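/- Let B_p be a random variable following the beta distribution β_{p,3/2}, with density x^{p−1}(1−x)^{1/2}/B(p,3/2) on (0,1). Then: (i) if 0 < p ≤ 1/2, for every real r with |r| ≥ 1 the law of B_p^r (the pushforward under x ↦ x^r) belongs to the class UI; and (ii) if p > 1/2, for every real r ≤ −1 the law of B_p^r belongs to the class UI. -/

import Mathlib

open MeasureTheory Set

/-- The Cauchy transform of a measure on `ℝ`, `G_μ(z) = ∫ (z-x)⁻¹ dμ(x)`. -/
noncomputable def cauchyTransform (μ : Measure ℝ) (z : ℂ) : ℂ :=
  ∫ x : ℝ, (z - (x : ℂ))⁻¹ ∂μ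

/-- The class UI: the right inverse of the Cauchy transform, defined on some triangular
domain `Λ_{γ,δ} = {w ∈ ℂ⁻ : γ|Re w| < -Im w, Im w > -δ}`, has a univalent (injective)
analytic continuation `F` to the whole lower half-plane. -/
def IsUI (μ : Measure ℝ) : Prop :=
  ∃ F : ℂ → ℂ,
    AnalyticOnNhd ℂ F {z : ℂ | z.im < 0} ∧
    Set.InjOn F {z : ℂ | z.im < 0} ∧
    ∃ γ : ℝ, 0 < γ ∧ ∃ δ : ℝ, 0 < δ ∧
      ∀ w : ℂ, γ * |w.re| < -w.im → -δ < w.im →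
        0 < (F w).im ∧ cauchyTransform μ (F w) = w

/-- The Beta function `B(p,q) = Γ(p)Γ(q)/Γ(p+q)`. -/
noncomputable def betaFun (p q : ℝ) : ℝ :=
  Real.Gamma p * Real.Gamma q / Real.Gamma (p + q)

/-- The beta distribution `β_{p,q}`: the probability measure on `(0,1)` with density
`x^{p-1}(1-x)^{q-1}/B(p,q)`. -/
noncomputable def betaMeasure (p q : ℝ) : Measure ℝ :=
  MeasureTheory.volume.withDensity
    (fun x => ENNReal.ofReal
      ((Set.Ioo (0 : ℝ) 1).indicator
        (fun x => x ^ (p - 1) * (1 - x) ^ (q - 1) / betaFun p q) x))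

open Filter Topology

/-- Near a critical point, a nonconstant analytic function takes every value close to (but
different from) the critical value at least twice. -/
theorem AnalyticAt.eventually_exists_two_preimages {g : ℂ → ℂ} {z₀ : ℂ} (hg : AnalyticAt ℂ g z₀)
    (hnc : ¬ ∀ᶠ z in 𝓝 z₀, g z = g z₀) (hd : deriv g z₀ = 0) {N : Set ℂ} (hN : N ∈ 𝓝 z₀) :
    ∀ᶠ w in 𝓝[≠] (g z₀), ∃ z₁ ∈ N, ∃ z₂ ∈ N, z₁ ≠ z₂ ∧ g z₁ = w ∧ g z₂ = w := by
  have hgs : AnalyticAt ℂ (fun z => g z - g z₀) z₀ := hg.sub analyticAt_const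
  have htop : analyticOrderAt (fun z => g z - g z₀) z₀ ≠ ⊤ := by
    intro h
    rw [analyticOrderAt_eq_top] at h
    exact hnc (h.mono fun z hz => sub_eq_zero.1 hz)
  obtain ⟨n, hn⟩ := ENat.ne_top_iff_exists.1 htop
  obtain ⟨q, hq, hq0, hqe⟩ := (hgs.analyticOrderAt_eq_natCast).1 hn.symm
  have hn2 : 2 ≤ n := by
    by_contra hlt
    have : n = 0 ∨ n = 1 := by omega
    rcases this with rfl | rfl
    · have := hqe.self_of_nhds
      simp at this
      exact hq0 this.symm
    · have h1 : HasDerivAt (fun z => (z - z₀) ^ 1 • q z) (q z₀) z₀ := by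
        have := ((hasDerivAt_id z₀).sub_const z₀).mul hq.differentiableAt.hasDerivAt
        simpa using! this
      have h2 := (h1.congr_of_eventuallyEq hqe).add_const (g z₀)
      simp only [sub_add_cancel] at h2
      rw [h2.deriv] at hd
      exact hq0 hd
  have hn0 : (n : ℂ) ≠ 0 := by
    have : n ≠ 0 := by omega
    exact_mod_cast this
  have hnn : n ≠ 0 := by omega
  set c : ℂ := (q z₀) ^ ((n : ℂ)⁻¹) with hc
  have hcn : c ^ n = q z₀ := Complex.cpow_nat_inv_pow _ hnn
  have hc0 : c ≠ 0 := by
    intro h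
    rw [h, zero_pow hnn] at hcn
    exact hq0 hcn.symm
  set H : ℂ → ℂ := fun z => (z - z₀) * (c * (q z / q z₀) ^ ((n : ℂ)⁻¹)) with hH
  have hHa : AnalyticAt ℂ H z₀ := by
    refine (analyticAt_id.sub analyticAt_const).mul (analyticAt_const.mul ?_)
    refine (hq.div analyticAt_const hq0).cpow analyticAt_const ?_
    simp [div_self hq0]
  have hHd : HasStrictDerivAt H c z₀ := by
    have h1 := hHa.hasStrictDerivAt
    have h2 : HasDerivAt H c z₀ := by
      have hk : AnalyticAt ℂ (fun z => c * (q z / q z₀) ^ ((n : ℂ)⁻¹)) z₀ := by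
        refine (analyticAt_const.mul ?_)
        refine (hq.div analyticAt_const hq0).cpow analyticAt_const ?_
        simp [div_self hq0]
      have := ((hasDerivAt_id z₀).sub_const z₀).mul hk.differentiableAt.hasDerivAt
      simpa [div_self hq0] using! this
    rwa [h2.deriv] at h1
  have hHpow : ∀ᶠ z in 𝓝 z₀, g z - g z₀ = H z ^ n := by
    filter_upwards [hqe] with z hz
    rw [hz, hH]
    simp only [smul_eq_mul, mul_pow, hcn, Complex.cpow_nat_inv_pow _ hnn]
    field_simp
  have hmap := hHd.map_nhds_eq hc0
  have hH0 : H z₀ = 0 := by simp [hH]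
  rw [hH0] at hmap
  have hS : H '' (N ∩ {z | g z - g z₀ = H z ^ n}) ∈ 𝓝 (0 : ℂ) := by
    rw [← hmap]
    exact image_mem_map (inter_mem hN hHpow)
  have hroot : Tendsto (fun w : ℂ => (w - g z₀) ^ ((n : ℂ)⁻¹)) (𝓝[≠] (g z₀)) (𝓝 0) := by
    have h0 : ContinuousAt (fun w : ℂ => w ^ ((n : ℂ)⁻¹)) 0 := by
      have := Complex.continuousAt_cpow_const_of_re_pos (z := 0) (w := (n : ℂ)⁻¹) (by simp) (by
        have : (0 : ℝ) < (n : ℝ)⁻¹ := by positivity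
        simpa using! this)
      exact this
    have h1 : Tendsto (fun w : ℂ => w - g z₀) (𝓝[≠] (g z₀)) (𝓝 0) := by
      have : Tendsto (fun w : ℂ => w - g z₀) (𝓝 (g z₀)) (𝓝 (g z₀ - g z₀)) :=
        (continuous_id.sub continuous_const).tendsto _
      rw [sub_self] at this
      exact this.mono_left nhdsWithin_le_nhds
    have h2 := h0.tendsto.comp h1
    rw [Complex.zero_cpow (by simpa using hn0)] at h2
    exact h2
  set ω : ℂ := Complex.exp (2 * Real.pi * Complex.I / n) with hω
  have hprim : IsPrimitiveRoot ω n := Complex.isPrimitiveRoot_exp n hnn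
  have hω1 : ω ≠ 1 := hprim.ne_one (by omega)
  have hroot2 : Tendsto (fun w : ℂ => ω * (w - g z₀) ^ ((n : ℂ)⁻¹)) (𝓝[≠] (g z₀)) (𝓝 0) := by
    simpa using hroot.const_mul ω
  filter_upwards [hroot hS, hroot2 hS, self_mem_nhdsWithin] with w h1 h2 hw
  obtain ⟨z₁, ⟨hz₁, hz₁'⟩, e₁⟩ := h1
  obtain ⟨z₂, ⟨hz₂, hz₂'⟩, e₂⟩ := h2
  have hv : ((w - g z₀) ^ ((n : ℂ)⁻¹)) ^ n = w - g z₀ := Complex.cpow_nat_inv_pow _ hnn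
  simp only [mem_ofPred_eq] at hz₁' hz₂'
  refine ⟨z₁, hz₁, z₂, hz₂, ?_, ?_, ?_⟩
  · rintro rfl
    rw [e₁] at e₂
    have hv0 : (w - g z₀) ^ ((n : ℂ)⁻¹) ≠ 0 := by
      intro h
      rw [h, zero_pow hnn] at hv
      exact hw (sub_eq_zero.1 hv.symm)
    exact hω1 (mul_right_cancel₀ hv0 (by rw [one_mul]; exact e₂.symm))
  · rw [e₁, hv] at hz₁'
    exact sub_left_injective hz₁'
  · rw [e₂, mul_pow, hprim.pow_eq_one, one_mul, hv] at hz₂'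
    exact sub_left_injective hz₂'

/-- A holomorphic map on `D` that is proper over a connected open set `V` and has a single simple
preimage over one point of `V` has an analytic inverse over `V`. -/
theorem exists_analytic_inverse_of_proper {D V : Set ℂ} {g : ℂ → ℂ} (hDo : IsOpen D)
    (hDc : IsPreconnected D) (hg : AnalyticOnNhd ℂ g D) (hVo : IsOpen V) (hVc : IsPreconnected V)
    (hprop : ∀ 𝒰 : Ultrafilter ℂ, D ∈ 𝒰 → ∀ w ∈ V, Tendsto g 𝒰 (𝓝 w) → ∃ z ∈ D, ↑𝒰 ≤ 𝓝 z)
    {w₀ : ℂ} (hw₀ : w₀ ∈ V)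
    (h0 : ∃ z ∈ D, g z = w₀ ∧ deriv g z ≠ 0 ∧ ∀ z' ∈ D, g z' = w₀ → z' = z) :
    ∃ F : ℂ → ℂ, AnalyticOnNhd ℂ F V ∧ (∀ w ∈ V, F w ∈ D ∧ g (F w) = w) ∧
      ∀ z ∈ D, g z ∈ V → F (g z) = z := by
  set T : Set ℂ :=
    {w | ∃ z ∈ D, g z = w ∧ deriv g z ≠ 0 ∧ ∀ z' ∈ D, g z' = w → z' = z} with hT
  have hlim : ∀ (𝒰 : Ultrafilter ℂ) (z : ℂ), z ∈ D → ↑𝒰 ≤ 𝓝 z → ∀ w, Tendsto g 𝒰 (𝓝 w) →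
      g z = w := by
    intro 𝒰 z hz hle w hw
    exact tendsto_nhds_unique ((hg z hz).continuousAt.tendsto.mono_left hle) hw
  have hnc : ∀ z ∈ D, ¬ ∀ᶠ z' in 𝓝 z, g z' = g z := by
    intro z hz hconst
    have heq := hg.eqOn_of_preconnected_of_eventuallyEq analyticOnNhd_const hDc hz hconst
    obtain ⟨z1, hz1, -, hd, -⟩ := h0
    apply hd
    have : g =ᶠ[𝓝 z1] fun _ => g z := by
      filter_upwards [hDo.mem_nhds hz1] with x hx using heq hx
    rw [this.deriv_eq]
    simp
  have hopen : ∀ z ∈ D, ∀ N ∈ 𝓝 z, g '' N ∈ 𝓝 (g z) := by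
    intro z hz N hN
    exact ((hg z hz).eventually_constant_or_nhds_le_map_nhds.resolve_left (hnc z hz))
      (image_mem_map hN)
  have hTo : IsOpen (T ∩ V) := by
    rw [isOpen_iff_mem_nhds]
    rintro w ⟨⟨z, hz, hgz, hd, huniq⟩, hwV⟩
    refine inter_mem ?_ (hVo.mem_nhds hwV)
    have hsd := (hg z hz).hasStrictDerivAt
    obtain ⟨N, hN, hinj⟩ : ∃ N ∈ 𝓝 z, InjOn g N := by
      refine ⟨_, ?_, (hsd.hasStrictFDerivAt_equiv hd).toOpenPartialHomeomorph g |>.injOn⟩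
      exact (OpenPartialHomeomorph.open_source _).mem_nhds
        (hsd.hasStrictFDerivAt_equiv hd).mem_toOpenPartialHomeomorph_source
    have hdcont : ∀ᶠ z' in 𝓝 z, deriv g z' ≠ 0 :=
      ((hg z hz).deriv.continuousAt).eventually_ne hd
    set N' := N ∩ D ∩ {z' | deriv g z' ≠ 0} with hN'
    have hN'm : N' ∈ 𝓝 z := inter_mem (inter_mem hN (hDo.mem_nhds hz)) hdcont
    by_contra hTn
    have hex : ∀ᶠ w' in 𝓝 w, ∃ z' ∈ N', g z' = w' := by
      have := hopen z hz N' hN'm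
      rw [hgz] at this
      exact this
    have hfreq : ∃ᶠ w' in 𝓝 w, ∃ z' ∈ D, g z' = w' ∧ z' ∉ N' := by
      have h1 : ∃ᶠ w' in 𝓝 w, w' ∉ T := fun h => hTn (by simpa using! h)
      refine (h1.and_eventually hex).mono ?_
      rintro w' ⟨hw', z', hz', rfl⟩
      by_contra! hcon
      refine hw' ⟨z', hz'.1.2, rfl, hz'.2, fun z'' hz'' he => ?_⟩
      exact hinj (hcon z'' hz'' he).1.1 hz'.1.1 he
    choose! ζ hζ using fun w' (h : ∃ z' ∈ D, g z' = w' ∧ z' ∉ N') => h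
    have : NeBot (𝓝 w ⊓ 𝓟 {w' | ∃ z' ∈ D, g z' = w' ∧ z' ∉ N'}) :=
      frequently_mem_iff_neBot.1 hfreq
    set 𝒱 := Ultrafilter.of (𝓝 w ⊓ 𝓟 {w' | ∃ z' ∈ D, g z' = w' ∧ z' ∉ N'})
    have hle : ↑𝒱 ≤ 𝓝 w ⊓ 𝓟 {w' | ∃ z' ∈ D, g z' = w' ∧ z' ∉ N'} := Ultrafilter.of_le _
    have hbad : ∀ᶠ w' in (𝒱 : Filter ℂ), ζ w' ∈ D ∧ g (ζ w') = w' ∧ ζ w' ∉ N' := by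
      filter_upwards [hle (mem_inf_of_right (mem_principal_self _))] with w' hw' using hζ w' hw'
    have hten : Tendsto g (𝒱.map ζ : Ultrafilter ℂ) (𝓝 w) := by
      rw [Ultrafilter.coe_map, tendsto_map'_iff]
      refine Tendsto.congr' (f₁ := id) ?_ (tendsto_id.mono_left (hle.trans inf_le_left))
      filter_upwards [hbad] with w' hw' using hw'.2.1.symm
    obtain ⟨z', hz'D, hz'⟩ := hprop (𝒱.map ζ) (hbad.mono fun w' h => h.1) w hwV hten
    have := huniq z' hz'D (hlim _ z' hz'D hz' w hten)
    subst this
    have h3 : ∀ᶠ w' in (𝒱 : Filter ℂ), ζ w' ∈ N' := hz' hN'm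
    obtain ⟨w', h4, h5⟩ := (h3.and hbad).exists
    exact h5.2.2 h4
  have hcl : closure (T ∩ V) ∩ V ⊆ T ∩ V := by
    rintro w ⟨hwc, hwV⟩
    by_contra hwT
    have hfreq : ∃ᶠ w' in 𝓝 w, w' ∈ T ∧ w' ∈ V := mem_closure_iff_frequently.1 hwc
    have hfreq' : ∃ᶠ w' in 𝓝[≠] w, w' ∈ T := by
      rw [frequently_nhdsWithin_iff]
      refine hfreq.mono fun w' h => ⟨h.1, ?_⟩
      rintro rfl
      exact hwT h
    choose! ζ hζ using fun w' (h : w' ∈ T) => h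
    obtain ⟨z, hzD, hgz⟩ : ∃ z ∈ D, g z = w := by
      have : NeBot (𝓝 w ⊓ 𝓟 T) := by
        exact frequently_mem_iff_neBot.1 (hfreq.mono fun w' h => h.1)
      set 𝒱 := Ultrafilter.of (𝓝 w ⊓ 𝓟 T)
      have hle : ↑𝒱 ≤ 𝓝 w ⊓ 𝓟 T := Ultrafilter.of_le _
      have hT' : ∀ᶠ w' in (𝒱 : Filter ℂ), w' ∈ T := hle (mem_inf_of_right (mem_principal_self _))
      have hten : Tendsto g (𝒱.map ζ : Ultrafilter ℂ) (𝓝 w) := by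
        rw [Ultrafilter.coe_map, tendsto_map'_iff]
        refine Tendsto.congr' (f₁ := id) ?_ (tendsto_id.mono_left (hle.trans inf_le_left))
        filter_upwards [hT'] with w' hw' using (hζ w' hw').2.1.symm
      obtain ⟨z, hzD, hz⟩ := hprop (𝒱.map ζ) (hT'.mono fun w' h => (hζ w' h).1) w hwV hten
      exact ⟨z, hzD, hlim _ z hzD hz w hten⟩
    refine hwT ⟨⟨z, hzD, hgz, ?_, ?_⟩, hwV⟩
    · intro hd
      have h2 := (hg z hzD).eventually_exists_two_preimages (hnc z hzD) hd (hDo.mem_nhds hzD)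
      rw [hgz] at h2
      obtain ⟨w', hw', z₁, h₁, z₂, h₂, hne, e₁, e₂⟩ := (hfreq'.and_eventually h2).exists
      exact hne (((hζ w' hw').2.2.2 z₁ h₁ e₁).trans ((hζ w' hw').2.2.2 z₂ h₂ e₂).symm)
    · intro z' hz'D hgz'
      by_contra hne
      obtain ⟨N', N, hN'o, hNo, hzN', hzN, hdisj⟩ := t2_separation hne
      have h1 := hopen z hzD (N ∩ D) (inter_mem (hNo.mem_nhds hzN) (hDo.mem_nhds hzD))
      have h2 := hopen z' hz'D (N' ∩ D) (inter_mem (hN'o.mem_nhds hzN') (hDo.mem_nhds hz'D))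
      rw [hgz] at h1
      rw [hgz'] at h2
      obtain ⟨w', ⟨hw', -⟩, ⟨z₁, h₁, e₁⟩, ⟨z₂, h₂, e₂⟩⟩ :=
        (hfreq.and_eventually (inter_mem h1 h2)).exists
      have : z₁ = z₂ :=
        ((hζ w' hw').2.2.2 z₁ h₁.2 e₁).trans ((hζ w' hw').2.2.2 z₂ h₂.2 e₂).symm
      subst this
      exact hdisj.le_bot ⟨h₂.1, h₁.1⟩
  have hVT : V ⊆ T := fun w hw =>
    (hVc.subset_of_closure_inter_subset hTo ⟨w₀, hw₀, h0, hw₀⟩ hcl hw).1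
  choose! F hF using fun w (h : w ∈ T) => h
  have hleft : ∀ z ∈ D, g z ∈ V → F (g z) = z := fun z hz hV =>
    ((hF _ (hVT hV)).2.2.2 z hz rfl).symm
  refine ⟨F, ?_, fun w hw => ⟨(hF w (hVT hw)).1, (hF w (hVT hw)).2.1⟩, hleft⟩
  have hcont : ∀ w ∈ V, ContinuousAt F w := by
    intro w hw
    rw [ContinuousAt, tendsto_iff_ultrafilter]
    intro 𝒱 hle
    have hV' : ∀ᶠ w' in (𝒱 : Filter ℂ), w' ∈ V := hle (hVo.mem_nhds hw)
    have hten : Tendsto g (𝒱.map F : Ultrafilter ℂ) (𝓝 w) := by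
      rw [Ultrafilter.coe_map, tendsto_map'_iff]
      refine Tendsto.congr' (f₁ := id) ?_ (tendsto_id.mono_left hle)
      filter_upwards [hV'] with w' hw' using (hF w' (hVT hw')).2.1.symm
    obtain ⟨z, hzD, hz⟩ := hprop (𝒱.map F) (hV'.mono fun w' h => (hF w' (hVT h)).1) w hw hten
    have hgz := hlim _ z hzD hz w hten
    have : F w = z := by rw [← hgz]; exact hleft z hzD (hgz ▸ hw)
    rw [this]
    exact hz
  have hdiff : DifferentiableOn ℂ F V := by
    intro w hw
    have hs := (hg _ (hF w (hVT hw)).1).hasStrictDerivAt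
    have := hs.of_local_left_inverse (hcont w hw) (hF w (hVT hw)).2.2.1 (by
      filter_upwards [hVo.mem_nhds hw] with w' hw' using (hF w' (hVT hw')).2.1)
    exact this.hasDerivAt.differentiableAt.differentiableWithinAt
  exact hdiff.analyticOnNhd hVo

/-- The part near which a function behaving like `c₀ z ^ (-α)` is studied: a sector. -/
def cSector (b₁ b₂ : ℝ) : Set ℂ := {z : ℂ | z ≠ 0 ∧ z.arg ∈ Ioo b₁ b₂}

theorem cSector_subset_slitPlane {b₁ b₂ : ℝ} (hb₂ : b₂ ≤ Real.pi) :
    cSector b₁ b₂ ⊆ Complex.slitPlane := fun _ hz =>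
  Complex.mem_slitPlane_iff_arg.2 ⟨(hz.2.2.trans_le hb₂).ne, hz.1⟩

theorem isOpen_cSector {b₁ b₂ : ℝ} (hb₂ : b₂ ≤ Real.pi) : IsOpen (cSector b₁ b₂) := by
  rw [isOpen_iff_mem_nhds]
  intro z hz
  have h1 := (Complex.continuousAt_arg (cSector_subset_slitPlane hb₂ hz)).eventually_mem
    (isOpen_Ioo.mem_nhds hz.2)
  filter_upwards [h1, isOpen_ne.mem_nhds hz.1] with w h1 h2 using ⟨h2, h1⟩

theorem ofReal_mul_mem_cSector {b₁ b₂ t : ℝ} (ht : 0 < t) {z : ℂ} (hz : z ∈ cSector b₁ b₂) :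
    (t : ℂ) * z ∈ cSector b₁ b₂ :=
  ⟨mul_ne_zero (by exact_mod_cast ht.ne') hz.1, by
    rw [Complex.arg_real_mul _ ht]; exact hz.2⟩

theorem Complex.ofReal_mul_cpow {t : ℝ} (ht : 0 < t) (z : ℂ) (hz : z ≠ 0) (s : ℂ) :
    ((t : ℂ) * z) ^ s = (t : ℂ) ^ s * z ^ s := by
  have ht' : (t : ℂ) ≠ 0 := by exact_mod_cast ht.ne'
  rw [Complex.cpow_def_of_ne_zero (mul_ne_zero ht' hz), Complex.cpow_def_of_ne_zero ht',
    Complex.cpow_def_of_ne_zero hz, ← Complex.exp_add, Complex.log_ofReal_mul ht hz,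
    Complex.ofReal_log ht.le]
  ring_nf

/-- A function equivalent to `c₀ z ^ (-α)` at `0` in a sector is, at every small scale, injective
without critical points near each given interior direction. -/
theorem eventually_injOn_of_tendsto_cpow_mul {g : ℂ → ℂ} {b₁ b₂ η₀ α : ℝ} {c₀ : ℂ}
    {D : Set ℂ} (hg : AnalyticOnNhd ℂ g D)
    (hb₁ : -Real.pi ≤ b₁) (hb₂ : b₂ ≤ Real.pi) (hη₀ : η₀ ∈ Ioo b₁ b₂) (hα : 0 < α) (hc₀ : c₀ ≠ 0)
    (hD : ∀ᶠ z in 𝓝 (0 : ℂ), z ∈ cSector b₁ b₂ → z ∈ D)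
    (hlim : Tendsto (fun z => z ^ (α : ℂ) * g z) (𝓝[cSector b₁ b₂] 0) (𝓝 c₀)) :
    ∃ δ > 0, ∀ᶠ t : ℝ in 𝓝[>] 0, ∀ ξ ∈ Metric.ball (Complex.exp (η₀ * Complex.I)) δ,
      deriv g (t * ξ) ≠ 0 ∧ ∀ ξ' ∈ Metric.ball (Complex.exp (η₀ * Complex.I)) δ,
        g (t * ξ) = g (t * ξ') → ξ = ξ' := by
  set ξ₀ := Complex.exp (η₀ * Complex.I) with hξ₀
  have hξ₀n : ‖ξ₀‖ = 1 := Complex.norm_exp_ofReal_mul_I η₀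
  have harg : ξ₀.arg = η₀ := by
    rw [hξ₀, Complex.arg_exp_mul_I]
    rw [toIocMod_eq_self]
    exact ⟨by linarith [hη₀.1], by linarith [hη₀.2]⟩
  have hξ₀S : ξ₀ ∈ cSector b₁ b₂ := ⟨Complex.exp_ne_zero _, by rw [harg]; exact hη₀⟩
  obtain ⟨d, hd, hdS⟩ := Metric.isOpen_iff.1 (isOpen_cSector (b₁ := b₁) hb₂) ξ₀ hξ₀S
  set d₀ := min d (1 / 2) with hd₀
  have hd₀p : 0 < d₀ := lt_min hd (by norm_num)
  set U := Metric.ball ξ₀ d₀ with hU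
  have hUS : U ⊆ cSector b₁ b₂ := (Metric.ball_subset_ball (min_le_left _ _)).trans hdS
  have hUn : ∀ ξ ∈ U, 1 / 2 ≤ ‖ξ‖ ∧ ‖ξ‖ ≤ 2 := by
    intro ξ hξ
    have h1 : ‖ξ - ξ₀‖ < 1 / 2 := (mem_ball_iff_norm.1 hξ).trans_le (min_le_right _ _)
    have h2 := norm_sub_norm_le ξ₀ ξ
    have h3 := norm_sub_norm_le ξ ξ₀
    rw [norm_sub_rev] at h2
    constructor <;> linarith
  have hsmall : ∀ N ∈ 𝓝 (0 : ℂ), ∀ᶠ t : ℝ in 𝓝[>] 0, ∀ ξ ∈ U, (t : ℂ) * ξ ∈ N := by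
    intro N hN
    obtain ⟨r, hr, hrN⟩ := Metric.mem_nhds_iff.1 hN
    have : Ioo (0 : ℝ) (r / 2) ∈ 𝓝[>] (0 : ℝ) := Ioo_mem_nhdsGT (by positivity)
    filter_upwards [this] with t ht ξ hξ
    apply hrN
    rw [mem_ball_zero_iff, norm_mul, Complex.norm_real, Real.norm_of_nonneg ht.1.le]
    have := (hUn ξ hξ).2
    have := ht.2
    have := ht.1
    nlinarith
  have hUD : ∀ᶠ t : ℝ in 𝓝[>] 0, ∀ ξ ∈ U, (t : ℂ) * ξ ∈ D := by
    filter_upwards [hsmall _ hD, self_mem_nhdsWithin] with t h ht ξ hξ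
    exact h ξ hξ (ofReal_mul_mem_cSector ht (hUS hξ))
  set F : ℝ → ℂ → ℂ := fun t ξ => (t : ℂ) ^ (α : ℂ) * g (t * ξ) with hF
  set f : ℂ → ℂ := fun ξ => c₀ * ξ ^ (-α : ℂ) with hf
  have hFd : ∀ᶠ t : ℝ in 𝓝[>] 0, DifferentiableOn ℂ (F t) U := by
    filter_upwards [hUD] with t ht ξ hξ
    have h1 : DifferentiableAt ℂ g (t * ξ) := (hg _ (ht ξ hξ)).differentiableAt
    have h2 : DifferentiableAt ℂ (fun ξ : ℂ => (t : ℂ) * ξ) ξ := by fun_prop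
    exact ((h1.comp ξ h2).const_mul _).differentiableWithinAt
  have hunif : TendstoUniformlyOn F f (𝓝[>] 0) U := by
    rw [Metric.tendstoUniformlyOn_iff]
    intro ε hε
    set C : ℝ := 2 ^ α with hC
    have hCp : 0 < C := by positivity
    have h1 := hlim (Metric.ball_mem_nhds c₀ (div_pos hε hCp))
    rw [mem_map, mem_nhdsWithin_iff_eventually] at h1
    filter_upwards [hsmall _ h1, self_mem_nhdsWithin] with t ht htp ξ hξ
    have h2 := ht ξ hξ (ofReal_mul_mem_cSector htp (hUS hξ))
    rw [mem_preimage, mem_ball_iff_norm] at h2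
    have hξ0 : ξ ≠ 0 := (hUS hξ).1
    have h3 : F t ξ - f ξ = ξ ^ (-α : ℂ) * (((t : ℂ) * ξ) ^ (α : ℂ) * g (t * ξ) - c₀) := by
      rw [Complex.ofReal_mul_cpow htp ξ hξ0, Complex.cpow_neg, hF, hf]
      have : ξ ^ (α : ℂ) ≠ 0 := by simp [Complex.cpow_eq_zero_iff, hξ0]
      simp only [Complex.cpow_neg]
      field_simp
    have h4 : ‖ξ ^ (-α : ℂ)‖ ≤ C := by
      have := Complex.norm_cpow_real ξ (-α)
      rw [Complex.ofReal_neg] at this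
      rw [this, hC, Real.rpow_neg (norm_nonneg _), ← Real.inv_rpow (norm_nonneg _)]
      apply Real.rpow_le_rpow (by positivity) _ hα.le
      rw [inv_le_comm₀ (norm_pos_iff.2 hξ0) (by norm_num)]
      have := (hUn ξ hξ).1
      linarith
    rw [dist_comm, dist_eq_norm, h3, norm_mul]
    calc _ ≤ C * ‖((t : ℂ) * ξ) ^ (α : ℂ) * g (t * ξ) - c₀‖ := by gcongr
      _ < C * (ε / C) := by gcongr
      _ = ε := by field_simp
  have hder := hunif.tendstoLocallyUniformlyOn.deriv hFd Metric.isOpen_ball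
  set L : ℂ := deriv f ξ₀ with hL
  have hfd : ∀ ξ ∈ U, HasDerivAt f (c₀ * ((-α : ℂ) * ξ ^ (-α - 1 : ℂ))) ξ := by
    intro ξ hξ
    have := ((hasDerivAt_id ξ).cpow_const (c := (-α : ℂ))
      (cSector_subset_slitPlane hb₂ (hUS hξ))).const_mul c₀
    simpa using! this
  have hξ₀U : ξ₀ ∈ U := Metric.mem_ball_self hd₀p
  have hL0 : 0 < ‖L‖ := by
    rw [norm_pos_iff, hL, (hfd ξ₀ hξ₀U).deriv]
    have : ξ₀ ≠ 0 := hξ₀S.1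
    have : (α : ℂ) ≠ 0 := by exact_mod_cast hα.ne'
    simp [Complex.cpow_eq_zero_iff, *]
  have hfa : DifferentiableOn ℂ f U := fun ξ hξ =>
    (hfd ξ hξ).differentiableAt.differentiableWithinAt
  have hdc : ContinuousAt (deriv f) ξ₀ :=
    ((hfa.analyticOnNhd Metric.isOpen_ball) ξ₀ hξ₀U).deriv.continuousAt
  have hnear : ∀ᶠ ξ in 𝓝 ξ₀, ‖deriv f ξ - L‖ < ‖L‖ / 4 := by
    have := hdc (Metric.ball_mem_nhds _ (show 0 < ‖L‖ / 4 by positivity))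
    filter_upwards [this] with ξ hξ
    exact mem_ball_iff_norm.1 hξ
  rw [Metric.tendstoLocallyUniformlyOn_iff] at hder
  obtain ⟨W, hW, hWt⟩ := hder (‖L‖ / 4) (by positivity) ξ₀ hξ₀U
  rw [Metric.isOpen_ball.nhdsWithin_eq hξ₀U] at hW
  obtain ⟨δ, hδ, hδs⟩ := Metric.mem_nhds_iff.1
    (inter_mem (inter_mem hW hnear) (Metric.isOpen_ball.mem_nhds hξ₀U))
  refine ⟨δ, hδ, ?_⟩
  filter_upwards [hWt, hFd, hUD, self_mem_nhdsWithin] with t h1 h2 h3 ht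
  have hdiff : ∀ ξ ∈ Metric.ball ξ₀ δ, DifferentiableAt ℂ (F t) ξ := fun ξ hξ =>
    h2.differentiableAt (Metric.isOpen_ball.mem_nhds (hδs hξ).2)
  have key : ∀ ξ ∈ Metric.ball ξ₀ δ, ‖deriv (F t) ξ - L‖ ≤ ‖L‖ / 2 := by
    intro ξ hξ
    obtain ⟨⟨h4, h5⟩, -⟩ := hδs hξ
    have h6 := h1 ξ h4
    rw [dist_comm, dist_eq_norm, Function.comp_apply] at h6
    calc ‖deriv (F t) ξ - L‖ = ‖(deriv (F t) ξ - deriv f ξ) + (deriv f ξ - L)‖ := by ring_nf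
      _ ≤ _ := norm_add_le _ _
      _ ≤ ‖L‖ / 2 := by linarith [show ‖deriv f ξ - L‖ < ‖L‖ / 4 from h5]
  intro ξ hξ
  constructor
  · intro h0
    have h7 : HasDerivAt (F t) 0 ξ := by
      have ha : HasDerivAt g (deriv g (t * ξ)) (t * ξ) :=
        (hg _ (h3 ξ (hδs hξ).2)).differentiableAt.hasDerivAt
      have hb : HasDerivAt (fun ξ : ℂ => (t : ℂ) * ξ) t ξ := by
        simpa using (hasDerivAt_id ξ).const_mul (t : ℂ)
      have := (ha.comp ξ hb).const_mul ((t : ℂ) ^ (α : ℂ))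
      rw [h0] at this
      simpa using! this
    have h8 := key ξ hξ
    rw [h7.deriv, zero_sub, norm_neg] at h8
    linarith
  · intro ξ' hξ' he
    have h9 : ‖(F t ξ' - L * ξ') - (F t ξ - L * ξ)‖ ≤ ‖L‖ / 2 * ‖ξ' - ξ‖ := by
      refine (convex_ball ξ₀ δ).norm_image_sub_le_of_norm_deriv_le (f := fun ξ => F t ξ - L * ξ)
        (fun x hx => ?_) (fun x hx => ?_) hξ hξ'
      · exact (hdiff x hx).sub (by fun_prop)
      · have : HasDerivAt (fun ξ => F t ξ - L * ξ) (deriv (F t) x - L) x := by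
          simpa using! (hdiff x hx).hasDerivAt.sub ((hasDerivAt_id x).const_mul L)
        rw [this.deriv]
        exact key x hx
    have h10 : F t ξ' = F t ξ := by simp only [hF, he]
    rw [h10, show F t ξ - L * ξ' - (F t ξ - L * ξ) = L * (ξ - ξ') by ring, norm_mul,
      norm_sub_rev ξ'] at h9
    by_contra hne
    have : 0 < ‖ξ - ξ'‖ := norm_pos_iff.2 (sub_ne_zero.2 hne)
    nlinarith

/-- Preimages of `-iy` tending to `0` have asymptotically determined modulus and argument. -/
theorem tendsto_of_tendsto_cpow_mul {g : ℂ → ℂ} {b₁ b₂ η₀ α : ℝ} {c₀ : ℂ}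
    (hc₀ : c₀ ≠ 0)
    (hlim : Tendsto (fun z => z ^ (α : ℂ) * g z) (𝓝[cSector b₁ b₂] 0) (𝓝 c₀))
    (hdir : ∀ η ∈ Icc b₁ b₂, Complex.exp ((α * η : ℝ) * Complex.I) * (-Complex.I) = c₀ / ‖c₀‖ →
      η = η₀)
    (𝒱 : Ultrafilter ℝ) (h𝒱 : ↑𝒱 ≤ (atTop : Filter ℝ)) {ζ : ℝ → ℂ}
    (hζ : Tendsto ζ 𝒱 (𝓝[cSector b₁ b₂] 0)) (hgζ : ∀ᶠ y in 𝒱, g (ζ y) = -(y * Complex.I)) :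
    Tendsto (fun y => (ζ y).arg) 𝒱 (𝓝 η₀) ∧
      Tendsto (fun y => ‖ζ y‖ ^ α * y) 𝒱 (𝓝 ‖c₀‖) := by
  have hS : ∀ᶠ y in 𝒱, ζ y ∈ cSector b₁ b₂ :=
    hζ (show cSector b₁ b₂ ∈ 𝓝[cSector b₁ b₂] (0 : ℂ) from self_mem_nhdsWithin)
  have hpos : ∀ᶠ y : ℝ in 𝒱, 0 < y := h𝒱 (Ioi_mem_atTop 0)
  have h1 : Tendsto (fun y : ℝ => ((‖ζ y‖ ^ α * y : ℝ) : ℂ) *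
      (Complex.exp ((α * (ζ y).arg : ℝ) * Complex.I) * (-Complex.I))) 𝒱 (𝓝 c₀) := by
    refine (hlim.comp hζ).congr' ?_
    filter_upwards [hS, hgζ] with y hy hgy
    have hz := hy.1
    simp only [Function.comp_apply]
    rw [hgy, Complex.cpow_def_of_ne_zero hz, Complex.log, add_mul, Complex.exp_add,
      ← Complex.ofReal_mul, ← Complex.ofReal_exp, mul_comm (Real.log _),
      show Real.exp (α * Real.log ‖ζ y‖) = ‖ζ y‖ ^ α by
        rw [Real.rpow_def_of_pos (norm_pos_iff.2 hz), mul_comm]]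
    push_cast
    ring_nf
  have h2 : Tendsto (fun y => ‖ζ y‖ ^ α * y) 𝒱 (𝓝 ‖c₀‖) := by
    refine h1.norm.congr' ?_
    filter_upwards [hpos] with y hy
    have : 0 ≤ ‖ζ y‖ ^ α * y := by positivity
    rw [norm_mul, norm_mul, Complex.norm_real, Complex.norm_exp_ofReal_mul_I, norm_neg,
      Complex.norm_I, Real.norm_of_nonneg this]
    ring
  refine ⟨?_, h2⟩
  have h3 : Tendsto (fun y : ℝ => Complex.exp ((α * (ζ y).arg : ℝ) * Complex.I) * (-Complex.I))
      𝒱 (𝓝 (c₀ / ‖c₀‖)) := by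
    have hc : ((‖c₀‖ : ℝ) : ℂ) ≠ 0 := by exact_mod_cast (norm_pos_iff.2 hc₀).ne'
    have := h1.div ((Complex.continuous_ofReal.tendsto _).comp h2) hc
    refine this.congr' ?_
    filter_upwards [hpos, hS] with y hy hyS
    have hne : ((‖ζ y‖ ^ α * y : ℝ) : ℂ) ≠ 0 := by
      have := norm_pos_iff.2 hyS.1
      have : 0 < ‖ζ y‖ ^ α * y := by positivity
      exact_mod_cast this.ne'
    simp only [Function.comp_apply, Pi.div_apply]
    rw [mul_div_right_comm, div_self hne, one_mul]
  have hI : ∀ᶠ y in 𝒱, (ζ y).arg ∈ Icc b₁ b₂ := by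
    filter_upwards [hS] with y hy using Ioo_subset_Icc_self hy.2
  obtain ⟨η, hηI, hη⟩ := isCompact_Icc.ultrafilter_le_nhds (𝒱.map fun y => (ζ y).arg)
    (le_principal_iff.2 hI)
  have hη' : Tendsto (fun y => (ζ y).arg) 𝒱 (𝓝 η) := hη
  have h4 : Tendsto (fun y : ℝ => Complex.exp ((α * (ζ y).arg : ℝ) * Complex.I) * (-Complex.I))
      𝒱 (𝓝 (Complex.exp ((α * η : ℝ) * Complex.I) * (-Complex.I))) := by
    have hcont : Continuous fun x : ℝ =>
      Complex.exp ((α * x : ℝ) * Complex.I) * (-Complex.I) := by fun_prop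
    exact (hcont.tendsto η).comp hη'
  rw [← hdir η hηI (tendsto_nhds_unique h4 h3)]
  exact hη'

/-- If `g(z) = -iy` has solutions for all `y > 0`, which must escape to `0` in a sector where
`g(z) ~ c₀ z ^ (-α)`, then for some `y` there is exactly one, and it is simple. -/
theorem exists_unique_simple_preimage {g : ℂ → ℂ} {b₁ b₂ η₀ α : ℝ} {c₀ : ℂ}
    {D : Set ℂ} (hg : AnalyticOnNhd ℂ g D)
    (hb₁ : -Real.pi ≤ b₁) (hb₂ : b₂ ≤ Real.pi) (hη₀ : η₀ ∈ Ioo b₁ b₂) (hα : 0 < α) (hc₀ : c₀ ≠ 0)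
    (hD : ∀ᶠ z in 𝓝 (0 : ℂ), z ∈ cSector b₁ b₂ → z ∈ D)
    (hlim : Tendsto (fun z => z ^ (α : ℂ) * g z) (𝓝[cSector b₁ b₂] 0) (𝓝 c₀))
    (hdir : ∀ η ∈ Icc b₁ b₂, Complex.exp ((α * η : ℝ) * Complex.I) * (-Complex.I) = c₀ / ‖c₀‖ →
      η = η₀)
    (hesc : ∀ 𝒰 : Ultrafilter ℂ, D ∈ 𝒰 → Tendsto (fun z => (g z).im) 𝒰 atBot →
      ↑𝒰 ≤ 𝓝[cSector b₁ b₂] (0 : ℂ))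
    (hsurj : ∀ w : ℂ, w.im < 0 → ∃ z ∈ D, g z = w) :
    ∃ w : ℂ, w.im < 0 ∧ ∃ z ∈ D, g z = w ∧ deriv g z ≠ 0 ∧ ∀ z' ∈ D, g z' = w → z' = z := by
  by_contra! hcon
  have hex : ∀ y : ℝ, ∃ z z' : ℂ, 0 < y → z ∈ D ∧ z' ∈ D ∧ g z = -(y * Complex.I) ∧
      g z' = -(y * Complex.I) ∧ (deriv g z ≠ 0 → z' ≠ z) := by
    intro y
    by_cases hy : 0 < y
    · have hw : (-(y * Complex.I)).im < 0 := by simpa using hy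
      obtain ⟨z, hz, hgz⟩ := hsurj _ hw
      by_cases hd : deriv g z = 0
      · exact ⟨z, z, fun _ => ⟨hz, hz, hgz, hgz, fun h => (h hd).elim⟩⟩
      · obtain ⟨z', hz', hgz', hne⟩ := hcon _ hw z hz hgz hd
        exact ⟨z, z', fun _ => ⟨hz, hz', hgz, hgz', fun _ => hne⟩⟩
    · exact ⟨0, 0, fun h => (hy h).elim⟩
  choose ζ ζ' hζ using hex
  set 𝒱 : Ultrafilter ℝ := Ultrafilter.of atTop
  have h𝒱 : ↑𝒱 ≤ (atTop : Filter ℝ) := Ultrafilter.of_le _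
  have hall : ∀ᶠ y : ℝ in 𝒱, 0 < y := h𝒱 (Ioi_mem_atTop 0)
  have hto : ∀ ξ : ℝ → ℂ, (∀ᶠ y in 𝒱, ξ y ∈ D ∧ g (ξ y) = -(y * Complex.I)) →
      Tendsto ξ 𝒱 (𝓝[cSector b₁ b₂] 0) := by
    intro ξ hξ
    refine hesc (𝒱.map ξ) (hξ.mono fun y h => h.1) ?_
    rw [Ultrafilter.coe_map, tendsto_map'_iff]
    refine (tendsto_neg_atTop_atBot.mono_left h𝒱).congr' ?_
    filter_upwards [hξ] with y hy
    simp [hy.2]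
  have e₁ : ∀ᶠ y in 𝒱, ζ y ∈ D ∧ g (ζ y) = -(y * Complex.I) :=
    hall.mono fun y hy => ⟨(hζ y hy).1, (hζ y hy).2.2.1⟩
  have e₂ : ∀ᶠ y in 𝒱, ζ' y ∈ D ∧ g (ζ' y) = -(y * Complex.I) :=
    hall.mono fun y hy => ⟨(hζ y hy).2.1, (hζ y hy).2.2.2.1⟩
  have t₁ := hto ζ e₁
  have t₂ := hto ζ' e₂
  obtain ⟨a₁, m₁⟩ := tendsto_of_tendsto_cpow_mul hc₀ hlim hdir 𝒱 h𝒱 t₁ (e₁.mono fun _ h => h.2)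
  obtain ⟨a₂, m₂⟩ := tendsto_of_tendsto_cpow_mul hc₀ hlim hdir 𝒱 h𝒱 t₂ (e₂.mono fun _ h => h.2)
  have hn₁ : ∀ᶠ y in 𝒱, 0 < ‖ζ y‖ := by
    have : ∀ᶠ y in 𝒱, ζ y ∈ cSector b₁ b₂ :=
      t₁ (show cSector b₁ b₂ ∈ 𝓝[cSector b₁ b₂] (0 : ℂ) from self_mem_nhdsWithin)
    exact this.mono fun y hy => norm_pos_iff.2 hy.1
  have hratio : Tendsto (fun y => ‖ζ' y‖ / ‖ζ y‖) 𝒱 (𝓝 1) := by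
    have h1 := m₂.div m₁ (norm_pos_iff.2 hc₀).ne'
    rw [div_self (norm_pos_iff.2 hc₀).ne'] at h1
    have h2 := h1.rpow_const (p := α⁻¹) (Or.inl one_ne_zero)
    rw [Real.one_rpow] at h2
    refine h2.congr' ?_
    filter_upwards [hall, hn₁] with y hy hn
    simp only [Pi.div_apply]
    rw [mul_div_mul_right _ _ hy.ne', ← Real.div_rpow (norm_nonneg _) (norm_nonneg _),
      ← Real.rpow_mul (by positivity), mul_inv_cancel₀ hα.ne', Real.rpow_one]
  have hexp : Continuous fun x : ℝ => Complex.exp (x * Complex.I) := by fun_prop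
  have u₁ : Tendsto (fun y => Complex.exp ((ζ y).arg * Complex.I)) 𝒱
      (𝓝 (Complex.exp (η₀ * Complex.I))) := (hexp.tendsto η₀).comp a₁
  have u₂ : Tendsto (fun y => ((‖ζ' y‖ / ‖ζ y‖ : ℝ) : ℂ) * Complex.exp ((ζ' y).arg * Complex.I)) 𝒱
      (𝓝 (Complex.exp (η₀ * Complex.I))) := by
    have := ((Complex.continuous_ofReal.tendsto _).comp hratio).mul ((hexp.tendsto η₀).comp a₂)
    simpa using! this
  obtain ⟨δ, hδ, hinj⟩ := eventually_injOn_of_tendsto_cpow_mul hg hb₁ hb₂ hη₀ hα hc₀ hD hlim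
  have hnorm : Tendsto (fun y => ‖ζ y‖) 𝒱 (𝓝[>] 0) := by
    refine tendsto_nhdsWithin_iff.2 ⟨?_, hn₁⟩
    simpa using (t₁.mono_right nhdsWithin_le_nhds).norm
  obtain ⟨y, hy, hn, h1, h2, h3⟩ := (hall.and (hn₁.and ((hnorm.eventually hinj).and
    ((u₁.eventually_mem (Metric.ball_mem_nhds _ hδ)).and
      (u₂.eventually_mem (Metric.ball_mem_nhds _ hδ)))))).exists
  have hz₁ : (‖ζ y‖ : ℂ) * Complex.exp ((ζ y).arg * Complex.I) = ζ y :=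
    Complex.norm_mul_exp_arg_mul_I _
  have hz₂ : (‖ζ y‖ : ℂ) * (((‖ζ' y‖ / ‖ζ y‖ : ℝ) : ℂ) * Complex.exp ((ζ' y).arg * Complex.I))
      = ζ' y := by
    have : (‖ζ y‖ : ℂ) ≠ 0 := by exact_mod_cast hn.ne'
    conv_rhs => rw [← Complex.norm_mul_exp_arg_mul_I (ζ' y)]
    push_cast
    field_simp
  obtain ⟨hd, hi⟩ := h1 _ h2
  rw [hz₁] at hd hi
  obtain ⟨-, -, g₁, g₂, hne⟩ := hζ y hy
  have := hi _ h3 (by rw [hz₂, g₁, g₂])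
  refine hne hd ?_
  rw [← hz₁, ← hz₂, ← this]

theorem isOpen_lowerHalfPlane : IsOpen {z : ℂ | z.im < 0} :=
  isOpen_lt Complex.continuous_im continuous_const

theorem nhdsWithin_cSector_neBot {b₁ b₂ η₀ : ℝ} (hb₁ : -Real.pi ≤ b₁) (hb₂ : b₂ ≤ Real.pi)
    (hη₀ : η₀ ∈ Ioo b₁ b₂) : NeBot (𝓝[cSector b₁ b₂] (0 : ℂ)) := by
  have h1 : Tendsto (fun t : ℝ => (t : ℂ) * Complex.exp (η₀ * Complex.I)) (𝓝[>] 0)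
      (𝓝[cSector b₁ b₂] 0) := by
    refine tendsto_nhdsWithin_iff.2 ⟨?_, ?_⟩
    · have : Continuous fun t : ℝ => (t : ℂ) * Complex.exp (η₀ * Complex.I) := by fun_prop
      have := this.tendsto 0
      simp only [Complex.ofReal_zero, zero_mul] at this
      exact this.mono_left nhdsWithin_le_nhds
    · filter_upwards [self_mem_nhdsWithin] with t ht
      refine ofReal_mul_mem_cSector ht ⟨Complex.exp_ne_zero _, ?_⟩
      rw [Complex.arg_exp_mul_I, (toIocMod_eq_self _).2]
      · exact hη₀
      · exact ⟨by linarith [hη₀.1], by linarith [hη₀.2]⟩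
  exact h1.neBot

/-- A holomorphic function on `D` which, at the boundary, either has asymptotically nonnegative
imaginary part or behaves like `c₀ z ^ (-α)` in a sector at `0`, has an analytic inverse over the
lower half-plane. -/
theorem exists_analytic_inverse_lowerHalfPlane {g : ℂ → ℂ} {b₁ b₂ η₀ α : ℝ} {c₀ : ℂ}
    {D : Set ℂ} (hDo : IsOpen D) (hDc : IsPreconnected D) (hg : AnalyticOnNhd ℂ g D)
    (hb₁ : -Real.pi ≤ b₁) (hb₂ : b₂ ≤ Real.pi) (hη₀ : η₀ ∈ Ioo b₁ b₂) (hα : 0 < α) (hc₀ : c₀ ≠ 0)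
    (hD : ∀ᶠ z in 𝓝 (0 : ℂ), z ∈ cSector b₁ b₂ → z ∈ D)
    (hlim : Tendsto (fun z => z ^ (α : ℂ) * g z) (𝓝[cSector b₁ b₂] 0) (𝓝 c₀))
    (hdir : ∀ η ∈ Icc b₁ b₂, Complex.exp ((α * η : ℝ) * Complex.I) * (-Complex.I) = c₀ / ‖c₀‖ →
      η = η₀)
    (hbd : ∀ 𝒰 : Ultrafilter ℂ, D ∈ 𝒰 → (∃ z ∈ D, ↑𝒰 ≤ 𝓝 z) ∨
      (∀ ε > 0, ∀ᶠ z in 𝒰, -ε < (g z).im) ∨ ↑𝒰 ≤ 𝓝[cSector b₁ b₂] (0 : ℂ))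
    (hne : ∃ z ∈ D, (g z).im < 0) :
    ∃ F : ℂ → ℂ, AnalyticOnNhd ℂ F {z | z.im < 0} ∧ (∀ w, w.im < 0 → F w ∈ D ∧ g (F w) = w) ∧
      ∀ z ∈ D, (g z).im < 0 → F (g z) = z := by
  have hnb := nhdsWithin_cSector_neBot hb₁ hb₂ hη₀
  have hcpow : Tendsto (fun z : ℂ => z ^ (α : ℂ)) (𝓝[cSector b₁ b₂] 0) (𝓝 0) := by
    have h1 := (Complex.continuousAt_cpow_const_of_re_pos (z := 0) (w := (α : ℂ)) (by simp)
      (by simpa using hα)).tendsto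
    rw [Complex.zero_cpow (by exact_mod_cast hα.ne')] at h1
    exact h1.mono_left nhdsWithin_le_nhds
  have hnolim : ∀ (l : Filter ℂ) [NeBot l], l ≤ 𝓝[cSector b₁ b₂] (0 : ℂ) → ∀ w,
      ¬ Tendsto g l (𝓝 w) := by
    intro l _ hl w hw
    have h1 := (hcpow.mono_left hl).mul hw
    rw [zero_mul] at h1
    exact hc₀ (tendsto_nhds_unique (hlim.mono_left hl) h1)
  have hev : ∀ᶠ z in 𝓝[cSector b₁ b₂] (0 : ℂ), z ∈ D := eventually_nhdsWithin_iff.2 hD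
  have hnc : ∀ z ∈ D, ¬ ∀ᶠ z' in 𝓝 z, g z' = g z := by
    intro z hz hconst
    have heq := hg.eqOn_of_preconnected_of_eventuallyEq analyticOnNhd_const hDc hz hconst
    refine hnolim _ le_rfl (g z) (tendsto_const_nhds.congr' ?_)
    filter_upwards [hev] with x hx using (heq hx).symm
  have hprop : ∀ 𝒰 : Ultrafilter ℂ, D ∈ 𝒰 → ∀ w ∈ {z : ℂ | z.im < 0}, Tendsto g 𝒰 (𝓝 w) →
      ∃ z ∈ D, ↑𝒰 ≤ 𝓝 z := by
    intro 𝒰 h𝒰 w hw hgw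
    rcases hbd 𝒰 h𝒰 with h | h | h
    · exact h
    · exfalso
      have hw' : w.im < 0 := hw
      have h1 := h (-w.im / 2) (by linarith)
      have h2 : ∀ᶠ z in 𝒰, (g z).im < w.im / 2 :=
        ((Complex.continuous_im.tendsto w).comp hgw).eventually_lt_const (by linarith)
      obtain ⟨z, h3, h4⟩ := (h1.and h2).exists
      linarith
    · exact (hnolim _ h w hgw).elim
  have hsurj : ∀ w ∈ {z : ℂ | z.im < 0}, w ∈ g '' D := by
    set V : Set ℂ := {z : ℂ | z.im < 0} with hV
    have hVc : IsPreconnected V := (convex_halfSpace_im_lt 0).isPreconnected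
    have hio : IsOpen (g '' D) := by
      rw [isOpen_iff_mem_nhds]
      rintro _ ⟨z, hz, rfl⟩
      exact ((hg z hz).eventually_constant_or_nhds_le_map_nhds.resolve_left (hnc z hz))
        (image_mem_map (hDo.mem_nhds hz))
    obtain ⟨z₁, hz₁, hgz₁⟩ := hne
    refine hVc.subset_of_closure_inter_subset hio ⟨g z₁, hgz₁, z₁, hz₁, rfl⟩ ?_
    rintro w ⟨hwc, hwV⟩
    have : NeBot (comap g (𝓝 w) ⊓ 𝓟 D) := by
      rw [← map_neBot_iff g, Filter.push_pull', map_principal]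
      exact mem_closure_iff_clusterPt.1 hwc
    set 𝒰 := Ultrafilter.of (comap g (𝓝 w) ⊓ 𝓟 D)
    have hle : ↑𝒰 ≤ comap g (𝓝 w) ⊓ 𝓟 D := Ultrafilter.of_le _
    have ht : Tendsto g 𝒰 (𝓝 w) := tendsto_iff_comap.2 (hle.trans inf_le_left)
    obtain ⟨z, hz, hz'⟩ := hprop 𝒰 (le_principal_iff.1 (hle.trans inf_le_right)) w hwV ht
    exact ⟨z, hz, tendsto_nhds_unique ((hg z hz).continuousAt.tendsto.mono_left hz') ht⟩
  obtain ⟨w₀, hw₀, hbase⟩ := exists_unique_simple_preimage hg hb₁ hb₂ hη₀ hα hc₀ hD hlim hdir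
    (by
      intro 𝒰 h𝒰 ht
      rcases hbd 𝒰 h𝒰 with ⟨z, hz, h⟩ | h | h
      · exfalso
        have h1 := (Complex.continuous_im.tendsto _).comp
          ((hg z hz).continuousAt.tendsto.mono_left h)
        exact not_tendsto_nhds_of_tendsto_atBot ht _ h1
      · exfalso
        obtain ⟨z, h3, h4⟩ := ((h 1 one_pos).and (ht.eventually_le_atBot (-1))).exists
        linarith
      · exact h) hsurj
  obtain ⟨F, hF1, hF2, hF3⟩ := exists_analytic_inverse_of_proper hDo hDc hg isOpen_lowerHalfPlane
    (convex_halfSpace_im_lt 0).isPreconnected hprop hw₀ hbase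
  exact ⟨F, hF1, fun w hw => hF2 w hw, fun z hz h => hF3 z hz h⟩

/-- The unnormalised Cauchy transform of the density `f` on the positive half-line. -/
noncomputable def halfLineCauchy (f : ℝ → ℝ) (z : ℂ) : ℂ :=
  ∫ t in Ioi (0 : ℝ), (f t : ℂ) * (z - (t : ℂ))⁻¹

theorem Complex.abs_im_le_norm_sub_ofReal (z : ℂ) (t : ℝ) : |z.im| ≤ ‖z - t‖ := by
  simpa using Complex.abs_im_le_norm (z - t)

theorem Complex.norm_inv_sub_ofReal_le {z : ℂ} (hz : z.im ≠ 0) (t : ℝ) :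
    ‖(z - (t : ℂ))⁻¹‖ ≤ |z.im|⁻¹ := by
  rw [norm_inv]
  exact inv_anti₀ (abs_pos.2 hz) (Complex.abs_im_le_norm_sub_ofReal z t)

theorem integrableOn_mul_inv_sub {f : ℝ → ℝ} (hf : IntegrableOn f (Ioi 0)) {z : ℂ}
    (hz : z.im ≠ 0) : IntegrableOn (fun t : ℝ => (f t : ℂ) * (z - (t : ℂ))⁻¹) (Ioi 0) :=
  Integrable.mul_bdd (c := |z.im|⁻¹) hf.ofReal (by fun_prop)
    (ae_of_all _ fun t => Complex.norm_inv_sub_ofReal_le hz t)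

theorem halfLineCauchy_im {f : ℝ → ℝ} (hf : IntegrableOn f (Ioi 0)) {z : ℂ} (hz : z.im ≠ 0) :
    (halfLineCauchy f z).im = ∫ t in Ioi (0 : ℝ), -(z.im * (f t * (‖z - t‖ ^ 2)⁻¹)) := by
  have h := integral_im (integrableOn_mul_inv_sub hf hz)
  simp only [RCLike.im_to_complex] at h
  rw [halfLineCauchy, ← h]
  congr 1
  ext t
  rw [Complex.im_ofReal_mul, Complex.inv_im, Complex.normSq_eq_norm_sq]
  simp
  ring

theorem integrableOn_halfLineCauchy_im {f : ℝ → ℝ} (hf : IntegrableOn f (Ioi 0)) {z : ℂ}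
    (hz : z.im ≠ 0) :
    IntegrableOn (fun t : ℝ => f t * (‖z - t‖ ^ 2)⁻¹) (Ioi 0) := by
  refine Integrable.mul_bdd (c := (|z.im| ^ 2)⁻¹) hf (by fun_prop) (ae_of_all _ fun t => ?_)
  rw [norm_inv, norm_pow, norm_norm]
  exact inv_anti₀ (by have := abs_pos.2 hz; positivity)
    (by gcongr; exact Complex.abs_im_le_norm_sub_ofReal z t)

/-- The Cauchy transform of a nonnegative nonzero density maps the upper half-plane to the lower
one, and conversely. -/
theorem halfLineCauchy_im_mul_neg {f : ℝ → ℝ} (hf : IntegrableOn f (Ioi 0))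
    (hf0 : ∀ t, 0 < t → 0 ≤ f t) (hM : 0 < ∫ t in Ioi (0 : ℝ), f t) {z : ℂ} (hz : z.im ≠ 0) :
    z.im * (halfLineCauchy f z).im < 0 := by
  rw [halfLineCauchy_im hf hz, integral_neg, integral_const_mul, mul_neg, ← mul_assoc]
  have h1 : 0 < ∫ t in Ioi (0 : ℝ), f t * (‖z - t‖ ^ 2)⁻¹ := by
    have hpos : ∀ t : ℝ, 0 < ‖z - t‖ ^ 2 := fun t => by
      have := (abs_pos.2 hz).trans_le (Complex.abs_im_le_norm_sub_ofReal z t)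
      positivity
    have hnn : 0 ≤ᵐ[volume.restrict (Ioi (0 : ℝ))] f :=
      (ae_restrict_iff' measurableSet_Ioi).2 (ae_of_all _ hf0)
    rw [integral_pos_iff_support_of_nonneg_ae hnn hf] at hM
    rw [integral_pos_iff_support_of_nonneg_ae]
    · convert hM using 2
      ext t
      simp only [Function.mem_support, ne_eq, mul_eq_zero, inv_eq_zero, (hpos t).ne', or_false]
    · filter_upwards [hnn] with t ht
      exact mul_nonneg ht (inv_nonneg.2 (hpos t).le)
    · exact integrableOn_halfLineCauchy_im hf hz
  have : 0 < z.im * z.im := mul_self_pos.2 hz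
  nlinarith

theorem integrable_poisson (x : ℝ) {y : ℝ} (hy : 0 < y) :
    Integrable (fun t : ℝ => y * (‖((x : ℂ) + y * Complex.I) - t‖ ^ 2)⁻¹) ∧
      ∫ t : ℝ, y * (‖((x : ℂ) + y * Complex.I) - t‖ ^ 2)⁻¹ = Real.pi := by
  have h1 : (fun t : ℝ => y * (‖((x : ℂ) + y * Complex.I) - t‖ ^ 2)⁻¹) =
      fun t => y⁻¹ * (1 + ((t - x) / y) ^ 2)⁻¹ := by
    ext t
    rw [← Complex.normSq_eq_norm_sq, Complex.normSq_apply]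
    simp only [Complex.sub_re, Complex.add_re, Complex.ofReal_re, Complex.mul_re, Complex.I_re,
      mul_zero, Complex.ofReal_im, Complex.I_im, mul_one, sub_self, add_zero, Complex.sub_im,
      Complex.add_im, Complex.mul_im, zero_add, sub_zero]
    have : 0 < y ^ 2 + (t - x) ^ 2 := by positivity
    have h2 : (x - t) * (x - t) + y * y ≠ 0 := by nlinarith
    have h3 : y ^ 2 + (t - x) ^ 2 ≠ 0 := this.ne'
    field_simp
    ring
  rw [h1]
  constructor
  · exact ((integrable_inv_one_add_sq.comp_div hy.ne').comp_sub_right x).const_mul _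
  · rw [integral_const_mul, integral_sub_right_eq_self (fun t => (1 + (t / y) ^ 2)⁻¹) x,
      Measure.integral_comp_div (fun t => (1 + t ^ 2)⁻¹) y, integral_univ_inv_one_add_sq,
      abs_of_pos hy, smul_eq_mul]
    field_simp

/-- A Poisson-integral bound: if the density is at most `ε` near `z`, then the imaginary part of
the Cauchy transform at `z` is small. -/
theorem neg_halfLineCauchy_im_le {f : ℝ → ℝ} (hf : IntegrableOn f (Ioi 0))
    (hf0 : ∀ t, 0 < t → 0 ≤ f t) {z : ℂ} (hz : 0 < z.im) {ε d : ℝ} (hε : 0 ≤ ε) (hd : 0 < d)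
    (hsmall : ∀ t : ℝ, 0 < t → ‖z - t‖ < d → f t ≤ ε) :
    -(halfLineCauchy f z).im ≤ ε * Real.pi + z.im / d ^ 2 * ∫ t in Ioi (0 : ℝ), f t := by
  obtain ⟨hi, hv⟩ := integrable_poisson z.re hz
  rw [Complex.re_add_im] at hi hv
  rw [halfLineCauchy_im hf hz.ne', integral_neg, neg_neg]
  have hpos : ∀ t : ℝ, 0 < ‖z - t‖ ^ 2 := fun t => by
    have := (abs_pos.2 hz.ne').trans_le (Complex.abs_im_le_norm_sub_ofReal z t)
    positivity
  calc ∫ t in Ioi (0 : ℝ), z.im * (f t * (‖z - t‖ ^ 2)⁻¹)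
      ≤ ∫ t in Ioi (0 : ℝ), (ε * (z.im * (‖z - t‖ ^ 2)⁻¹) + z.im / d ^ 2 * f t) := by
        refine setIntegral_mono_on ((integrableOn_halfLineCauchy_im hf hz.ne').const_mul _)
          ((hi.integrableOn.const_mul _).add (hf.const_mul _)) measurableSet_Ioi fun t ht => ?_
        have h0 := hf0 t ht
        have h1 : 0 < (‖z - t‖ ^ 2)⁻¹ := inv_pos.2 (hpos t)
        by_cases h : ‖z - t‖ < d
        · have h2 := hsmall t ht h
          have h3 : 0 ≤ z.im / d ^ 2 * f t := by positivity
          have h4 : z.im * (f t * (‖z - t‖ ^ 2)⁻¹) ≤ z.im * (ε * (‖z - t‖ ^ 2)⁻¹) := by gcongr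
          linarith
        · push Not at h
          have h2 : (‖z - t‖ ^ 2)⁻¹ ≤ (d ^ 2)⁻¹ := inv_anti₀ (by positivity) (by gcongr)
          have h3 : z.im * (f t * (‖z - t‖ ^ 2)⁻¹) ≤ z.im * (f t * (d ^ 2)⁻¹) := by gcongr
          have h4 : 0 ≤ ε * (z.im * (‖z - t‖ ^ 2)⁻¹) := by positivity
          rw [div_eq_mul_inv]
          linarith
    _ = ε * (∫ t in Ioi (0 : ℝ), z.im * (‖z - t‖ ^ 2)⁻¹) +
        z.im / d ^ 2 * ∫ t in Ioi (0 : ℝ), f t := by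
        rw [integral_add (hi.integrableOn.const_mul _) (hf.const_mul _),
          integral_const_mul (μ := volume.restrict (Ioi 0)) ε,
          integral_const_mul (μ := volume.restrict (Ioi 0)) (z.im / d ^ 2)]
    _ ≤ _ := by
        gcongr
        rw [← hv]
        refine setIntegral_le_integral hi (ae_of_all _ fun t => ?_)
        have := (inv_pos.2 (hpos t)).le
        positivity

/-- `z G_μ(z)` tends to the total mass as `z → ∞` in a vertical cone. -/
theorem tendsto_mul_cauchyTransform (μ : Measure ℝ) [IsFiniteMeasure μ] :
    Tendsto (fun z : ℂ => z * cauchyTransform μ z)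
      (comap norm atTop ⊓ 𝓟 {z : ℂ | 0 < z.im ∧ |z.re| ≤ z.im}) (𝓝 (μ.real univ : ℂ)) := by
  have hr : (μ.real univ : ℂ) = ∫ _ : ℝ, (1 : ℂ) ∂μ := by simp
  have he : (fun z : ℂ => z * cauchyTransform μ z) =
      fun z : ℂ => ∫ x : ℝ, z * (z - (x : ℂ))⁻¹ ∂μ := by
    ext z
    rw [cauchyTransform, integral_const_mul]
  rw [hr, he]
  have hcone : ∀ᶠ z : ℂ in comap norm atTop ⊓ 𝓟 {z : ℂ | 0 < z.im ∧ |z.re| ≤ z.im},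
      0 < z.im ∧ |z.re| ≤ z.im := mem_inf_of_right (mem_principal_self _)
  refine tendsto_integral_filter_of_dominated_convergence (fun _ => 2) ?_ ?_ (by fun_prop) ?_
  · exact Eventually.of_forall fun z => by fun_prop
  · filter_upwards [hcone] with z hz
    refine ae_of_all _ fun x => ?_
    have h1 := Complex.abs_im_le_norm_sub_ofReal z x
    have h2 := Complex.norm_le_abs_re_add_abs_im z
    rw [abs_of_pos hz.1] at h1 h2
    rw [norm_mul, norm_inv, ← div_eq_mul_inv, div_le_iff₀ (hz.1.trans_le h1)]
    linarith [hz.2]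
  · refine ae_of_all _ fun x => ?_
    have h1 : Tendsto (fun z : ℂ => ‖z‖) (comap norm atTop ⊓ 𝓟 {z : ℂ | 0 < z.im ∧ |z.re| ≤ z.im})
        atTop := tendsto_comap.mono_left inf_le_left
    have h2 : Tendsto (fun z : ℂ => (x : ℂ) * z⁻¹)
        (comap norm atTop ⊓ 𝓟 {z : ℂ | 0 < z.im ∧ |z.re| ≤ z.im}) (𝓝 0) := by
      rw [tendsto_zero_iff_norm_tendsto_zero]
      have := h1.inv_tendsto_atTop.const_mul ‖(x : ℂ)‖
      simpa using! this
    have h3 := ((tendsto_const_nhds (x := (1 : ℂ))).sub h2).inv₀ (by simp)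
    rw [sub_zero, inv_one] at h3
    refine h3.congr' ?_
    filter_upwards [hcone] with z hz
    have hz0 : z ≠ 0 := by
      rintro rfl
      simp at hz
    have hzx : z - x ≠ 0 := by
      intro h
      have := congrArg Complex.im h
      simp at this
      exact hz.1.ne' this
    have : 1 - (x : ℂ) * z⁻¹ = (z - x) * z⁻¹ := by field_simp
    rw [this, mul_inv, inv_inv, mul_comm]

/-- A continuous left inverse of a Cauchy-type transform over the lower half-plane takes values in
the upper half-plane on some triangular domain. -/
theorem exists_triangular_of_leftInverse {G F : ℂ → ℂ} {M : ℝ} (hM : 0 < M)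
    (hG : Tendsto (fun z : ℂ => z * G z)
      (comap norm atTop ⊓ 𝓟 {z : ℂ | 0 < z.im ∧ |z.re| ≤ z.im}) (𝓝 (M : ℂ)))
    (hF : ContinuousOn F {w | w.im < 0})
    (hleft : ∀ z : ℂ, 0 < z.im → (G z).im < 0 → F (G z) = z)
    (hright : ∀ w : ℂ, w.im < 0 → 0 < (F w).im → G (F w) = w) :
    ∃ γ : ℝ, 0 < γ ∧ ∃ δ : ℝ, 0 < δ ∧ ∀ w : ℂ, γ * |w.re| < -w.im → -δ < w.im →
      0 < (F w).im ∧ G (F w) = w := by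
  have h1 := hG.eventually_mem (Metric.ball_mem_nhds (M : ℂ) (show 0 < M / 8 by positivity))
  rw [eventually_inf_principal, eventually_comap, ] at h1
  obtain ⟨R₀, hR₀⟩ := eventually_atTop.1 h1
  set R : ℝ := max R₀ 1 with hR
  have hRp : 0 < R := lt_of_lt_of_le one_pos (le_max_right _ _)
  have hest : ∀ z : ℂ, R ≤ ‖z‖ → 0 < z.im → |z.re| ≤ z.im → ‖z * G z - M‖ < M / 8 := by
    intro z hz h2 h3
    exact mem_ball_iff_norm.1 (hR₀ ‖z‖ ((le_max_left _ _).trans hz) z rfl ⟨h2, h3⟩)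
  set δ : ℝ := M / (4 * R) with hδ
  have hδp : 0 < δ := by positivity
  set Λ : Set ℂ := {w | 3 * |w.re| < -w.im ∧ -δ < w.im} with hΛ
  set Q : Set ℂ := {z | |z.re| < z.im ∧ R < ‖z‖} with hQ
  have hΛneg : ∀ w ∈ Λ, w.im < 0 := fun w hw => by
    have := abs_nonneg w.re
    linarith [hw.1]
  have hΛc : IsPreconnected Λ := by
    refine Convex.isPreconnected ?_
    rintro u ⟨hu1, hu2⟩ v ⟨hv1, hv2⟩ a b ha hb hab
    simp only [hΛ, mem_ofPred_eq, Complex.add_re, Complex.add_im, Complex.real_smul,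
      Complex.re_ofReal_mul, Complex.im_ofReal_mul]
    have h5 : |a * u.re + b * v.re| ≤ a * |u.re| + b * |v.re| := by
      refine (abs_add_le _ _).trans_eq ?_
      rw [abs_mul, abs_mul, abs_of_nonneg ha, abs_of_nonneg hb]
    rcases ha.eq_or_lt with rfl | ha'
    · have : b = 1 := by linarith
      subst this
      simp only [zero_mul, one_mul, zero_add] at h5 ⊢
      exact ⟨hv1, hv2⟩
    · constructor <;> nlinarith
  have hQo : IsOpen Q := by
    exact (isOpen_lt Complex.continuous_re.abs Complex.continuous_im).inter
      (isOpen_lt continuous_const continuous_norm)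
  have hQcl : closure Q ⊆ {z | |z.re| ≤ z.im ∧ R ≤ ‖z‖} := by
    refine closure_minimal (fun z hz => ⟨hz.1.le, hz.2.le⟩) ?_
    exact (isClosed_le Complex.continuous_re.abs Complex.continuous_im).inter
      (isClosed_le continuous_const continuous_norm)
  have hsub : F '' Λ ⊆ Q := by
    refine (hΛc.image F (hF.mono hΛneg)).subset_of_closure_inter_subset hQo ?_ ?_
    · set T : ℝ := 8 * R with hT
      have hTp : 0 < T := by positivity
      have hz1 : (T * Complex.I : ℂ).im = T := by simp
      have hz2 : (T * Complex.I : ℂ).re = 0 := by simp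
      have hzn : ‖(T * Complex.I : ℂ)‖ = T := by simp [abs_of_pos hTp]
      have h6 := hest (T * Complex.I) (by rw [hzn]; linarith) (by rw [hz1]; exact hTp)
        (by rw [hz1, hz2]; simpa using hTp.le)
      have h7 := (Complex.abs_re_le_norm _).trans_lt h6
      have h8 := (Complex.abs_im_le_norm _).trans_lt h6
      have e1 : ((T * Complex.I : ℂ) * G (T * Complex.I) - M).re =
          -(T * (G (T * Complex.I)).im) - M := by simp
      have e2 : ((T * Complex.I : ℂ) * G (T * Complex.I) - M).im =
          T * (G (T * Complex.I)).re := by simp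
      rw [e1, abs_lt] at h7
      rw [e2, abs_mul, abs_of_pos hTp] at h8
      have hmem : G (T * Complex.I) ∈ Λ := by
        constructor
        · have h9 : T * (3 * |(G (T * Complex.I)).re|) < T * (-(G (T * Complex.I)).im) := by
            linarith [h7.1, h7.2]
          exact lt_of_mul_lt_mul_left h9 hTp.le
        · have h9 : T * (-δ) < T * (G (T * Complex.I)).im := by
            have : T * δ = 2 * M := by rw [hT, hδ]; field_simp; norm_num
            linarith [h7.1, h7.2]
          exact lt_of_mul_lt_mul_left h9 hTp.le
      refine ⟨T * Complex.I, ⟨_, hmem, hleft _ (by rw [hz1]; exact hTp) (hΛneg _ hmem)⟩, ?_, ?_⟩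
      · rw [hz1, hz2]; simpa using hTp
      · rw [hzn]; linarith
    · rintro _ ⟨hzc, w, hw, rfl⟩
      obtain ⟨hz1, hz2⟩ := hQcl hzc
      have him : 0 < (F w).im := by
        by_contra hcon
        have h5 : (F w).im = 0 := le_antisymm (not_lt.1 hcon) ((abs_nonneg _).trans hz1)
        have h6 : (F w).re = 0 := abs_eq_zero.1 (le_antisymm (hz1.trans h5.le) (abs_nonneg _))
        have : F w = 0 := Complex.ext h6 h5
        rw [this, norm_zero] at hz2
        linarith
      have h6 := hest (F w) hz2 him hz1
      rw [hright w (hΛneg w hw) him] at h6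
      have hw1 := hw.1
      have hw2 := hw.2
      constructor
      · refine lt_of_le_of_ne hz1 fun heq => ?_
        have h7 := (Complex.abs_re_le_norm _).trans_lt h6
        have h8 := (Complex.abs_im_le_norm _).trans_lt h6
        simp only [Complex.sub_re, Complex.mul_re, Complex.ofReal_re, Complex.sub_im,
          Complex.mul_im, Complex.ofReal_im, sub_zero] at h7 h8
        rw [abs_lt] at h7 h8
        have h10 : (F w).im * (3 * w.re) < (F w).im * (-w.im) := by
          gcongr
          linarith [le_abs_self w.re]
        have h11 : (F w).im * (3 * -w.re) < (F w).im * (-w.im) := by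
          gcongr
          linarith [neg_le_abs w.re]
        rcases abs_cases (F w).re with ⟨h9, -⟩ | ⟨h9, -⟩
        · rw [← h9, heq] at h7 h8
          linarith
        · rw [show (F w).re = -(F w).im by linarith] at h7 h8
          linarith
      · refine lt_of_le_of_ne hz2 fun heq => ?_
        have h7 : ‖w‖ ≤ 2 * δ := by
          have := Complex.norm_le_abs_re_add_abs_im w
          rw [abs_of_neg (hΛneg w hw)] at this
          linarith [abs_nonneg w.re]
        have h8 : M - M / 8 < ‖F w * w‖ := by
          have := norm_sub_norm_le (M : ℂ) (F w * w)
          rw [norm_sub_rev, Complex.norm_real, Real.norm_of_nonneg hM.le] at this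
          linarith
        rw [norm_mul, ← heq] at h8
        have h9 : R * ‖w‖ ≤ R * (2 * δ) := by gcongr
        have : R * (2 * δ) = M / 2 := by rw [hδ]; field_simp; norm_num
        linarith
  refine ⟨3, by norm_num, δ, hδp, fun w hw1 hw2 => ?_⟩
  have hwΛ : w ∈ Λ := ⟨hw1, hw2⟩
  have h5 := hsub ⟨w, hwΛ, rfl⟩
  have h6 : 0 < (F w).im := (abs_nonneg _).trans_lt h5.1
  exact ⟨h6, hright w (hΛneg w hwΛ) h6⟩

/-- A dominated family of holomorphic functions has a holomorphic integral. -/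
theorem differentiableOn_integral_of_dominated {α : Type*} [MeasurableSpace α] {μ : Measure α}
    {φ : ℂ → α → ℂ} {U : Set ℂ} (hU : IsOpen U)
    (hmeas : ∀ z ∈ U, AEStronglyMeasurable (φ z) μ)
    (hdiff : ∀ᵐ t ∂μ, DifferentiableOn ℂ (fun z => φ z t) U) {bound : α → ℝ}
    (hb : Integrable bound μ) (hbound : ∀ᵐ t ∂μ, ∀ z ∈ U, ‖φ z t‖ ≤ bound t) :
    DifferentiableOn ℂ (fun z => ∫ t, φ z t ∂μ) U := by
  intro z₀ hz₀
  obtain ⟨r, hr, hrU⟩ := Metric.nhds_basis_closedBall.mem_iff.1 (hU.mem_nhds hz₀)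
  have hball : ∀ z ∈ Metric.ball z₀ (r / 2), Metric.closedBall z (r / 2) ⊆ U := fun z hz =>
    (Metric.closedBall_subset_closedBall' (by
      have := Metric.mem_ball.1 hz
      linarith)).trans hrU
  refine (hasDerivAt_integral_of_dominated_loc_of_deriv_le (F := φ)
    (F' := fun z t => deriv (fun z => φ z t) z) (bound := fun t => bound t / (r / 2))
    (Metric.ball_mem_nhds z₀ (half_pos hr)) ?_ ?_ ?_ ?_ (hb.div_const _) ?_).2
    |>.differentiableAt.differentiableWithinAt
  · filter_upwards [hU.mem_nhds hz₀] with z hz using hmeas z hz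
  · exact hb.mono' (hmeas z₀ hz₀) (hbound.mono fun t ht => ht z₀ hz₀)
  · have hε : ∀ n : ℕ, z₀ + ((r / (n + 1) : ℝ) : ℂ) ∈ U := fun n => by
      apply hrU
      rw [mem_closedBall_iff_norm, add_sub_cancel_left, Complex.norm_real,
        Real.norm_of_nonneg (by positivity)]
      exact div_le_self hr.le (by linarith [(n.cast_nonneg : (0 : ℝ) ≤ n)])
    have hε0 : Tendsto (fun n : ℕ => ((r / (n + 1) : ℝ) : ℂ)) atTop (𝓝[≠] 0) := by
      refine tendsto_nhdsWithin_iff.2 ⟨?_, Eventually.of_forall fun n => ?_⟩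
      · have := tendsto_one_div_add_atTop_nhds_zero_nat (𝕜 := ℝ) |>.const_mul r
        simp only [mul_zero, mul_one_div] at this
        exact_mod_cast (Complex.continuous_ofReal.tendsto 0).comp this
      · have : r / ((n : ℝ) + 1) ≠ 0 := by positivity
        rw [mem_compl_singleton_iff]
        exact_mod_cast this
    refine aestronglyMeasurable_of_tendsto_ae atTop
      (f := fun (n : ℕ) t => ((r / (n + 1) : ℝ) : ℂ)⁻¹ •
        (φ (z₀ + ((r / (n + 1) : ℝ) : ℂ)) t - φ z₀ t)) (fun n => ?_) ?_
    · exact ((hmeas _ (hε n)).sub (hmeas _ hz₀)).const_smul (((r / (n + 1) : ℝ) : ℂ)⁻¹)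
    · filter_upwards [hdiff] with t ht
      have := (ht.differentiableAt (hU.mem_nhds hz₀)).hasDerivAt
      rw [hasDerivAt_iff_tendsto_slope_zero] at this
      exact this.comp hε0
  · filter_upwards [hdiff, hbound] with t ht hbt z hz
    refine Complex.norm_deriv_le_of_forall_mem_sphere_norm_le (half_pos hr) ?_ fun w hw =>
      hbt w (hball z hz (Metric.sphere_subset_closedBall hw))
    refine DifferentiableOn.diffContOnCl ?_
    rw [closure_ball z (half_pos hr).ne']
    exact ht.mono (hball z hz)
  · filter_upwards [hdiff] with t ht z hz
    exact (ht.differentiableAt (hU.mem_nhds (hball z hz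
      (Metric.mem_closedBall_self (half_pos hr).le)))).hasDerivAt

theorem one_add_le_mul_norm_sub {z₀ z : ℂ} {r t : ℝ} (hr : 0 < r) (ht : 0 < t)
    (hz : z ∈ Metric.ball z₀ r) (hzt : (t : ℂ) ∉ Metric.ball z₀ (2 * r)) :
    r ≤ ‖z - t‖ ∧ 1 + t ≤ (2 + (1 + ‖z₀‖) / r) * ‖z - t‖ := by
  rw [mem_ball_iff_norm] at hz
  rw [mem_ball_iff_norm, not_lt] at hzt
  have h1 : ‖(t : ℂ) - z₀‖ ≤ ‖z - t‖ + ‖z - z₀‖ := by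
    rw [show (t : ℂ) - z₀ = (z - z₀) - (z - t) by ring]
    exact (norm_sub_le _ _).trans_eq (add_comm _ _)
  have h2 : r ≤ ‖z - t‖ := by linarith
  have h3 : t ≤ ‖z - t‖ + r + ‖z₀‖ := by
    have h4 : ‖(t : ℂ)‖ ≤ ‖(t : ℂ) - z₀‖ + ‖z₀‖ := by
      simpa using norm_add_le ((t : ℂ) - z₀) z₀
    rw [Complex.norm_real, Real.norm_of_nonneg ht.le] at h4
    linarith
  have h4 : 1 + ‖z₀‖ ≤ (1 + ‖z₀‖) / r * ‖z - t‖ := by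
    rw [div_mul_eq_mul_div, le_div_iff₀ hr]
    gcongr
  exact ⟨h2, by linarith⟩

theorem integrableOn_rpow_neg_mul_inv {a : ℝ} (ha0 : 0 < a) (ha1 : a < 1) :
    IntegrableOn (fun t : ℝ => t ^ (-a) * (1 + t)⁻¹) (Ioi 0) := by
  rw [← Ioc_union_Ioi_eq_Ioi zero_le_one]
  refine IntegrableOn.union ?_ ?_
  · have h1 := (intervalIntegral.intervalIntegrable_rpow' (a := 0) (b := 1)
      (show -1 < -a by linarith))
    rw [intervalIntegrable_iff_integrableOn_Ioc_of_le zero_le_one] at h1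
    refine h1.mono' (by fun_prop) ((ae_restrict_iff' measurableSet_Ioc).2 (ae_of_all _ ?_))
    intro t ht
    have := Real.rpow_pos_of_pos ht.1 (-a)
    rw [Real.norm_of_nonneg (by have := ht.1; positivity)]
    exact mul_le_of_le_one_right this.le (inv_le_one_of_one_le₀ (by linarith [ht.1]))
  · have h1 := integrableOn_Ioi_rpow_of_lt (show -a - 1 < -1 by linarith) one_pos
    refine h1.mono' (by fun_prop) ((ae_restrict_iff' measurableSet_Ioi).2 (ae_of_all _ ?_))
    intro t ht
    have ht0 : (0 : ℝ) < t := one_pos.trans ht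
    have := Real.rpow_pos_of_pos ht0 (-a)
    rw [Real.norm_of_nonneg (by positivity), Real.rpow_sub ht0, Real.rpow_one, div_eq_mul_inv]
    gcongr
    linarith

/-- The constant in the Cauchy transform of `t ^ (-a)`. -/
noncomputable def powCauchyConst (a : ℝ) : ℝ := ∫ t in Ioi (0 : ℝ), t ^ (-a) * (1 + t)⁻¹

theorem powCauchyConst_pos {a : ℝ} (ha0 : 0 < a) (ha1 : a < 1) : 0 < powCauchyConst a := by
  rw [powCauchyConst, setIntegral_pos_iff_support_of_nonneg_ae _
    (integrableOn_rpow_neg_mul_inv ha0 ha1)]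
  · have : Ioi (0 : ℝ) ⊆ (Function.support fun t : ℝ => t ^ (-a) * (1 + t)⁻¹) ∩ Ioi 0 := by
      intro t ht
      have ht0 : (0 : ℝ) < t := ht
      have := Real.rpow_pos_of_pos ht0 (-a)
      exact ⟨by rw [Function.mem_support]; positivity, ht⟩
    exact lt_of_lt_of_le (by simp) (measure_mono this)
  · refine (ae_restrict_iff' measurableSet_Ioi).2 (ae_of_all _ fun t ht => ?_)
    have ht0 : (0 : ℝ) < t := ht
    have := Real.rpow_pos_of_pos ht0 (-a)
    simp only [Pi.zero_apply]
    positivity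

theorem isOpen_neg_mem_slitPlane : IsOpen {z : ℂ | -z ∈ Complex.slitPlane} :=
  Complex.isOpen_slitPlane.preimage continuous_neg

theorem neg_ofReal_notMem_slitPlane {t : ℝ} (ht : 0 < t) : -(t : ℂ) ∉ Complex.slitPlane := by
  rw [← Complex.ofReal_neg, Complex.ofReal_mem_slitPlane]
  linarith

theorem norm_rpow_mul_inv_sub_le {a t r : ℝ} {z₀ z : ℂ} (hr : 0 < r) (ht : 0 < t)
    (hz : z ∈ Metric.ball z₀ r) (hzt : (t : ℂ) ∉ Metric.ball z₀ (2 * r)) :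
    ‖((t ^ (-a) : ℝ) : ℂ) * (z - (t : ℂ))⁻¹‖ ≤
      (2 + (1 + ‖z₀‖) / r) * (t ^ (-a) * (1 + t)⁻¹) := by
  obtain ⟨h1, h2⟩ := one_add_le_mul_norm_sub hr ht hz hzt
  have h3 := Real.rpow_pos_of_pos ht (-a)
  rw [norm_mul, Complex.norm_real, Real.norm_of_nonneg h3.le, norm_inv, mul_left_comm]
  gcongr
  rw [inv_le_iff_one_le_mul₀ (hr.trans_le h1), mul_right_comm, ← div_eq_mul_inv,
    le_div_iff₀ (by positivity)]
  linarith

theorem differentiableOn_powCauchy {a : ℝ} (ha0 : 0 < a) (ha1 : a < 1) :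
    DifferentiableOn ℂ (halfLineCauchy fun t => t ^ (-a)) {z : ℂ | -z ∈ Complex.slitPlane} := by
  intro z₀ hz₀
  obtain ⟨r, hr, hrU⟩ := Metric.mem_nhds_iff.1 (isOpen_neg_mem_slitPlane.mem_nhds hz₀)
  have hr2 : 0 < r / 2 := half_pos hr
  have hnot : ∀ t : ℝ, 0 < t → (t : ℂ) ∉ Metric.ball z₀ (2 * (r / 2)) := fun t ht h => by
    rw [mul_div_cancel₀ r two_ne_zero] at h
    exact neg_ofReal_notMem_slitPlane ht (hrU h)
  refine DifferentiableAt.differentiableWithinAt ?_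
  refine (differentiableOn_integral_of_dominated (U := Metric.ball z₀ (r / 2)) Metric.isOpen_ball
    (fun z hz => by fun_prop) ?_ ((integrableOn_rpow_neg_mul_inv ha0 ha1).const_mul
      (2 + (1 + ‖z₀‖) / (r / 2))) ?_).differentiableAt (Metric.ball_mem_nhds z₀ hr2)
  · refine (ae_restrict_iff' measurableSet_Ioi).2 (ae_of_all _ fun t ht z hz => ?_)
    have h1 := (one_add_le_mul_norm_sub hr2 ht hz (hnot t ht)).1
    have h2 : z - t ≠ 0 := norm_pos_iff.1 (hr2.trans_le h1)
    have h3 : DifferentiableAt ℂ (fun z : ℂ => (z - (t : ℂ))⁻¹) z :=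
      (differentiableAt_id.sub_const (t : ℂ)).inv h2
    exact (h3.const_mul _).differentiableWithinAt
  · refine (ae_restrict_iff' measurableSet_Ioi).2 (ae_of_all _ fun t ht z hz => ?_)
    exact norm_rpow_mul_inv_sub_le hr2 ht hz (hnot t ht)

theorem powCauchy_ofReal_mul {a s : ℝ} (hs : 0 < s) (z : ℂ) :
    halfLineCauchy (fun t => t ^ (-a)) (s * z) =
      ((s ^ (-a) : ℝ) : ℂ) * halfLineCauchy (fun t => t ^ (-a)) z := by
  have h1 := integral_comp_mul_left_Ioi
    (fun t : ℝ => ((t ^ (-a) : ℝ) : ℂ) * ((s : ℂ) * z - (t : ℂ))⁻¹) 0 hs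
  rw [mul_zero] at h1
  have hs' : (s : ℂ) ≠ 0 := by exact_mod_cast hs.ne'
  have h2 : halfLineCauchy (fun t => t ^ (-a)) (s * z) =
      s • ∫ x in Ioi (0 : ℝ), (((s * x) ^ (-a) : ℝ) : ℂ) * ((s : ℂ) * z - ((s * x : ℝ) : ℂ))⁻¹ := by
    rw [h1, smul_smul, mul_inv_cancel₀ hs.ne', one_smul, halfLineCauchy]
  rw [h2, halfLineCauchy, ← integral_const_mul, ← integral_smul]
  refine setIntegral_congr_fun measurableSet_Ioi fun x hx => ?_
  have hx0 : (0 : ℝ) < x := hx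
  rw [Real.mul_rpow hs.le hx0.le, Complex.ofReal_mul s x, ← mul_sub, mul_inv, Complex.real_smul,
    Complex.ofReal_mul]
  field_simp

/-- The Cauchy transform of `t ^ (-a)` on the half-line. -/
theorem powCauchy_eq {a : ℝ} (ha0 : 0 < a) (ha1 : a < 1) {z : ℂ} (hz : -z ∈ Complex.slitPlane) :
    halfLineCauchy (fun t => t ^ (-a)) z = -(powCauchyConst a) * (-z) ^ (-a : ℂ) := by
  set K := halfLineCauchy (fun t => t ^ (-a)) with hK
  set Ψ : ℂ → ℂ := fun z => K z * (-z) ^ (a : ℂ) with hΨ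
  have hpd : ∀ z : ℂ, -z ∈ Complex.slitPlane → DifferentiableAt ℂ (fun z : ℂ => (-z) ^ (a : ℂ)) z :=
    fun z hz => differentiableAt_id.neg.cpow_const hz
  have hd : DifferentiableOn ℂ Ψ {z : ℂ | -z ∈ Complex.slitPlane} :=
    (differentiableOn_powCauchy ha0 ha1).mul fun z hz => (hpd z hz).differentiableWithinAt
  have hscale : ∀ s : ℝ, 0 < s → ∀ z : ℂ, -z ∈ Complex.slitPlane → Ψ (s * z) = Ψ z := by
    intro s hs z hz
    have hz0 : -z ≠ 0 := Complex.slitPlane_ne_zero hz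
    rw [hΨ]
    simp only
    rw [hK, powCauchy_ofReal_mul hs, ← mul_neg, Complex.ofReal_mul_cpow hs _ hz0,
      Complex.ofReal_cpow hs.le]
    have h1 : (s : ℂ) ^ ((-a : ℝ) : ℂ) * (s : ℂ) ^ (a : ℂ) = 1 := by
      have hs' : (s : ℂ) ≠ 0 := by exact_mod_cast hs.ne'
      rw [← Complex.cpow_add _ _ hs']
      simp
    linear_combination (halfLineCauchy (fun t => t ^ (-a)) z * (-z) ^ (a : ℂ)) * h1
  have hderiv : EqOn (deriv Ψ) 0 {z : ℂ | -z ∈ Complex.slitPlane} := by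
    intro z hz
    have hz0 : z ≠ 0 := fun h => Complex.slitPlane_ne_zero hz (by simp [h])
    have h1 : HasDerivAt Ψ (deriv Ψ z) (((1 : ℝ) : ℂ) * z) := by
      rw [Complex.ofReal_one, one_mul]
      exact (hd.differentiableAt (isOpen_neg_mem_slitPlane.mem_nhds hz)).hasDerivAt
    have h2 : HasDerivAt (fun s : ℝ => (s : ℂ) * z) z 1 := by
      simpa using! (Complex.ofRealCLM.hasDerivAt (x := (1 : ℝ))).mul_const z
    have h3 := h1.scomp (1 : ℝ) h2
    have h4 : (Ψ ∘ fun s : ℝ => (s : ℂ) * z) =ᶠ[𝓝 1] fun _ => Ψ z := by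
      filter_upwards [Ioi_mem_nhds one_pos] with s hs using hscale s hs z hz
    have h5 := h3.congr_of_eventuallyEq h4.symm
    have h6 := h5.unique (hasDerivAt_const _ _)
    simpa [hz0] using h6
  have hconn : IsPreconnected {z : ℂ | -z ∈ Complex.slitPlane} := by
    have := Complex.starConvex_one_slitPlane.isPathConnected Complex.one_mem_slitPlane
    have h2 := this.isConnected.isPreconnected.image Neg.neg continuous_neg.continuousOn
    rwa [Set.image_neg_eq_neg] at h2
  have hone : -(-1 : ℂ) ∈ Complex.slitPlane := by simp
  have hconst := isOpen_neg_mem_slitPlane.is_const_of_deriv_eq_zero hconn hd hderiv hz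
    (y := -1) hone
  have hval : Ψ (-1) = -(powCauchyConst a) := by
    simp only [hΨ, neg_neg, Complex.one_cpow, mul_one]
    rw [hK, halfLineCauchy, powCauchyConst, ← integral_complex_ofReal, ← integral_neg]
    refine setIntegral_congr_fun measurableSet_Ioi fun x hx => ?_
    have h1 : (1 + (x : ℂ)) ≠ 0 := by
      have hx0 : (0 : ℝ) < x := hx
      have : 1 + x ≠ 0 := by positivity
      exact_mod_cast this
    rw [show (-1 - (x : ℂ)) = -(1 + x) by ring, inv_neg]
    push_cast
    ring
  rw [← hval, ← hconst, hΨ]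
  simp only
  have hz0 : -z ≠ 0 := Complex.slitPlane_ne_zero hz
  rw [mul_assoc, ← Complex.cpow_add _ _ hz0]
  simp

/-- The analytic continuation of `halfLineCauchy f` through the part of the positive half-line
where `f` extends to the holomorphic function `h`. -/
noncomputable def halfLineCont (f : ℝ → ℝ) (h : ℂ → ℂ) (a : ℝ) (z : ℂ) : ℂ :=
  (∫ t in Ioi (0 : ℝ),
      ((f t : ℂ) - z ^ (a : ℂ) * h z * ((t ^ (-a) : ℝ) : ℂ)) * (z - (t : ℂ))⁻¹) -
    powCauchyConst a * Complex.exp (Real.pi * a * Complex.I) * h z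

theorem neg_cpow_neg_of_im_pos {z : ℂ} (hz : 0 < z.im) (a : ℝ) :
    z ^ (a : ℂ) * (-z) ^ (-a : ℂ) = Complex.exp (Real.pi * a * Complex.I) := by
  have h0 : z ≠ 0 := by rintro rfl; simp at hz
  rw [Complex.cpow_def_of_ne_zero h0, Complex.cpow_def_of_ne_zero (neg_ne_zero.2 h0),
    ← Complex.exp_add, Complex.log, Complex.log, norm_neg,
    Complex.arg_neg_eq_arg_sub_pi_of_im_pos hz]
  push_cast
  ring_nf

theorem neg_cpow_neg_of_im_neg {z : ℂ} (hz : z.im < 0) (a : ℝ) :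
    z ^ (a : ℂ) * (-z) ^ (-a : ℂ) = Complex.exp (-(Real.pi * a * Complex.I)) := by
  have h0 : z ≠ 0 := by rintro rfl; simp at hz
  rw [Complex.cpow_def_of_ne_zero h0, Complex.cpow_def_of_ne_zero (neg_ne_zero.2 h0),
    ← Complex.exp_add, Complex.log, Complex.log, norm_neg,
    Complex.arg_neg_eq_arg_add_pi_of_im_neg hz]
  push_cast
  ring_nf

theorem neg_mem_slitPlane_of_im_ne {z : ℂ} (hz : z.im ≠ 0) : -z ∈ Complex.slitPlane := by
  rw [Complex.mem_slitPlane_iff]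
  right
  simpa using hz

section
variable {f : ℝ → ℝ} {h : ℂ → ℂ} {a : ℝ}

theorem integrableOn_rpow_mul_inv_sub (ha0 : 0 < a) (ha1 : a < 1) {z : ℂ} (hz : z.im ≠ 0) :
    IntegrableOn (fun t : ℝ => ((t ^ (-a) : ℝ) : ℂ) * (z - (t : ℂ))⁻¹) (Ioi 0) := by
  have hr : 0 < |z.im| / 2 := half_pos (abs_pos.2 hz)
  refine ((integrableOn_rpow_neg_mul_inv ha0 ha1).const_mul
    (2 + (1 + ‖z‖) / (|z.im| / 2))).mono' (by fun_prop)
    ((ae_restrict_iff' measurableSet_Ioi).2 (ae_of_all _ fun t ht => ?_))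
  refine norm_rpow_mul_inv_sub_le hr ht (Metric.mem_ball_self hr) fun hb => ?_
  rw [mem_ball_iff_norm, norm_sub_rev] at hb
  have := Complex.abs_im_le_norm_sub_ofReal z t
  linarith

theorem halfLineCont_of_im_ne (hf : IntegrableOn f (Ioi 0)) (ha0 : 0 < a) (ha1 : a < 1) {z : ℂ}
    (hz : z.im ≠ 0) :
    halfLineCont f h a z = halfLineCauchy f z +
      powCauchyConst a * (z ^ (a : ℂ) * (-z) ^ (-a : ℂ) -
        Complex.exp (Real.pi * a * Complex.I)) * h z := by
  have h1 := powCauchy_eq ha0 ha1 (neg_mem_slitPlane_of_im_ne hz)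
  have h2 : ∫ t in Ioi (0 : ℝ),
      ((f t : ℂ) - z ^ (a : ℂ) * h z * ((t ^ (-a) : ℝ) : ℂ)) * (z - (t : ℂ))⁻¹ =
      halfLineCauchy f z - z ^ (a : ℂ) * h z * halfLineCauchy (fun t => t ^ (-a)) z := by
    rw [halfLineCauchy, halfLineCauchy, ← integral_const_mul, ← integral_sub
      (integrableOn_mul_inv_sub hf hz) ((integrableOn_rpow_mul_inv_sub ha0 ha1 hz).const_mul _)]
    congr 1
    ext t
    ring
  rw [halfLineCont, h2, h1]
  ring

theorem halfLineCont_of_im_pos (hf : IntegrableOn f (Ioi 0)) (ha0 : 0 < a) (ha1 : a < 1) {z : ℂ}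
    (hz : 0 < z.im) : halfLineCont f h a z = halfLineCauchy f z := by
  rw [halfLineCont_of_im_ne hf ha0 ha1 hz.ne', neg_cpow_neg_of_im_pos hz]
  ring

theorem halfLineCont_of_im_neg (hf : IntegrableOn f (Ioi 0)) (ha0 : 0 < a) (ha1 : a < 1) {z : ℂ}
    (hz : z.im < 0) : halfLineCont f h a z = halfLineCauchy f z -
      ((2 * powCauchyConst a * Real.sin (Real.pi * a) : ℝ) : ℂ) * Complex.I * h z := by
  rw [halfLineCont_of_im_ne hf ha0 ha1 hz.ne, neg_cpow_neg_of_im_neg hz]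
  have h1 : Complex.exp (-(Real.pi * a * Complex.I)) - Complex.exp (Real.pi * a * Complex.I) =
      -(2 * Complex.sin (Real.pi * a) * Complex.I) := by
    rw [Complex.sin, ← neg_mul]
    linear_combination (Complex.exp (-(Real.pi * a) * Complex.I) -
      Complex.exp (Real.pi * a * Complex.I)) * Complex.I_mul_I
  rw [h1]
  push_cast
  ring

theorem halfLineCont_ofReal_im {x : ℝ} (hx : 0 < x) (hfx : h x = f x) :
    (halfLineCont f h a x).im = -(powCauchyConst a * Real.sin (Real.pi * a) * f x) := by
  have h1 : (x : ℂ) ^ (a : ℂ) = ((x ^ a : ℝ) : ℂ) := (Complex.ofReal_cpow hx.le a).symm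
  have h2 : (∫ t in Ioi (0 : ℝ),
      ((f t : ℂ) - (x : ℂ) ^ (a : ℂ) * h x * ((t ^ (-a) : ℝ) : ℂ)) * ((x : ℂ) - (t : ℂ))⁻¹) =
      ((∫ t in Ioi (0 : ℝ), (f t - x ^ a * f x * t ^ (-a)) * (x - t)⁻¹ : ℝ) : ℂ) := by
    rw [← integral_complex_ofReal]
    congr 1
    ext t
    rw [h1, hfx]
    push_cast
    rfl
  have h3 : Complex.exp (Real.pi * a * Complex.I) = Complex.exp ((Real.pi * a : ℝ) * Complex.I) := by
    push_cast
    rfl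
  rw [halfLineCont, h2, h3, hfx, Complex.sub_im, Complex.ofReal_im, zero_sub,
    Complex.im_mul_ofReal, Complex.im_ofReal_mul, Complex.exp_ofReal_mul_I_im]

theorem differentiableOn_halfLineCont (hf : IntegrableOn f (Ioi 0)) (ha0 : 0 < a) (ha1 : a < 1)
    {Ω : Set ℂ} (hΩ : IsOpen Ω) (hΩs : Ω ⊆ Complex.slitPlane) (hh : DifferentiableOn ℂ h Ω)
    (hfh : ∀ t : ℝ, (t : ℂ) ∈ Ω → h t = f t) : DifferentiableOn ℂ (halfLineCont f h a) Ω := by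
  refine DifferentiableOn.sub ?_ (hh.const_mul _)
  intro z₀ hz₀
  set m : ℂ → ℂ := fun z => z ^ (a : ℂ) * h z with hm
  have hmd : DifferentiableOn ℂ m Ω := fun z hz =>
    ((differentiableAt_id.cpow_const (hΩs hz)).differentiableWithinAt).mul (hh z hz)
  obtain ⟨r, hr, hrΩ⟩ := Metric.nhds_basis_closedBall.mem_iff.1 (hΩ.mem_nhds hz₀)
  set s := r / 2 with hs
  have hsp : 0 < s := half_pos hr
  have hrs : 2 * s = r := by rw [hs]; ring
  have hsub : Metric.ball z₀ s ⊆ Metric.ball z₀ (2 * s) := Metric.ball_subset_ball (by linarith)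
  have hbΩ : Metric.ball z₀ (2 * s) ⊆ Ω := by
    rw [hrs]
    exact Metric.ball_subset_closedBall.trans hrΩ
  obtain ⟨C₁, hC₁⟩ := (isCompact_closedBall z₀ r).exists_bound_of_continuousOn
    (hmd.continuousOn.mono hrΩ)
  obtain ⟨C₂, hC₂⟩ := (isCompact_closedBall z₀ r).exists_bound_of_continuousOn
    ((hmd.deriv hΩ).continuousOn.mono hrΩ)
  have hC₁0 : 0 ≤ C₁ := (norm_nonneg _).trans (hC₁ z₀ (Metric.mem_closedBall_self hr.le))
  have hC₂0 : 0 ≤ C₂ := (norm_nonneg _).trans (hC₂ z₀ (Metric.mem_closedBall_self hr.le))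
  set φ : ℂ → ℝ → ℂ := fun z t => ((f t : ℂ) - m z * ((t ^ (-a) : ℝ) : ℂ)) * (z - (t : ℂ))⁻¹
    with hφ
  open Classical in
  set ψ : ℂ → ℝ → ℂ := fun z t => if (t : ℂ) ∈ Metric.ball z₀ (2 * s) then
    -((t ^ (-a) : ℝ) : ℂ) * dslope m t z else φ z t with hψ
  have hψφ : ∀ z, ∀ t : ℝ, 0 < t → (t : ℂ) ≠ z → ψ z t = φ z t := by
    intro z t ht htz
    simp only [hψ]
    split_ifs with hb
    · have hmt : m t = ((t ^ a : ℝ) : ℂ) * f t := by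
        rw [hm]
        simp only
        rw [hfh t (hbΩ hb), Complex.ofReal_cpow ht.le]
      have hta : ((t ^ (-a) : ℝ) : ℂ) * ((t ^ a : ℝ) : ℂ) = 1 := by
        rw [← Complex.ofReal_mul, ← Real.rpow_add ht]
        simp
      rw [dslope_of_ne _ htz.symm, slope_def_module, hmt, smul_eq_mul, hφ]
      linear_combination ((z - (t : ℂ))⁻¹ * (f t : ℂ)) * hta
    · rfl
  have hae : ∀ z, ψ z =ᵐ[volume.restrict (Ioi 0)] φ z := by
    intro z
    have h1 : ∀ᵐ t : ℝ, t ≠ z.re := by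
      rw [ae_iff]
      simp
    filter_upwards [(ae_restrict_iff' measurableSet_Ioi).2 (ae_of_all _ fun t ht => ht),
      ae_restrict_of_ae h1] with t ht h2
    refine hψφ z t ht fun he => h2 ?_
    rw [← he, Complex.ofReal_re]
  have hfm : AEMeasurable f (volume.restrict (Ioi 0)) := hf.aestronglyMeasurable.aemeasurable
  have hball : ∀ z ∈ Metric.ball z₀ s, z ∈ Ω := fun z hz => hbΩ (hsub hz)
  have key := differentiableOn_integral_of_dominated (μ := volume.restrict (Ioi (0 : ℝ)))
    (φ := ψ) (U := Metric.ball z₀ s) (bound := fun t => s⁻¹ * ‖f t‖ +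
      (C₁ * (2 + (1 + ‖z₀‖) / s) + C₂ * (1 + ‖z₀‖ + r)) * (t ^ (-a) * (1 + t)⁻¹))
    Metric.isOpen_ball ?_ ?_ ?_ ?_
  · refine DifferentiableAt.differentiableWithinAt ?_
    refine (key.differentiableAt (Metric.ball_mem_nhds z₀ hsp)).congr_of_eventuallyEq ?_
    exact Eventually.of_forall fun z => (integral_congr_ae (hae z)).symm
  · intro z hz
    refine AEStronglyMeasurable.congr ?_ (hae z).symm
    refine AEMeasurable.aestronglyMeasurable ?_
    exact ((Complex.measurable_ofReal.comp_aemeasurable hfm).sub (by fun_prop)).mul (by fun_prop)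
  · refine (ae_restrict_iff' measurableSet_Ioi).2 (ae_of_all _ fun t ht => ?_)
    by_cases hb : (t : ℂ) ∈ Metric.ball z₀ (2 * s)
    · have : (fun z => ψ z t) = fun z => -((t ^ (-a) : ℝ) : ℂ) * dslope m t z := by
        ext z
        rw [hψ]
        exact if_pos hb
      rw [this]
      exact (((Complex.differentiableOn_dslope (hΩ.mem_nhds (hbΩ hb))).2 hmd).mono hball).const_mul _
    · have : (fun z => ψ z t) = fun z => φ z t := by
        ext z
        rw [hψ]
        exact if_neg hb
      rw [this]
      intro z hz
      have h2 : z - t ≠ 0 := norm_pos_iff.1 (hsp.trans_le (one_add_le_mul_norm_sub hsp ht hz hb).1)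
      have h3 : DifferentiableAt ℂ (fun z : ℂ => (z - (t : ℂ))⁻¹) z :=
        (differentiableAt_id.sub_const (t : ℂ)).inv h2
      have h4 : DifferentiableAt ℂ m z := hmd.differentiableAt (hΩ.mem_nhds (hball z hz))
      exact (((h4.mul_const _).const_sub _).mul h3).differentiableWithinAt
  · exact (hf.norm.const_mul _).add ((integrableOn_rpow_neg_mul_inv ha0 ha1).const_mul _)
  · refine (ae_restrict_iff' measurableSet_Ioi).2 (ae_of_all _ fun t ht z hz => ?_)
    have ht0 : (0 : ℝ) < t := ht
    have hta : 0 < t ^ (-a) := Real.rpow_pos_of_pos ht0 (-a)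
    by_cases hb : (t : ℂ) ∈ Metric.ball z₀ (2 * s)
    · have h1 : ψ z t = -((t ^ (-a) : ℝ) : ℂ) * dslope m t z := if_pos hb
      have h2 : ‖dslope m t z‖ ≤ C₂ := by
        by_cases hzt : z = t
        · rw [hzt, dslope_same]
          exact hC₂ _ (by rw [← hrs]; exact Metric.ball_subset_closedBall hb)
        · rw [dslope_of_ne _ hzt, slope_def_module, norm_smul, norm_inv,
            inv_mul_le_iff₀ (norm_pos_iff.2 (sub_ne_zero.2 hzt)), mul_comm]
          exact (convex_ball z₀ (2 * s)).norm_image_sub_le_of_norm_deriv_le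
            (fun x hx => hmd.differentiableAt (hΩ.mem_nhds (hbΩ hx)))
            (fun x hx => hC₂ x (by rw [← hrs]; exact Metric.ball_subset_closedBall hx)) hb
            (hsub hz)
      have h3 : 1 + t ≤ 1 + ‖z₀‖ + r := by
        rw [mem_ball_iff_norm, hrs] at hb
        have := norm_sub_norm_le (t : ℂ) z₀
        rw [Complex.norm_real, Real.norm_of_nonneg ht0.le] at this
        linarith
      have h4 : t ^ (-a) * C₂ ≤ C₂ * (1 + ‖z₀‖ + r) * (t ^ (-a) * (1 + t)⁻¹) := by
        have : 1 ≤ (1 + ‖z₀‖ + r) * (1 + t)⁻¹ := by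
          rw [← div_eq_mul_inv, one_le_div (by positivity)]
          exact h3
        calc t ^ (-a) * C₂ = t ^ (-a) * C₂ * 1 := by ring
          _ ≤ t ^ (-a) * C₂ * ((1 + ‖z₀‖ + r) * (1 + t)⁻¹) := by gcongr
          _ = _ := by ring
      rw [h1, norm_mul, norm_neg, Complex.norm_real, Real.norm_of_nonneg hta.le]
      have h5 : 0 ≤ s⁻¹ * ‖f t‖ := by positivity
      have h6 : 0 ≤ C₁ * (2 + (1 + ‖z₀‖) / s) * (t ^ (-a) * (1 + t)⁻¹) := by positivity
      have h7 : t ^ (-a) * ‖dslope m t z‖ ≤ t ^ (-a) * C₂ := by gcongr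
      linarith
    · have h1 : ψ z t = (f t : ℂ) * (z - (t : ℂ))⁻¹ -
          m z * (((t ^ (-a) : ℝ) : ℂ) * (z - (t : ℂ))⁻¹) := by
        have : ψ z t = φ z t := if_neg hb
        rw [this, hφ]
        ring
      have h2 := norm_rpow_mul_inv_sub_le (a := a) hsp ht0 hz hb
      have h3 : ‖(f t : ℂ) * (z - (t : ℂ))⁻¹‖ ≤ s⁻¹ * ‖f t‖ := by
        rw [norm_mul, Complex.norm_real, norm_inv, mul_comm]
        gcongr
        exact (one_add_le_mul_norm_sub hsp ht0 hz hb).1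
      have h4 : ‖m z‖ ≤ C₁ :=
        hC₁ z (by rw [← hrs]; exact Metric.ball_subset_closedBall (hsub hz))
      have h5 : ‖m z * (((t ^ (-a) : ℝ) : ℂ) * (z - (t : ℂ))⁻¹)‖ ≤
          C₁ * ((2 + (1 + ‖z₀‖) / s) * (t ^ (-a) * (1 + t)⁻¹)) := by
        rw [norm_mul]
        gcongr
      have h6 : 0 ≤ C₂ * (1 + ‖z₀‖ + r) * (t ^ (-a) * (1 + t)⁻¹) := by positivity
      rw [h1]
      refine (norm_sub_le _ _).trans ?_
      linarith

end

theorem Complex.arg_cpow_ofReal {z : ℂ} (hz : z ≠ 0) {s : ℝ}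
    (h : s * z.arg ∈ Ioc (-Real.pi) Real.pi) : (z ^ (s : ℂ)).arg = s * z.arg := by
  rw [Complex.cpow_def_of_ne_zero hz, Complex.arg_exp]
  have : (Complex.log z * s).im = s * z.arg := by
    simp [Complex.mul_im, Complex.log_im, mul_comm]
  rw [this]
  exact (toIocMod_eq_self Real.two_pi_pos).2 ⟨h.1, by linarith [h.2]⟩

theorem Complex.cpow_ofReal_cpow_ofReal {z : ℂ} {s t : ℝ}
    (h : s * z.arg ∈ Ioc (-Real.pi) Real.pi) :
    (z ^ (s : ℂ)) ^ (t : ℂ) = z ^ ((s * t : ℝ) : ℂ) := by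
  have : (Complex.log z * s).im = s * z.arg := by
    simp [Complex.mul_im, Complex.log_im, mul_comm]
  rw [Complex.ofReal_mul, Complex.cpow_mul]
  · rw [this]; exact h.1
  · rw [this]; exact h.2

theorem Complex.neg_cpow_half_of_im_neg {w : ℂ} (hw : w.im < 0) :
    (-w) ^ ((1 / 2 : ℝ) : ℂ) = Complex.I * w ^ ((1 / 2 : ℝ) : ℂ) := by
  have h0 : w ≠ 0 := by rintro rfl; simp at hw
  rw [Complex.cpow_def_of_ne_zero (neg_ne_zero.2 h0), Complex.cpow_def_of_ne_zero h0,
    Complex.log, Complex.log, norm_neg, Complex.arg_neg_eq_arg_add_pi_of_im_neg hw]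
  rw [show (((Real.log ‖w‖ : ℝ) : ℂ) + ((w.arg + Real.pi : ℝ) : ℂ) * I) * ((1 / 2 : ℝ) : ℂ) =
    Real.pi / 2 * I + ((Real.log ‖w‖ : ℝ) + w.arg * I) * ((1 / 2 : ℝ) : ℂ) by push_cast; ring,
    Complex.exp_add, Complex.exp_pi_div_two_mul_I]

theorem Complex.neg_cpow_half_of_im_pos {w : ℂ} (hw : 0 < w.im) :
    (-w) ^ ((1 / 2 : ℝ) : ℂ) = -Complex.I * w ^ ((1 / 2 : ℝ) : ℂ) := by
  have := Complex.neg_cpow_half_of_im_neg (w := -w) (by simpa using hw)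
  rw [neg_neg] at this
  rw [this, ← mul_assoc]
  simp

theorem Complex.inv_im_pos_of_im_neg {w : ℂ} (hw : w.im < 0) : 0 < (w⁻¹).im := by
  have h0 : w ≠ 0 := by rintro rfl; simp at hw
  rw [Complex.inv_im]
  exact div_pos (by linarith) (Complex.normSq_pos.2 h0)

theorem Complex.inv_im_neg_of_im_pos {w : ℂ} (hw : 0 < w.im) : (w⁻¹).im < 0 := by
  have h0 : w ≠ 0 := by rintro rfl; simp at hw
  rw [Complex.inv_im]
  exact div_neg_of_neg_of_pos (by linarith) (Complex.normSq_pos.2 h0)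

theorem Complex.mul_cpow_of_im_neg_of_im_pos {x y : ℂ} (hx : x.im < 0) (hy : 0 < y.im) (s : ℂ) :
    (x * y) ^ s = x ^ s * y ^ s := by
  have hx0 : x ≠ 0 := by rintro rfl; simp at hx
  have hy0 : y ≠ 0 := by rintro rfl; simp at hy
  have h1 := Complex.arg_neg_iff.2 hx
  have h2 := Complex.neg_pi_lt_arg x
  have h3 := Complex.arg_nonneg_iff.2 hy.le
  have h4 := Complex.arg_le_pi y
  rw [Complex.cpow_def_of_ne_zero (mul_ne_zero hx0 hy0), Complex.cpow_def_of_ne_zero hx0,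
    Complex.cpow_def_of_ne_zero hy0, Complex.log_mul hx0 hy0 ⟨by linarith, by linarith⟩,
    ← Complex.exp_add]
  ring_nf

theorem Complex.one_sub_cpow_half_of_im_neg {w : ℂ} (hw : w.im < 0) :
    (1 - w) ^ ((1 / 2 : ℝ) : ℂ) =
      Complex.I * w ^ ((1 / 2 : ℝ) : ℂ) * (1 - w⁻¹) ^ ((1 / 2 : ℝ) : ℂ) := by
  have h0 : w ≠ 0 := by rintro rfl; simp at hw
  have h1 := Complex.inv_im_pos_of_im_neg hw
  rw [← Complex.neg_cpow_half_of_im_neg hw, mul_comm,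
    ← Complex.mul_cpow_of_im_neg_of_im_pos (by simpa using h1) (by simpa using hw)]
  congr 1
  field_simp
  ring

theorem Complex.one_sub_cpow_half_of_im_pos {w : ℂ} (hw : 0 < w.im) :
    (1 - w) ^ ((1 / 2 : ℝ) : ℂ) =
      -Complex.I * w ^ ((1 / 2 : ℝ) : ℂ) * (1 - w⁻¹) ^ ((1 / 2 : ℝ) : ℂ) := by
  have h0 : w ≠ 0 := by rintro rfl; simp at hw
  have h1 := Complex.inv_im_neg_of_im_pos hw
  rw [← Complex.neg_cpow_half_of_im_pos hw,
    ← Complex.mul_cpow_of_im_neg_of_im_pos (by simpa using hw) (by simpa using h1)]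
  congr 1
  field_simp
  ring

/-- The density, up to a constant factor, of the law of `B_p ^ (1 / σ)` on `(0, ∞)`. -/
noncomputable def betaDens (p σ t : ℝ) : ℝ := t ^ (p * σ - 1) * √(1 - t ^ σ)

/-- The holomorphic extension of `betaDens`. -/
noncomputable def betaDensC (p σ : ℝ) (z : ℂ) : ℂ :=
  z ^ ((p * σ - 1 : ℝ) : ℂ) * (1 - z ^ (σ : ℂ)) ^ ((1 / 2 : ℝ) : ℂ)

theorem betaDens_nonneg {p σ t : ℝ} (ht : 0 < t) : 0 ≤ betaDens p σ t := by
  unfold betaDens; positivity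

theorem betaDens_eq_comp {p σ t : ℝ} (ht : 0 < t) :
    |σ| * betaDens p σ t = (|σ| * t ^ (σ - 1)) • betaDens p 1 (t ^ σ) := by
  unfold betaDens
  rw [Real.rpow_one, smul_eq_mul, ← Real.rpow_mul ht.le,
    show p * σ - 1 = (σ - 1) + σ * (p * 1 - 1) by ring, Real.rpow_add ht]
  ring

theorem integrableOn_betaDens_one {p : ℝ} (hp : 0 < p) :
    IntegrableOn (betaDens p 1) (Ioi 0) := by
  have h1 : IntegrableOn (betaDens p 1) (Ioc 0 1) := by
    have h2 : IntegrableOn (fun x : ℝ => x ^ (p - 1)) (Ioc 0 1) :=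
      (intervalIntegrable_iff_integrableOn_Ioc_of_le zero_le_one).1
        (intervalIntegral.intervalIntegrable_rpow' (by linarith))
    refine h2.mono' (by unfold betaDens; fun_prop)
      ((ae_restrict_iff' measurableSet_Ioc).2 (ae_of_all _ fun t ht => ?_))
    rw [Real.norm_of_nonneg (betaDens_nonneg ht.1), betaDens, Real.rpow_one, mul_one]
    refine mul_le_of_le_one_right (Real.rpow_nonneg ht.1.le _) ?_
    rw [Real.sqrt_le_one]
    linarith [ht.1]
  rw [← Ioc_union_Ioi_eq_Ioi zero_le_one]
  refine h1.union ?_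
  refine integrableOn_zero.congr_fun (fun t ht => ?_) measurableSet_Ioi
  rw [betaDens, Real.rpow_one, Real.sqrt_eq_zero_of_nonpos (by linarith [mem_Ioi.1 ht]), mul_zero]

theorem integrableOn_betaDens {p σ : ℝ} (hp : 0 < p) (hσ : σ ≠ 0) :
    IntegrableOn (betaDens p σ) (Ioi 0) := by
  have h1 := (integrableOn_Ioi_comp_rpow_iff (betaDens p 1) hσ).2 (integrableOn_betaDens_one hp)
  have h2 : IntegrableOn (fun t => |σ| * betaDens p σ t) (Ioi 0) :=
    h1.congr_fun (fun t ht => (betaDens_eq_comp ht).symm) measurableSet_Ioi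
  have h3 : IntegrableOn (fun t => |σ|⁻¹ * (|σ| * betaDens p σ t)) (Ioi 0) := h2.const_mul _
  refine h3.congr_fun (fun t _ => ?_) measurableSet_Ioi
  have := abs_pos.2 hσ
  field_simp

theorem integral_betaDens_pos {p σ : ℝ} (hp : 0 < p) (hσ : σ ≠ 0) :
    0 < ∫ t in Ioi 0, betaDens p σ t := by
  have h1 : ∫ t in Ioi 0, |σ| * betaDens p σ t = ∫ t in Ioi 0, betaDens p 1 t := by
    rw [← integral_comp_rpow_Ioi (betaDens p 1) hσ]
    exact setIntegral_congr_fun measurableSet_Ioi fun t ht => betaDens_eq_comp ht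
  rw [integral_const_mul] at h1
  have h2 : 0 < ∫ t in Ioi 0, betaDens p 1 t := by
    rw [setIntegral_pos_iff_support_of_nonneg_ae
      ((ae_restrict_iff' measurableSet_Ioi).2 (ae_of_all _ fun t ht => betaDens_nonneg ht))
      (integrableOn_betaDens_one hp)]
    have : Ioo (0 : ℝ) 1 ⊆ Function.support (betaDens p 1) ∩ Ioi 0 := fun t ht => by
      refine ⟨?_, ht.1⟩
      rw [Function.mem_support, betaDens, Real.rpow_one]
      exact (mul_pos (Real.rpow_pos_of_pos ht.1 _)
        (Real.sqrt_pos.2 (by linarith [ht.2]))).ne'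
    refine lt_of_lt_of_le ?_ (measure_mono this)
    simp
  rw [← h1] at h2
  exact pos_of_mul_pos_right h2 (abs_nonneg σ)

theorem mul_arg_mem_Ioo {z : ℂ} {σ : ℝ} (hz : z ∈ Complex.slitPlane) (hσ : |σ| ≤ 1) :
    σ * z.arg ∈ Ioo (-Real.pi) Real.pi := by
  rw [mem_Ioo, ← abs_lt, abs_mul]
  have h1 : |z.arg| < Real.pi :=
    lt_of_le_of_ne (Complex.abs_arg_le_pi z) fun h => by
      rcases (abs_eq Real.pi_pos.le).1 h with h | h
      · exact (Complex.mem_slitPlane_iff_arg.1 hz).1 h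
      · exact absurd h (Complex.neg_pi_lt_arg z).ne'
  nlinarith [abs_nonneg z.arg, abs_nonneg σ]

theorem Complex.slitPlane_of_im_ne {z : ℂ} (hz : z.im ≠ 0) : z ∈ Complex.slitPlane := Or.inr hz

theorem cpow_im_neg_of_arg {z : ℂ} (hz : z ≠ 0) {σ : ℝ} (h : σ * z.arg ∈ Ioo (-Real.pi) 0) :
    (z ^ (σ : ℂ)).im < 0 := by
  rw [← Complex.arg_neg_iff, Complex.arg_cpow_ofReal hz ⟨h.1, h.2.le.trans Real.pi_pos.le⟩]
  exact h.2

theorem cpow_im_pos_of_arg {z : ℂ} (hz : z ≠ 0) {σ : ℝ} (h : σ * z.arg ∈ Ioo 0 Real.pi) :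
    0 < (z ^ (σ : ℂ)).im := by
  have h1 : (z ^ (σ : ℂ)).arg = σ * z.arg :=
    Complex.arg_cpow_ofReal hz ⟨by linarith [h.1, Real.pi_pos], h.2.le⟩
  have h2 : (z ^ (σ : ℂ)) ≠ 0 := by
    rw [Complex.cpow_def_of_ne_zero hz]; exact Complex.exp_ne_zero _
  rw [← Complex.norm_mul_sin_arg, h1]
  exact mul_pos (norm_pos_iff.2 h2) (Real.sin_pos_of_pos_of_lt_pi h.1 h.2)

theorem arg_mem_of_im_neg {z : ℂ} (hz : z.im < 0) : z.arg ∈ Ioo (-Real.pi) 0 :=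
  ⟨Complex.neg_pi_lt_arg z, Complex.arg_neg_iff.2 hz⟩

theorem arg_mem_of_im_pos {z : ℂ} (hz : 0 < z.im) : z.arg ∈ Ioo 0 Real.pi := by
  have h1 := Complex.arg_nonneg_iff.2 hz.le
  refine ⟨lt_of_le_of_ne h1 fun h => ?_, Complex.arg_lt_pi_iff.2 (Or.inr hz.ne')⟩
  rw [← Complex.norm_mul_sin_arg, ← h] at hz
  simp at hz

theorem cpow_im_ne {z : ℂ} (hz : z.im ≠ 0) {σ : ℝ} (hσ0 : σ ≠ 0) (hσ1 : |σ| ≤ 1) :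
    (z ^ (σ : ℂ)).im ≠ 0 := by
  have h0 : z ≠ 0 := by rintro rfl; simp at hz
  have h1 := mul_arg_mem_Ioo (Complex.slitPlane_of_im_ne hz) hσ1
  have h2 : z.arg ≠ 0 := by
    rcases lt_or_gt_of_ne hz with h | h
    · exact (arg_mem_of_im_neg h).2.ne
    · exact (arg_mem_of_im_pos h).1.ne'
  rcases lt_or_gt_of_ne (mul_ne_zero hσ0 h2) with h | h
  · exact (cpow_im_neg_of_arg h0 ⟨h1.1, h⟩).ne
  · exact (cpow_im_pos_of_arg h0 ⟨h, h1.2⟩).ne'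

/-- The domain of `betaDensC`: the non-real points and the positive reals where `betaDens`
does not vanish. -/
def betaDomain (σ : ℝ) : Set ℂ :=
  {z | z ∈ Complex.slitPlane ∧ 1 - z ^ (σ : ℂ) ∈ Complex.slitPlane}

theorem betaDomain_subset (σ : ℝ) : betaDomain σ ⊆ Complex.slitPlane := fun _ h => h.1

theorem isOpen_betaDomain (σ : ℝ) : IsOpen (betaDomain σ) := by
  have h : ContinuousOn (fun z : ℂ => 1 - z ^ (σ : ℂ)) Complex.slitPlane := fun z hz =>
    (continuousAt_const.sub (continuousAt_cpow_const hz)).continuousWithinAt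
  exact h.isOpen_inter_preimage Complex.isOpen_slitPlane Complex.isOpen_slitPlane

theorem mem_betaDomain_of_im_ne {z : ℂ} {σ : ℝ} (hz : z.im ≠ 0) (hσ0 : σ ≠ 0) (hσ1 : |σ| ≤ 1) :
    z ∈ betaDomain σ :=
  ⟨Complex.slitPlane_of_im_ne hz, Complex.slitPlane_of_im_ne (by
    simpa using cpow_im_ne hz hσ0 hσ1)⟩

theorem ofReal_mem_betaDomain {t σ : ℝ} : (t : ℂ) ∈ betaDomain σ ↔ 0 < t ∧ t ^ σ < 1 := by
  rw [betaDomain, Set.mem_ofPred_eq, Complex.ofReal_mem_slitPlane]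
  refine and_congr_right fun ht => ?_
  rw [← Complex.ofReal_cpow ht.le, ← Complex.ofReal_one, ← Complex.ofReal_sub,
    Complex.ofReal_mem_slitPlane, sub_pos]

theorem betaDensC_ofReal {p t σ : ℝ} (ht : (t : ℂ) ∈ betaDomain σ) :
    betaDensC p σ t = betaDens p σ t := by
  obtain ⟨h0, h1⟩ := ofReal_mem_betaDomain.1 ht
  rw [betaDensC, betaDens, ← Complex.ofReal_cpow h0.le, ← Complex.ofReal_cpow h0.le,
    ← Complex.ofReal_one, ← Complex.ofReal_sub, ← Complex.ofReal_cpow (by linarith),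
    Real.sqrt_eq_rpow]
  push_cast
  rfl

theorem differentiableOn_betaDensC (p σ : ℝ) :
    DifferentiableOn ℂ (betaDensC p σ) (betaDomain σ) := fun z hz => by
  have h1 : DifferentiableAt ℂ (fun z : ℂ => z ^ (σ : ℂ)) z :=
    differentiableAt_id.cpow_const hz.1
  have h2 : DifferentiableAt ℂ (fun z : ℂ => z ^ ((p * σ - 1 : ℝ) : ℂ)) z :=
    differentiableAt_id.cpow_const hz.1
  exact (h2.mul (((differentiableAt_const 1).sub h1).cpow_const hz.2)).differentiableWithinAt

theorem betaDensC_of_im_neg_of_pos {p σ : ℝ} {z : ℂ} (hz : z.im < 0) (hσ0 : 0 < σ)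
    (hσ1 : σ ≤ 1) : betaDensC p σ z = Complex.I * z ^ (((p + 1 / 2) * σ - 1 : ℝ) : ℂ) *
      (1 - z ^ ((-σ : ℝ) : ℂ)) ^ ((1 / 2 : ℝ) : ℂ) := by
  have h0 : z ≠ 0 := by rintro rfl; simp at hz
  have h1 := mul_arg_mem_Ioo (Complex.slitPlane_of_im_ne hz.ne) (abs_le.2 ⟨by linarith, hσ1⟩)
  have h2 : (z ^ (σ : ℂ)).im < 0 :=
    cpow_im_neg_of_arg h0 ⟨h1.1, mul_neg_of_pos_of_neg hσ0 (arg_mem_of_im_neg hz).2⟩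
  rw [betaDensC, Complex.one_sub_cpow_half_of_im_neg h2, ← Complex.cpow_neg,
    Complex.cpow_ofReal_cpow_ofReal ⟨h1.1, h1.2.le⟩, Complex.ofReal_neg,
    show (p + 1 / 2) * σ - 1 = (p * σ - 1) + σ * (1 / 2) by ring, Complex.ofReal_add (p * σ - 1),
    Complex.cpow_add _ _ h0]
  ring

theorem betaDensC_of_im_neg_of_neg {p σ : ℝ} {z : ℂ} (hz : z.im < 0) (hσ0 : σ < 0)
    (hσ1 : -1 ≤ σ) : betaDensC p σ z = -Complex.I * z ^ (((p + 1 / 2) * σ - 1 : ℝ) : ℂ) *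
      (1 - z ^ ((-σ : ℝ) : ℂ)) ^ ((1 / 2 : ℝ) : ℂ) := by
  have h0 : z ≠ 0 := by rintro rfl; simp at hz
  have h1 := mul_arg_mem_Ioo (Complex.slitPlane_of_im_ne hz.ne) (abs_le.2 ⟨hσ1, by linarith⟩)
  have h2 : 0 < (z ^ (σ : ℂ)).im :=
    cpow_im_pos_of_arg h0 ⟨mul_pos_of_neg_of_neg hσ0 (arg_mem_of_im_neg hz).2, h1.2⟩
  rw [betaDensC, Complex.one_sub_cpow_half_of_im_pos h2, ← Complex.cpow_neg,
    Complex.cpow_ofReal_cpow_ofReal ⟨h1.1, h1.2.le⟩, Complex.ofReal_neg,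
    show (p + 1 / 2) * σ - 1 = (p * σ - 1) + σ * (1 / 2) by ring, Complex.ofReal_add (p * σ - 1),
    Complex.cpow_add _ _ h0]
  ring

/-- The continuation of the Cauchy transform of `betaDens p σ` through its support. -/
noncomputable def betaCauchy (p σ a : ℝ) : ℂ → ℂ :=
  halfLineCont (betaDens p σ) (betaDensC p σ) a

section
variable {p σ a : ℝ}

theorem analyticOnNhd_betaCauchy (hp : 0 < p) (hσ : σ ≠ 0) (ha0 : 0 < a) (ha1 : a < 1) :
    AnalyticOnNhd ℂ (betaCauchy p σ a) (betaDomain σ) :=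
  (differentiableOn_halfLineCont (integrableOn_betaDens hp hσ) ha0 ha1 (isOpen_betaDomain σ)
    (betaDomain_subset σ) (differentiableOn_betaDensC p σ)
    fun _ ht => betaDensC_ofReal ht).analyticOnNhd (isOpen_betaDomain σ)

theorem betaCauchy_of_im_pos (hp : 0 < p) (hσ : σ ≠ 0) (ha0 : 0 < a) (ha1 : a < 1) {z : ℂ}
    (hz : 0 < z.im) : betaCauchy p σ a z = halfLineCauchy (betaDens p σ) z :=
  halfLineCont_of_im_pos (integrableOn_betaDens hp hσ) ha0 ha1 hz

theorem betaCauchy_of_im_neg (hp : 0 < p) (hσ : σ ≠ 0) (ha0 : 0 < a) (ha1 : a < 1) {z : ℂ}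
    (hz : z.im < 0) : betaCauchy p σ a z = halfLineCauchy (betaDens p σ) z -
      ((2 * powCauchyConst a * Real.sin (Real.pi * a) : ℝ) : ℂ) * Complex.I * betaDensC p σ z :=
  halfLineCont_of_im_neg (integrableOn_betaDens hp hσ) ha0 ha1 hz

theorem betaCauchy_im_neg_of_im_pos (hp : 0 < p) (hσ : σ ≠ 0) (ha0 : 0 < a) (ha1 : a < 1) {z : ℂ}
    (hz : 0 < z.im) : (betaCauchy p σ a z).im < 0 := by
  rw [betaCauchy_of_im_pos hp hσ ha0 ha1 hz]
  have := halfLineCauchy_im_mul_neg (integrableOn_betaDens hp hσ) (fun t => betaDens_nonneg)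
    (integral_betaDens_pos hp hσ) hz.ne'
  exact neg_of_mul_neg_right this hz.le

theorem lt_betaCauchy_im_of_im_neg (hp : 0 < p) (hσ : σ ≠ 0) (ha0 : 0 < a) (ha1 : a < 1) {z : ℂ}
    (hz : z.im < 0) : -(2 * powCauchyConst a * Real.sin (Real.pi * a)) * (betaDensC p σ z).re <
      (betaCauchy p σ a z).im := by
  rw [betaCauchy_of_im_neg hp hσ ha0 ha1 hz]
  have h1 := halfLineCauchy_im_mul_neg (integrableOn_betaDens hp hσ) (fun t => betaDens_nonneg)
    (integral_betaDens_pos hp hσ) hz.ne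
  have h2 : 0 < (halfLineCauchy (betaDens p σ) z).im := pos_of_mul_neg_right h1 hz.le
  rw [Complex.sub_im, mul_assoc _ Complex.I, Complex.im_ofReal_mul, Complex.I_mul_im]
  linarith

theorem sin_pi_mul_pos (ha0 : 0 < a) (ha1 : a < 1) : 0 < Real.sin (Real.pi * a) :=
  Real.sin_pos_of_pos_of_lt_pi (mul_pos Real.pi_pos ha0)
    (mul_lt_of_lt_one_right Real.pi_pos ha1)

theorem eventually_lt_betaCauchy_im_of_re_le (hp : 0 < p) (hσ : σ ≠ 0) (ha0 : 0 < a)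
    (ha1 : a < 1) {l : Filter ℂ} (hl : ∀ ε > 0, ∀ᶠ z in l, z.im < 0 → (betaDensC p σ z).re ≤ ε)
    {ε : ℝ} (hε : 0 < ε) : ∀ᶠ z in l, z.im < 0 → -ε < (betaCauchy p σ a z).im := by
  have hK : 0 < 2 * powCauchyConst a * Real.sin (Real.pi * a) := by
    have := powCauchyConst_pos ha0 ha1
    have := sin_pi_mul_pos ha0 ha1
    positivity
  filter_upwards [hl (ε / (2 * powCauchyConst a * Real.sin (Real.pi * a))) (div_pos hε hK)]
    with z hz hz0
  have h1 := lt_betaCauchy_im_of_im_neg hp hσ ha0 ha1 hz0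
  have h2 := (le_div_iff₀ hK).1 (hz hz0)
  nlinarith

theorem betaCauchy_ofReal_im {x : ℝ}
    (h : (x : ℂ) ∈ betaDomain σ) : (betaCauchy p σ a x).im =
      -(powCauchyConst a * Real.sin (Real.pi * a) * betaDens p σ x) :=
  halfLineCont_ofReal_im (ofReal_mem_betaDomain.1 h).1 (betaDensC_ofReal h)

/-- A lower bound for `Im (betaCauchy p σ a z)` in the closed upper half-plane from smallness of
the density near `z`. -/
theorem le_betaCauchy_im (hp : 0 < p) (hσ : σ ≠ 0) (ha0 : 0 < a) (ha1 : a < 1) {z : ℂ}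
    (hz : 0 ≤ z.im) (hzD : z ∈ betaDomain σ) {ε d : ℝ} (hε : 0 ≤ ε) (hd : 0 < d)
    (hsmall : ∀ t : ℝ, 0 < t → ‖z - t‖ < d → betaDens p σ t ≤ ε) :
    -(ε * (Real.pi + powCauchyConst a * Real.sin (Real.pi * a)) +
      z.im / d ^ 2 * ∫ t in Ioi 0, betaDens p σ t) ≤ (betaCauchy p σ a z).im := by
  have hK : 0 < powCauchyConst a * Real.sin (Real.pi * a) :=
    mul_pos (powCauchyConst_pos ha0 ha1) (sin_pi_mul_pos ha0 ha1)
  rcases hz.eq_or_lt with h0 | h0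
  · have h1 : z = (z.re : ℂ) := Complex.ext (by simp) (by simp [← h0])
    rw [h1] at hzD ⊢
    rw [betaCauchy_ofReal_im hzD]
    have h2 := hsmall z.re (ofReal_mem_betaDomain.1 hzD).1 (by rw [← h1]; simpa using hd)
    have := Real.pi_pos
    simp only [Complex.ofReal_im, zero_div, zero_mul, add_zero]
    nlinarith
  · rw [betaCauchy_of_im_pos hp hσ ha0 ha1 h0]
    have h2 := neg_halfLineCauchy_im_le (integrableOn_betaDens hp hσ)
      (fun t => betaDens_nonneg) h0 hε hd hsmall
    nlinarith

theorem eventually_lt_betaCauchy_im_nhds (hp : 0 < p) (hσ : σ ≠ 0) (ha0 : 0 < a)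
    (ha1 : a < 1) {x : ℝ} (hx : Tendsto (betaDens p σ) (𝓝[Ioi 0] x) (𝓝 0)) {ε : ℝ} (hε : 0 < ε) :
    ∀ᶠ z in 𝓝 (x : ℂ), 0 ≤ z.im → z ∈ betaDomain σ → -ε < (betaCauchy p σ a z).im := by
  have hK : 0 < powCauchyConst a * Real.sin (Real.pi * a) :=
    mul_pos (powCauchyConst_pos ha0 ha1) (sin_pi_mul_pos ha0 ha1)
  have hM := integral_betaDens_pos hp hσ
  set K := powCauchyConst a * Real.sin (Real.pi * a)
  set M := ∫ t in Ioi 0, betaDens p σ t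
  have hπ := Real.pi_pos
  have hε' : 0 < ε / 3 / (Real.pi + K) := by positivity
  obtain ⟨d, hd, hd1⟩ := Metric.eventually_nhds_iff_ball.1
    (eventually_nhdsWithin_iff.1 (hx.eventually (gt_mem_nhds hε')))
  have hcont : Tendsto (fun z : ℂ => z.im / (d / 2) ^ 2 * M) (𝓝 (x : ℂ)) (𝓝 0) := by
    have : Continuous (fun z : ℂ => z.im / (d / 2) ^ 2 * M) := by fun_prop
    simpa using this.tendsto (x : ℂ)
  filter_upwards [Metric.ball_mem_nhds (x : ℂ) (half_pos hd),
    hcont.eventually (gt_mem_nhds (by positivity : (0 : ℝ) < ε / 3))] with z h1 h2 hz hzD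
  have h3 := le_betaCauchy_im (ε := ε / 3 / (Real.pi + K)) hp hσ ha0 ha1 hz hzD hε'.le
    (half_pos hd) fun t ht htz => (hd1 t (by
      rw [mem_ball_iff_norm] at h1 ⊢
      have : ((t - x : ℝ) : ℂ) = (z - x) - (z - t) := by push_cast; ring
      rw [← Complex.norm_real, this]
      exact (norm_sub_le _ _).trans_lt (by linarith)) ht).le
  have h4 : ε / 3 / (Real.pi + K) * (Real.pi + K) = ε / 3 :=
    div_mul_cancel₀ _ (by positivity)
  rw [h4] at h3
  linarith

theorem eventually_lt_betaCauchy_im_cocompact (hp : 0 < p) (hσ : σ ≠ 0) (ha0 : 0 < a)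
    (ha1 : a < 1) (hx : Tendsto (betaDens p σ) atTop (𝓝 0)) {ε : ℝ} (hε : 0 < ε) :
    ∀ᶠ z in cocompact ℂ, 0 ≤ z.im → z ∈ betaDomain σ → -ε < (betaCauchy p σ a z).im := by
  have hK : 0 < powCauchyConst a * Real.sin (Real.pi * a) :=
    mul_pos (powCauchyConst_pos ha0 ha1) (sin_pi_mul_pos ha0 ha1)
  have hM := integral_betaDens_pos hp hσ
  set K := powCauchyConst a * Real.sin (Real.pi * a)
  set M := ∫ t in Ioi 0, betaDens p σ t
  have hπ := Real.pi_pos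
  have hε' : 0 < ε / 3 / (Real.pi + K) := by positivity
  obtain ⟨R, hR⟩ := eventually_atTop.1 (hx.eventually (gt_mem_nhds hε'))
  have h0 := tendsto_norm_cocompact_atTop (E := ℂ)
  filter_upwards [h0.eventually_ge_atTop (2 * R), h0.eventually_gt_atTop 0,
    h0.eventually_gt_atTop (12 * M / ε)] with z h1 h2 h5 hz hzD
  have h3 := le_betaCauchy_im (ε := ε / 3 / (Real.pi + K)) hp hσ ha0 ha1 hz hzD hε'.le
    (half_pos h2) fun t ht htz => (hR t (by
      have h6 : ‖z‖ ≤ ‖z - t‖ + ‖(t : ℂ)‖ := by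
        simpa using norm_add_le (z - t) (t : ℂ)
      rw [Complex.norm_real, Real.norm_of_nonneg ht.le] at h6
      linarith)).le
  have h4 : ε / 3 / (Real.pi + K) * (Real.pi + K) = ε / 3 :=
    div_mul_cancel₀ _ (by positivity)
  rw [h4] at h3
  have h6 : z.im / (‖z‖ / 2) ^ 2 * M ≤ ε / 3 := by
    have h7 : z.im ≤ ‖z‖ := Complex.im_le_norm z
    rw [div_mul_eq_mul_div, div_le_iff₀ (by positivity)]
    rw [div_lt_iff₀ hε] at h5
    have h8 : z.im * M ≤ ‖z‖ * M := by gcongr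
    nlinarith
  linarith

theorem tendsto_betaDens_zero {x : ℝ} (hx : x ≠ 0) (hx1 : (x : ℂ) ∉ betaDomain σ) :
    Tendsto (betaDens p σ) (𝓝[Ioi 0] x) (𝓝 0) := by
  rcases hx.lt_or_gt with h | h
  · have : 𝓝[Ioi 0] x = ⊥ := by
      rw [← notMem_closure_iff_nhdsWithin_eq_bot, closure_Ioi, mem_Ici]
      exact h.not_ge
    rw [this]; exact tendsto_bot
  · have h1 : ContinuousAt (betaDens p σ) x := by
      unfold betaDens
      exact (Real.continuousAt_rpow_const _ _ (Or.inl hx)).mul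
        (Real.continuous_sqrt.continuousAt.comp (continuousAt_const.sub
          (Real.continuousAt_rpow_const _ _ (Or.inl hx))))
    have h2 : betaDens p σ x = 0 := by
      have : 1 ≤ x ^ σ := by
        by_contra! h3
        exact hx1 (ofReal_mem_betaDomain.2 ⟨h, h3⟩)
      rw [betaDens, Real.sqrt_eq_zero_of_nonpos (by linarith), mul_zero]
    rw [← h2]
    exact h1.tendsto.mono_left nhdsWithin_le_nhds

theorem tendsto_betaDens_atTop (ha : p * σ < 1) :
    Tendsto (betaDens p σ) atTop (𝓝 0) := by
  have h1 : Tendsto (fun t : ℝ => t ^ (p * σ - 1)) atTop (𝓝 0) := by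
    have := tendsto_rpow_neg_atTop (show 0 < 1 - p * σ by linarith)
    simpa using this
  refine squeeze_zero' ?_ ?_ h1
  · filter_upwards [eventually_gt_atTop 0] with t ht using betaDens_nonneg ht
  · filter_upwards [eventually_gt_atTop 0] with t ht
    refine mul_le_of_le_one_right (Real.rpow_nonneg ht.le _) ?_
    rw [Real.sqrt_le_one]
    linarith [Real.rpow_nonneg ht.le σ]

end

/-- The domain on which `betaCauchy` is inverted. -/
def betaRegion (σ θ : ℝ) : Set ℂ := betaDomain σ ∩ {z | -θ < z.arg}

theorem isOpen_betaRegion (σ θ : ℝ) : IsOpen (betaRegion σ θ) := by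
  have h : ContinuousOn Complex.arg (betaDomain σ) := fun z hz =>
    (Complex.continuousAt_arg hz.1).continuousWithinAt
  exact h.isOpen_inter_preimage (isOpen_betaDomain σ) isOpen_Ioi

theorem mem_betaRegion_of_im_pos {σ θ : ℝ} {z : ℂ} (hσ0 : σ ≠ 0) (hσ1 : |σ| ≤ 1) (hθ : 0 < θ)
    (hz : 0 < z.im) : z ∈ betaRegion σ θ :=
  ⟨mem_betaDomain_of_im_ne hz.ne' hσ0 hσ1, by
    have := (arg_mem_of_im_pos hz).1
    change -θ < z.arg
    linarith⟩

theorem isPreconnected_betaRegion {σ θ : ℝ} (hσ0 : σ ≠ 0) (hσ1 : |σ| ≤ 1) (hθ : 0 < θ)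
    (hθπ : θ ≤ Real.pi) : IsPreconnected (betaRegion σ θ) := by
  let S : Set ℂ := {w | -θ < w.im ∧ w.im < Real.pi ∧ (w.im = 0 → σ * w.re < 0)}
  have hσ2 : 0 < σ * σ := mul_self_pos.2 hσ0
  have hπ := Real.pi_pos
  have hS : StarConvex ℝ ((-σ : ℝ) : ℂ) S := by
    intro w hw a b ha hb hab
    obtain ⟨h1, h2, h3⟩ := hw
    have him : (a • ((-σ : ℝ) : ℂ) + b • w).im = b * w.im := by simp
    have hre : (a • ((-σ : ℝ) : ℂ) + b • w).re = a * -σ + b * w.re := by simp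
    have hb1 : b ≤ 1 := by linarith
    refine ⟨?_, ?_, fun h => ?_⟩
    · rw [him]
      rcases hb.eq_or_lt with h5 | h5
      · subst h5; linarith
      · nlinarith
    · rw [him]
      rcases hb.eq_or_lt with h5 | h5
      · subst h5; linarith
      · nlinarith
    · rw [him] at h
      rw [hre]
      rcases mul_eq_zero.1 h with h | h
      · have : a = 1 := by linarith
        subst this; subst h; linarith
      · have h4 := h3 h
        rcases hb.eq_or_lt with h5 | h5
        · have : a = 1 := by linarith
          subst this; subst h5; linarith
        · nlinarith
  have hSne : ((-σ : ℝ) : ℂ) ∈ S := by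
    refine ⟨?_, ?_, fun _ => ?_⟩ <;> simp [hθ, hπ, hσ0]
  have himage : betaRegion σ θ = Complex.exp '' S := by
    ext z
    constructor
    · intro hz
      have h0 : z ≠ 0 := Complex.slitPlane_ne_zero hz.1.1
      refine ⟨Complex.log z, ⟨?_, ?_, fun h => ?_⟩, Complex.exp_log h0⟩
      · rw [Complex.log_im]; exact hz.2
      · rw [Complex.log_im]
        exact lt_of_le_of_ne (Complex.arg_le_pi z) (Complex.mem_slitPlane_iff_arg.1 hz.1.1).1
      · rw [Complex.log_im] at h
        have h1 : z = (‖z‖ : ℝ) := by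
          have := Complex.norm_mul_exp_arg_mul_I z
          rw [h] at this
          simpa using this.symm
        have h2 := hz.1
        rw [h1, ofReal_mem_betaDomain] at h2
        rw [Complex.log_re]
        have h3 := Real.log_neg (Real.rpow_pos_of_pos h2.1 _) h2.2
        rwa [Real.log_rpow h2.1] at h3
    · rintro ⟨w, ⟨h1, h2, h3⟩, rfl⟩
      have harg : (Complex.exp w).arg = w.im := by
        rw [Complex.arg_exp]
        exact (toIocMod_eq_self Real.two_pi_pos).2 ⟨by linarith, by linarith⟩
      refine ⟨?_, by change -θ < _; rwa [harg]⟩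
      rcases eq_or_ne w.im 0 with h | h
      · have : Complex.exp w = (Real.exp w.re : ℝ) := by
          rw [Complex.ofReal_exp]; congr 1; exact Complex.ext (by simp) (by simp [h])
        rw [this, ofReal_mem_betaDomain, ← Real.exp_mul]
        exact ⟨Real.exp_pos _, Real.exp_lt_one_iff.2 (by linarith [h3 h])⟩
      · refine mem_betaDomain_of_im_ne ?_ hσ0 hσ1
        rw [Complex.exp_im]
        refine mul_ne_zero (Real.exp_pos _).ne' ?_
        rw [Real.sin_ne_zero_iff]
        intro n hn
        rw [← hn] at h1 h2 h
        have hn1 : (-1 : ℝ) < n := by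
          by_contra! h5
          nlinarith
        have hn2 : (n : ℝ) < 1 := by
          by_contra! h5
          nlinarith
        have hn3 : n = 0 := by
          have : (-1 : ℤ) < n := by exact_mod_cast hn1
          have : n < (1 : ℤ) := by exact_mod_cast hn2
          omega
        subst hn3
        simp at h
  rw [himage]
  exact (hS.isPathConnected hSne).isConnected.isPreconnected.image _
    Complex.continuous_exp.continuousOn

theorem mem_cSector_of_mem_betaRegion {σ θ : ℝ} {z : ℂ} (hz : z ∈ betaRegion σ θ)
    (h : z.im < 0) : z ∈ cSector (-θ) 0 :=
  ⟨Complex.slitPlane_ne_zero hz.1.1, hz.2, Complex.arg_neg_iff.2 h⟩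

theorem Complex.cpow_half_im_pos {w : ℂ} (hw : 0 < w.im) :
    0 < (w ^ ((1 / 2 : ℝ) : ℂ)).im := by
  have h0 : w ≠ 0 := by rintro rfl; simp at hw
  have := arg_mem_of_im_pos hw
  exact cpow_im_pos_of_arg h0 ⟨by linarith [this.1], by linarith [this.2, this.1]⟩

section
variable {p σ : ℝ}

theorem betaDensC_re_neg_of_arg (hσ0 : σ < 0) (hσ1 : -1 ≤ σ) {z : ℂ} (hz : z.im < 0)
    (harg : (1 - (p + 1 / 2) * σ) * z.arg = -Real.pi) : (betaDensC p σ z).re < 0 := by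
  have h0 : z ≠ 0 := by rintro rfl; simp at hz
  rw [betaDensC_of_im_neg_of_neg hz hσ0 hσ1]
  have h1 : z ^ (((p + 1 / 2) * σ - 1 : ℝ) : ℂ) = -((‖z‖ ^ ((p + 1 / 2) * σ - 1) : ℝ) : ℂ) := by
    rw [Complex.cpow_def_of_ne_zero h0, Complex.log]
    have : ((Real.log ‖z‖ : ℝ) + z.arg * Complex.I) * (((p + 1 / 2) * σ - 1 : ℝ) : ℂ) =
        ((Real.log ‖z‖ * ((p + 1 / 2) * σ - 1) : ℝ) : ℂ) + Real.pi * Complex.I := by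
      rw [show Real.pi = ((p + 1 / 2) * σ - 1) * z.arg by linarith]
      push_cast; ring
    rw [this, Complex.exp_add, Complex.exp_pi_mul_I, ← Complex.ofReal_exp,
      Real.rpow_def_of_pos (norm_pos_iff.2 h0)]
    ring
  have h2 : 0 < (1 - z ^ ((-σ : ℝ) : ℂ)).im := by
    have h3 := arg_mem_of_im_neg hz
    have h4 := mul_arg_mem_Ioo (σ := -σ) (Complex.slitPlane_of_im_ne hz.ne)
      (abs_le.2 ⟨by linarith, by linarith⟩)
    have := cpow_im_neg_of_arg h0 ⟨h4.1, mul_neg_of_pos_of_neg (by linarith) h3.2⟩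
    simpa using this
  have h3 := Complex.cpow_half_im_pos h2
  have h4 : 0 < ‖z‖ ^ ((p + 1 / 2) * σ - 1) := Real.rpow_pos_of_pos (norm_pos_iff.2 h0) _
  rw [h1, show -Complex.I * -((‖z‖ ^ ((p + 1 / 2) * σ - 1) : ℝ) : ℂ) *
    (1 - z ^ ((-σ : ℝ) : ℂ)) ^ ((1 / 2 : ℝ) : ℂ) = ((‖z‖ ^ ((p + 1 / 2) * σ - 1) : ℝ) : ℂ) *
    (Complex.I * (1 - z ^ ((-σ : ℝ) : ℂ)) ^ ((1 / 2 : ℝ) : ℂ)) by ring, Complex.re_ofReal_mul,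
    Complex.I_mul_re]
  nlinarith

theorem continuousAt_cpow_mul_one_sub_cpow (s : ℝ) {τ x : ℝ} (hx : 0 < x) (hxτ : x ^ τ ≤ 1) :
    ContinuousAt (fun z : ℂ => z ^ (s : ℂ) * (1 - z ^ (τ : ℂ)) ^ ((1 / 2 : ℝ) : ℂ)) x := by
  have h1 := Complex.ofReal_mem_slitPlane.2 hx
  refine (continuousAt_cpow_const h1).mul ?_
  refine ContinuousAt.comp (f := fun z : ℂ => 1 - z ^ (τ : ℂ))
    (g := fun w : ℂ => w ^ ((1 / 2 : ℝ) : ℂ)) ?_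
    (continuousAt_const.sub (continuousAt_cpow_const h1))
  refine Complex.continuousAt_cpow_const_of_re_pos (Or.inl ?_) (by simp)
  rw [← Complex.ofReal_cpow hx.le]
  simpa using hxτ

theorem cpow_mul_one_sub_cpow_im (s : ℝ) {τ x : ℝ} (hx : 0 < x) (hxτ : x ^ τ ≤ 1) :
    ((x : ℂ) ^ (s : ℂ) * (1 - (x : ℂ) ^ (τ : ℂ)) ^ ((1 / 2 : ℝ) : ℂ)).im = 0 := by
  rw [← Complex.ofReal_cpow hx.le, ← Complex.ofReal_cpow hx.le, ← Complex.ofReal_one,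
    ← Complex.ofReal_sub, ← Complex.ofReal_cpow (by linarith), ← Complex.ofReal_mul,
    Complex.ofReal_im]

theorem tendsto_cpow_mul_one_sub_cpow_im (s : ℝ) {τ x : ℝ} (hx : 0 < x) (hxτ : x ^ τ ≤ 1) :
    Tendsto (fun z : ℂ => (z ^ (s : ℂ) * (1 - z ^ (τ : ℂ)) ^ ((1 / 2 : ℝ) : ℂ)).im)
      (𝓝 (x : ℂ)) (𝓝 0) := by
  have := (Complex.continuous_im.continuousAt.comp
    (continuousAt_cpow_mul_one_sub_cpow s hx hxτ)).tendsto
  rwa [Function.comp_apply, cpow_mul_one_sub_cpow_im s hx hxτ] at this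

theorem norm_one_sub_cpow_half_le (z : ℂ) (τ : ℝ) :
    ‖(1 - z ^ (τ : ℂ)) ^ ((1 / 2 : ℝ) : ℂ)‖ ≤ (1 + ‖z‖ ^ τ) ^ (1 / 2 : ℝ) := by
  rw [Complex.norm_cpow_real]
  refine Real.rpow_le_rpow (norm_nonneg _) ?_ (by norm_num)
  refine (norm_sub_le _ _).trans ?_
  rw [norm_one, Complex.norm_cpow_real]

end

theorem Ultrafilter.exists_le_nhds_of_not_le_cocompact {X : Type*} [TopologicalSpace X]
    {𝒰 : Ultrafilter X} (h : ¬ (𝒰 : Filter X) ≤ cocompact X) :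
    ∃ x, (𝒰 : Filter X) ≤ 𝓝 x := by
  rw [Filter.le_def] at h
  push Not at h
  obtain ⟨s, hs, hs1⟩ := h
  obtain ⟨K, hK, hKs⟩ := mem_cocompact.1 hs
  have hKU : K ∈ 𝒰 := by
    by_contra h'
    exact hs1 (mem_of_superset (Ultrafilter.compl_mem_iff_notMem.2 h') hKs)
  obtain ⟨x, -, hx⟩ := hK.ultrafilter_le_nhds 𝒰 (le_principal_iff.2 hKU)
  exact ⟨x, hx⟩

theorem norm_betaDensC_le {z : ℂ} (p σ : ℝ) :
    ‖betaDensC p σ z‖ ≤ ‖z‖ ^ (p * σ - 1) * (1 + ‖z‖ ^ σ) ^ (1 / 2 : ℝ) := by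
  rw [betaDensC, norm_mul, Complex.norm_cpow_real]
  exact mul_le_mul_of_nonneg_left (norm_one_sub_cpow_half_le z σ)
    (Real.rpow_nonneg (norm_nonneg _) _)

section
variable {p σ : ℝ}

theorem tendsto_betaDensC_cocompact_of_neg (hp : 0 < p) (hσ0 : σ < 0) :
    Tendsto (betaDensC p σ) (cocompact ℂ) (𝓝 0) := by
  have h0 := tendsto_norm_cocompact_atTop (E := ℂ)
  have h1 : Tendsto (fun t : ℝ => t ^ (p * σ - 1) * (1 + t ^ σ) ^ (1 / 2 : ℝ)) atTop (𝓝 0) := by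
    have h2 : Tendsto (fun t : ℝ => t ^ (p * σ - 1)) atTop (𝓝 0) := by
      have := tendsto_rpow_neg_atTop (show 0 < 1 - p * σ by nlinarith)
      simpa using this
    have h3 : Tendsto (fun t : ℝ => t ^ σ) atTop (𝓝 0) := by
      have := tendsto_rpow_neg_atTop (show 0 < -σ by linarith)
      simpa using this
    have h4 := h2.mul ((h3.const_add 1).rpow_const (p := 1 / 2) (Or.inr (by norm_num)))
    simpa using h4
  rw [tendsto_zero_iff_norm_tendsto_zero]
  exact squeeze_zero (fun _ => norm_nonneg _) (fun z => norm_betaDensC_le p σ) (h1.comp h0)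

theorem betaDens_eq_zero_of_neg (hσ0 : σ < 0) {t : ℝ} (ht0 : 0 < t) (ht : t ≤ 1) :
    betaDens p σ t = 0 := by
  have := Real.one_le_rpow_of_pos_of_le_one_of_nonpos ht0 ht hσ0.le
  rw [betaDens, Real.sqrt_eq_zero_of_nonpos (by linarith), mul_zero]

theorem tendsto_betaDens_nhds_zero_of_neg (hσ0 : σ < 0) :
    Tendsto (betaDens p σ) (𝓝[Ioi 0] 0) (𝓝 0) := by
  refine tendsto_const_nhds.congr' ?_
  filter_upwards [self_mem_nhdsWithin, nhdsWithin_le_nhds (Iio_mem_nhds one_pos)] with t h1 h2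
  exact (betaDens_eq_zero_of_neg hσ0 h1 (mem_Iio.1 h2).le).symm

theorem norm_halfLineCauchy_betaDens_le (hp : 0 < p) (hσ0 : σ < 0) {z : ℂ} (hz : ‖z‖ ≤ 1 / 2) :
    ‖halfLineCauchy (betaDens p σ) z‖ ≤ 2 * ∫ t in Ioi 0, betaDens p σ t := by
  rw [← integral_const_mul]
  refine norm_integral_le_of_norm_le ((integrableOn_betaDens hp hσ0.ne).const_mul 2)
    ((ae_restrict_iff' measurableSet_Ioi).2 (ae_of_all _ fun t ht => ?_))
  rcases le_or_gt t 1 with h | h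
  · rw [betaDens_eq_zero_of_neg hσ0 ht h]; simp
  · rw [norm_mul, norm_inv, Complex.norm_real, Real.norm_of_nonneg (betaDens_nonneg ht), mul_comm]
    refine mul_le_mul_of_nonneg_right ?_ (betaDens_nonneg ht)
    have h2 : ‖(t : ℂ)‖ ≤ ‖z - t‖ + ‖z‖ := by
      have := norm_sub_le z (z - t)
      rw [sub_sub_cancel] at this
      linarith
    rw [Complex.norm_real, Real.norm_of_nonneg (le_of_lt ht)] at h2
    rw [inv_le_comm₀ (by linarith) (by norm_num)]
    norm_num
    linarith

theorem tendsto_cpow_mul_betaCauchy_of_neg (hp : 0 < p) (hσ0 : σ < 0) (hσ1 : -1 ≤ σ) (θ : ℝ) :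
    Tendsto (fun z => z ^ ((1 - (p + 1 / 2) * σ : ℝ) : ℂ) * betaCauchy p σ (1 / 2) z)
      (𝓝[cSector (-θ) 0] 0) (𝓝 ((-(2 * powCauchyConst (1 / 2)) : ℝ) : ℂ)) := by
  set α := 1 - (p + 1 / 2) * σ with hα
  have hα0 : 0 < α := by nlinarith
  have hcont : ∀ s : ℝ, 0 < s → Tendsto (fun z : ℂ => z ^ (s : ℂ)) (𝓝 0) (𝓝 0) := fun s hs => by
    have := (Complex.continuousAt_cpow_const_of_re_pos (z := 0) (w := (s : ℂ)) (Or.inl le_rfl)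
      (by simpa using hs)).tendsto
    rwa [Complex.zero_cpow (by exact_mod_cast hs.ne')] at this
  have h1 : Tendsto (fun z : ℂ => z ^ (α : ℂ) * halfLineCauchy (betaDens p σ) z)
      (𝓝[cSector (-θ) 0] 0) (𝓝 0) := by
    refine ((hcont α hα0).mono_left nhdsWithin_le_nhds).zero_mul_isBoundedUnder_le
      (isBoundedUnder_of_eventually_le (a := 2 * ∫ t in Ioi 0, betaDens p σ t) ?_)
    filter_upwards [nhdsWithin_le_nhds (Metric.closedBall_mem_nhds (0 : ℂ) one_half_pos)] with z hz
    exact norm_halfLineCauchy_betaDens_le hp hσ0 (by simpa using hz)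
  have h2 : Tendsto (fun z : ℂ => ((-(2 * powCauchyConst (1 / 2)) : ℝ) : ℂ) *
      (1 - z ^ ((-σ : ℝ) : ℂ)) ^ ((1 / 2 : ℝ) : ℂ)) (𝓝[cSector (-θ) 0] 0)
      (𝓝 ((-(2 * powCauchyConst (1 / 2)) : ℝ) : ℂ)) := by
    have h3 := (hcont (-σ) (by linarith)).const_sub 1
    rw [sub_zero] at h3
    have h4 := (continuousAt_cpow_const (b := ((1 / 2 : ℝ) : ℂ)) Complex.one_mem_slitPlane).tendsto
    rw [Complex.one_cpow] at h4
    have := (h4.comp h3).const_mul ((-(2 * powCauchyConst (1 / 2)) : ℝ) : ℂ)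
    rw [mul_one] at this
    exact this.mono_left nhdsWithin_le_nhds
  have h5 := h1.add h2
  rw [zero_add] at h5
  refine h5.congr' ?_
  filter_upwards [self_mem_nhdsWithin] with z hz
  have hz1 : z.im < 0 := Complex.arg_neg_iff.1 hz.2.2
  rw [betaCauchy_of_im_neg hp hσ0.ne (by norm_num) (by norm_num) hz1,
    betaDensC_of_im_neg_of_neg hz1 hσ0 hσ1, mul_one_div, Real.sin_pi_div_two]
  have h6 : z ^ (α : ℂ) * z ^ (((p + 1 / 2) * σ - 1 : ℝ) : ℂ) = 1 := by
    rw [← Complex.cpow_add _ _ hz.1, ← Complex.ofReal_add]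
    simp [hα]
  push_cast at h6 ⊢
  linear_combination (-2 * (powCauchyConst (1 / 2) : ℂ) *
    (1 - z ^ (-(σ : ℂ))) ^ (1 / 2 : ℂ)) * (Complex.I ^ 2 * h6 + Complex.I_sq)

theorem betaCauchy_boundary_of_neg (hp : 0 < p) (hσ0 : σ < 0) (hσ1 : -1 ≤ σ) {θ : ℝ}
    (hθ : (1 - (p + 1 / 2) * σ) * θ = Real.pi) (𝒰 : Ultrafilter ℂ) (hD : betaRegion σ θ ∈ 𝒰) :
    (∃ z ∈ betaRegion σ θ, ↑𝒰 ≤ 𝓝 z) ∨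
      (∀ ε > 0, ∀ᶠ z in 𝒰, -ε < (betaCauchy p σ (1 / 2) z).im) ∨
      ↑𝒰 ≤ 𝓝[cSector (-θ) 0] (0 : ℂ) := by
  have hα1 : 1 < 1 - (p + 1 / 2) * σ := by nlinarith
  have hπ := Real.pi_pos
  have hθ0 : 0 < θ := by
    by_contra! h; nlinarith
  have hθπ : θ < Real.pi := by nlinarith
  have hσ1' : |σ| ≤ 1 := abs_le.2 ⟨hσ1, by linarith⟩
  have h12 : (0 : ℝ) < 1 / 2 := by norm_num
  have h12' : (1 / 2 : ℝ) < 1 := by norm_num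
  have key : ∀ l : Filter ℂ, ↑𝒰 ≤ l →
      (∀ ε > 0, ∀ᶠ z in l, 0 ≤ z.im → z ∈ betaDomain σ → -ε < (betaCauchy p σ (1 / 2) z).im) →
      (∀ ε > 0, ∀ᶠ z in l, z ∈ betaRegion σ θ → z.im < 0 → (betaDensC p σ z).re ≤ ε) →
      ∀ ε > 0, ∀ᶠ z in 𝒰, -ε < (betaCauchy p σ (1 / 2) z).im := by
    intro l hl h1 h2 ε hε
    have h3 := eventually_lt_betaCauchy_im_of_re_le (l := (𝒰 : Filter ℂ)) hp hσ0.ne h12 h12'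
      (fun ε hε => by
        filter_upwards [hl (h2 ε hε), hD] with z hz hzD using hz hzD) hε
    filter_upwards [h3, hl (h1 ε hε), hD] with z hz1 hz2 hz3
    rcases lt_or_ge z.im 0 with h | h
    exacts [hz1 h, hz2 h hz3.1]
  by_cases hcc : ↑𝒰 ≤ cocompact ℂ
  · refine Or.inr (Or.inl (key _ hcc (fun ε hε => eventually_lt_betaCauchy_im_cocompact hp hσ0.ne
      h12 h12' (tendsto_betaDens_atTop (by nlinarith)) hε) fun ε hε => ?_))
    have h1 := (Complex.continuous_re.tendsto 0).comp (tendsto_betaDensC_cocompact_of_neg hp hσ0)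
    filter_upwards [h1.eventually (gt_mem_nhds hε)] with z hz _ _ using hz.le
  obtain ⟨z₀, hz₀⟩ := Ultrafilter.exists_le_nhds_of_not_le_cocompact hcc
  by_cases hz₀D : z₀ ∈ betaRegion σ θ
  · exact Or.inl ⟨z₀, hz₀D, hz₀⟩
  rcases eq_or_ne z₀ 0 with rfl | hz₀0
  · rcases 𝒰.em (fun z => z.im < 0) with h | h
    · refine Or.inr (Or.inr (le_inf hz₀ (le_principal_iff.2 ?_)))
      filter_upwards [h, hD] with z hz hzD using mem_cSector_of_mem_betaRegion hzD hz
    · refine Or.inr (Or.inl fun ε hε => ?_)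
      have h1 := eventually_lt_betaCauchy_im_nhds (x := 0) hp hσ0.ne h12 h12'
        (tendsto_betaDens_nhds_zero_of_neg hσ0) hε
      rw [Complex.ofReal_zero] at h1
      filter_upwards [hz₀ h1, h, hD] with z hz hz1 hzD using hz (not_lt.1 hz1) hzD.1
  refine Or.inr (Or.inl ?_)
  rcases eq_or_ne z₀.im 0 with him | him
  · obtain ⟨x, rfl⟩ : ∃ x : ℝ, (x : ℂ) = z₀ := ⟨z₀.re, Complex.ext (by simp) (by simp [him])⟩
    have hx0 : x ≠ 0 := by exact_mod_cast hz₀0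
    have hxD : (x : ℂ) ∉ betaDomain σ := fun h => hz₀D ⟨h, by
      change -θ < _
      rw [Complex.arg_ofReal_of_nonneg (ofReal_mem_betaDomain.1 h).1.le]
      linarith⟩
    refine key _ hz₀ (fun ε hε => eventually_lt_betaCauchy_im_nhds hp hσ0.ne h12 h12'
      (tendsto_betaDens_zero hx0 hxD) hε) fun ε hε => ?_
    rcases hx0.lt_or_gt with hx | hx
    · have h1 := Complex.tendsto_arg_nhdsWithin_im_neg_of_re_neg_of_im_zero (z := (x : ℂ))
        (by simpa using hx) (by simp)
      filter_upwards [eventually_nhdsWithin_iff.1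
        (h1.eventually (gt_mem_nhds (show -Real.pi < -θ by linarith)))] with z hz hzD hz0
      exact absurd (hz hz0) (not_lt.2 (le_of_lt hzD.2))
    · have hx1 : x ^ (-σ) ≤ 1 := by
        have : 1 ≤ x ^ σ := by
          by_contra! h
          exact hxD (ofReal_mem_betaDomain.2 ⟨hx, h⟩)
        rw [Real.rpow_neg hx.le]
        exact inv_le_one_of_one_le₀ this
      filter_upwards [(tendsto_cpow_mul_one_sub_cpow_im ((p + 1 / 2) * σ - 1) hx hx1).eventually
        (gt_mem_nhds hε)] with z hz _ hz0
      rw [betaDensC_of_im_neg_of_neg hz0 hσ0 hσ1, mul_assoc, neg_mul, Complex.neg_re,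
        Complex.I_mul_re, neg_neg]
      exact hz.le
  · have hsl := Complex.slitPlane_of_im_ne him
    have hdom := mem_betaDomain_of_im_ne him hσ0.ne hσ1'
    have harg1 : z₀.arg ≤ -θ := by
      by_contra! h
      exact hz₀D ⟨hdom, h⟩
    have harg2 : -θ ≤ z₀.arg := by
      have h1 : Tendsto Complex.arg 𝒰 (𝓝 z₀.arg) := (Complex.continuousAt_arg hsl).mono_left hz₀
      refine ge_of_tendsto h1 ?_
      filter_upwards [hD] with z hz using le_of_lt hz.2
    have harg : z₀.arg = -θ := le_antisymm harg1 harg2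
    have him1 : z₀.im < 0 := by
      rw [← Complex.arg_neg_iff]; linarith
    have h1 := betaDensC_re_neg_of_arg (p := p) hσ0 hσ1 him1 (by rw [harg]; linarith)
    have h2 := lt_betaCauchy_im_of_im_neg hp hσ0.ne h12 h12' him1
    have h3 : 0 < (betaCauchy p σ (1 / 2) z₀).im := by
      have := powCauchyConst_pos h12 h12'
      have := sin_pi_mul_pos h12 h12'
      refine lt_trans ?_ h2
      exact mul_pos_of_neg_of_neg (by simp only [Left.neg_neg_iff]; positivity) h1
    intro ε hε
    have h4 := (analyticOnNhd_betaCauchy hp hσ0.ne h12 h12' z₀ hdom).continuousAt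
    have h5 := (Complex.continuous_im.continuousAt.comp h4).tendsto
    filter_upwards [hz₀ (h5.eventually (lt_mem_nhds h3))] with z hz
    have : 0 < (betaCauchy p σ (1 / 2) z).im := hz
    linarith

theorem exists_inverse_betaCauchy_of_neg (hp : 0 < p) (hσ0 : σ < 0) (hσ1 : -1 ≤ σ) :
    ∃ D : Set ℂ, {z | 0 < z.im} ⊆ D ∧ ∃ F : ℂ → ℂ, AnalyticOnNhd ℂ F {z | z.im < 0} ∧
      (∀ w, w.im < 0 → F w ∈ D ∧ betaCauchy p σ (1 / 2) (F w) = w) ∧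
      ∀ z ∈ D, (betaCauchy p σ (1 / 2) z).im < 0 → F (betaCauchy p σ (1 / 2) z) = z := by
  have hα1 : 1 < 1 - (p + 1 / 2) * σ := by nlinarith
  set α := 1 - (p + 1 / 2) * σ with hα
  have hπ := Real.pi_pos
  have hα0 : 0 < α := by linarith
  set θ := Real.pi / α with hθ
  have hθ1 : α * θ = Real.pi := mul_div_cancel₀ _ hα0.ne'
  have hθ0 : 0 < θ := div_pos hπ hα0
  have hθπ : θ < Real.pi := div_lt_self hπ hα1
  have hσ1' : |σ| ≤ 1 := abs_le.2 ⟨hσ1, by linarith⟩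
  have h12 : (0 : ℝ) < 1 / 2 := by norm_num
  have h12' : (1 / 2 : ℝ) < 1 := by norm_num
  have hk := powCauchyConst_pos h12 h12'
  have hsub : {z : ℂ | 0 < z.im} ⊆ betaRegion σ θ := fun z hz =>
    mem_betaRegion_of_im_pos hσ0.ne hσ1' hθ0 hz
  refine ⟨betaRegion σ θ, hsub, ?_⟩
  refine exists_analytic_inverse_lowerHalfPlane (b₁ := -θ) (b₂ := 0) (η₀ := -(θ / 2)) (α := α)
    (c₀ := ((-(2 * powCauchyConst (1 / 2)) : ℝ) : ℂ)) (isOpen_betaRegion σ θ)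
    (isPreconnected_betaRegion hσ0.ne hσ1' hθ0 hθπ.le)
    ((analyticOnNhd_betaCauchy hp hσ0.ne h12 h12').mono inter_subset_left) (by linarith) hπ.le
    ⟨by linarith, by linarith⟩ hα0 (by exact_mod_cast (by linarith : _ < (0 : ℝ)).ne)
    (Eventually.of_forall fun z hz => ⟨mem_betaDomain_of_im_ne
      (Complex.arg_neg_iff.1 hz.2.2).ne hσ0.ne hσ1', hz.2.1⟩)
    (tendsto_cpow_mul_betaCauchy_of_neg hp hσ0 hσ1 θ) (fun η hη h => ?_)
    (betaCauchy_boundary_of_neg hp hσ0 hσ1 hθ1)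
    ⟨Complex.I, hsub (by simp), betaCauchy_im_neg_of_im_pos hp hσ0.ne h12 h12' (by simp)⟩
  have h1 : Complex.exp ((α * η : ℝ) * Complex.I) * (-Complex.I) = -1 := by
    rw [h, Complex.norm_real, Real.norm_of_nonpos (by linarith), ← Complex.ofReal_div,
      div_neg, div_self (by linarith)]
    simp
  have h2 := congrArg Complex.im h1
  have h3 := congrArg Complex.re h1
  simp only [Complex.mul_im, Complex.mul_re, Complex.exp_ofReal_mul_I_re,
    Complex.exp_ofReal_mul_I_im, Complex.neg_re, Complex.neg_im, Complex.I_re, Complex.I_im,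
    Complex.one_re, Complex.one_im] at h2 h3
  have h4 : Real.cos (α * η) = 0 := by linarith
  have h5 : Real.sin (α * η + Real.pi / 2) = 0 := by rw [Real.sin_add_pi_div_two, h4]
  have h6 : α * -θ ≤ α * η := mul_le_mul_of_nonneg_left hη.1 hα0.le
  have h7 := mul_nonpos_of_nonneg_of_nonpos hα0.le hη.2
  have h8 := (Real.sin_eq_zero_iff_of_lt_of_lt (by linarith) (by linarith)).1 h5
  have h9 : α * η = α * -(θ / 2) := by linarith
  exact mul_left_cancel₀ hα0.ne' h9
end

theorem norm_cpow_sub_one_le {ζ : ℂ} (hζ : ‖ζ‖ = 1) {σ : ℝ} (hσ0 : 0 ≤ σ) (hσ1 : σ ≤ 1) :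
    ‖ζ ^ (σ : ℂ) - 1‖ ≤ ‖ζ - 1‖ := by
  have h0 : ζ ≠ 0 := by rintro rfl; simp at hζ
  have h1 : ζ ^ (σ : ℂ) = Complex.exp (Complex.I * (σ * ζ.arg : ℝ)) := by
    rw [Complex.cpow_def_of_ne_zero h0, Complex.log, hζ]
    push_cast; simp; ring_nf
  have h2 : ζ = Complex.exp (Complex.I * (ζ.arg : ℝ)) := by
    have := Complex.norm_mul_exp_arg_mul_I ζ
    rw [hζ, Complex.ofReal_one, one_mul, mul_comm] at this
    exact this.symm
  rw [h1]
  nth_rewrite 2 [h2]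
  rw [Complex.norm_exp_I_mul_ofReal_sub_one, Complex.norm_exp_I_mul_ofReal_sub_one,
    norm_mul, norm_mul]
  refine mul_le_mul_of_nonneg_left ?_ (norm_nonneg _)
  have hπ : |ζ.arg| ≤ Real.pi := Complex.abs_arg_le_pi ζ
  have habs : ∀ x : ℝ, |x| ≤ Real.pi / 2 → ‖Real.sin x‖ = Real.sin |x| := fun x hx => by
    rw [Real.norm_eq_abs]
    rcases le_total 0 x with h | h
    · rw [abs_of_nonneg h] at hx ⊢
      exact abs_of_nonneg (Real.sin_nonneg_of_nonneg_of_le_pi h (by linarith [Real.pi_pos]))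
    · rw [abs_of_nonpos h] at hx ⊢
      rw [Real.sin_neg]
      exact abs_of_nonpos (Real.sin_nonpos_of_nonpos_of_neg_pi_le h (by linarith [Real.pi_pos]))
  have h3 : |ζ.arg / 2| ≤ Real.pi / 2 := by
    rw [abs_div, abs_two]; linarith
  have h4 : |σ * ζ.arg / 2| ≤ |ζ.arg / 2| := by
    rw [mul_div_assoc, abs_mul, abs_of_nonneg hσ0]
    exact mul_le_of_le_one_left (abs_nonneg _) hσ1
  rw [habs _ (h4.trans h3), habs _ h3]
  exact Real.sin_le_sin_of_le_of_le_pi_div_two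
    (by linarith [abs_nonneg (σ * ζ.arg / 2), Real.pi_pos]) h3 h4

theorem abs_rpow_sub_one_le {τ σ : ℝ} (hτ : 0 < τ) (hσ0 : 0 ≤ σ) (hσ1 : σ ≤ 1) :
    |τ ^ σ - 1| ≤ |τ - 1| := by
  rcases le_total τ 1 with h | h
  · have h1 : τ ^ (1 : ℝ) ≤ τ ^ σ := Real.rpow_le_rpow_of_exponent_ge hτ h hσ1
    have h2 : τ ^ σ ≤ 1 := Real.rpow_le_one hτ.le h hσ0
    rw [Real.rpow_one] at h1
    rw [abs_of_nonpos (by linarith), abs_of_nonpos (by linarith)]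
    linarith
  · have h1 : τ ^ σ ≤ τ ^ (1 : ℝ) := Real.rpow_le_rpow_of_exponent_le h hσ1
    have h2 : 1 ≤ τ ^ σ := Real.one_le_rpow h hσ0
    rw [Real.rpow_one] at h1
    rw [abs_of_nonneg (by linarith), abs_of_nonneg (by linarith)]
    linarith

theorem norm_cpow_sub_rpow_le {z : ℂ} (hz : z ≠ 0) {t σ : ℝ} (ht : 0 < t) (hσ0 : 0 ≤ σ)
    (hσ1 : σ ≤ 1) : ‖z ^ (σ : ℂ) - (t ^ σ : ℝ)‖ ≤ 3 * ‖z‖ ^ (σ - 1) * ‖z - t‖ := by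
  have hρ : 0 < ‖z‖ := norm_pos_iff.2 hz
  have hρ' : (‖z‖ : ℂ) ≠ 0 := by exact_mod_cast hρ.ne'
  set ζ : ℂ := z / ‖z‖ with hζ
  set τ : ℝ := t / ‖z‖ with hτ
  have hζ1 : ‖ζ‖ = 1 := by
    rw [hζ, norm_div, Complex.norm_real, norm_norm, div_self hρ.ne']
  have hζ0 : ζ ≠ 0 := by rintro h; simp [h] at hζ1
  have hτ0 : 0 < τ := div_pos ht hρ
  have hzζ : z = (‖z‖ : ℝ) * ζ := by rw [hζ]; field_simp
  have htτ : t = ‖z‖ * τ := by rw [hτ]; field_simp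
  have h1 : z ^ (σ : ℂ) - (t ^ σ : ℝ) = ((‖z‖ ^ σ : ℝ) : ℂ) * (ζ ^ (σ : ℂ) - (τ ^ σ : ℝ)) := by
    conv_lhs => rw [hzζ, htτ, Complex.ofReal_mul_cpow hρ _ hζ0, Real.mul_rpow hρ.le hτ0.le]
    rw [Complex.ofReal_cpow hρ.le]
    push_cast
    rw [Complex.ofReal_cpow hρ.le]
    ring
  have h2 : z - t = ((‖z‖ : ℝ) : ℂ) * (ζ - τ) := by
    conv_lhs => rw [hzζ, htτ]
    push_cast; ring
  have h3 : |τ - 1| ≤ ‖ζ - τ‖ := by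
    have := abs_norm_sub_norm_le (τ : ℂ) ζ
    rwa [hζ1, Complex.norm_real, Real.norm_of_nonneg hτ0.le, norm_sub_rev] at this
  have h4 : ‖((τ - 1 : ℝ) : ℂ)‖ ≤ ‖ζ - τ‖ := by rwa [Complex.norm_real]
  have h5 : ‖((τ ^ σ - 1 : ℝ) : ℂ)‖ ≤ ‖ζ - τ‖ := by
    rw [Complex.norm_real]
    exact (abs_rpow_sub_one_le hτ0 hσ0 hσ1).trans h3
  have h6 : ‖ζ - 1‖ ≤ 2 * ‖ζ - τ‖ := by
    have : ζ - 1 = (ζ - τ) + ((τ - 1 : ℝ) : ℂ) := by push_cast; ring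
    rw [this]
    exact (norm_add_le _ _).trans (by linarith)
  have h7 : ‖ζ ^ (σ : ℂ) - (τ ^ σ : ℝ)‖ ≤ 3 * ‖ζ - τ‖ := by
    have : ζ ^ (σ : ℂ) - (τ ^ σ : ℝ) = (ζ ^ (σ : ℂ) - 1) - ((τ ^ σ - 1 : ℝ) : ℂ) := by
      push_cast; ring
    rw [this]
    refine (norm_sub_le _ _).trans ?_
    linarith [norm_cpow_sub_one_le hζ1 hσ0 hσ1]
  rw [h1, h2, norm_mul, norm_mul, Complex.norm_real, Complex.norm_real, norm_norm,
    Real.norm_of_nonneg (Real.rpow_nonneg hρ.le _), Real.rpow_sub_one hρ.ne']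
  calc ‖z‖ ^ σ * ‖ζ ^ (σ : ℂ) - (τ ^ σ : ℝ)‖ ≤ ‖z‖ ^ σ * (3 * ‖ζ - τ‖) := by gcongr
    _ = _ := by field_simp

theorem cpow_half_re_nonneg (w : ℂ) : 0 ≤ (w ^ ((1 / 2 : ℝ) : ℂ)).re := by
  rw [Complex.cpow_ofReal_re]
  have h1 := Complex.neg_pi_lt_arg w
  have h2 := Complex.arg_le_pi w
  exact mul_nonneg (Real.rpow_nonneg (norm_nonneg _) _)
    (Real.cos_nonneg_of_neg_pi_div_two_le_of_le (by linarith) (by linarith))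

theorem cpow_half_sq (w : ℂ) : (w ^ ((1 / 2 : ℝ) : ℂ)) ^ 2 = w := by
  rw [← Complex.cpow_nat_mul]
  simp

theorem norm_cpow_half_le_of_norm_le {w : ℂ} (hw : ‖w‖ ≤ 1 / 2) :
    ‖(1 - w) ^ ((1 / 2 : ℝ) : ℂ)‖ ≤ 3 / 2 := by
  have h1 : ‖(1 - w) ^ ((1 / 2 : ℝ) : ℂ)‖ ^ 2 ≤ 3 / 2 := by
    rw [← norm_pow, cpow_half_sq]
    refine (norm_sub_le _ _).trans ?_
    rw [norm_one]; linarith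
  nlinarith [norm_nonneg ((1 - w) ^ ((1 / 2 : ℝ) : ℂ))]

theorem norm_sqrt_one_sub_sub_le {w : ℂ} (hw : ‖w‖ ≤ 1 / 2) (x : ℝ) :
    ‖(√(1 - x) : ℂ) - (1 - w) ^ ((1 / 2 : ℝ) : ℂ)‖ ≤ 3 * ‖w - x‖ := by
  set m := (1 - w) ^ ((1 / 2 : ℝ) : ℂ) with hm
  rcases le_or_gt x 1 with hx | hx
  · have h1 : 1 / 2 ≤ m.re := by
      have h2 : m ^ 2 = 1 - w := cpow_half_sq _
      have h3 := congrArg Complex.re h2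
      rw [sq, Complex.mul_re, Complex.sub_re, Complex.one_re] at h3
      have h4 := (Complex.re_le_norm w).trans hw
      have h5 := cpow_half_re_nonneg (1 - w)
      rw [← hm] at h5
      nlinarith
    have h2 : ((√(1 - x) : ℂ) - m) * ((√(1 - x) : ℂ) + m) = w - x := by
      have h3 : m ^ 2 = 1 - w := cpow_half_sq _
      have h4 : (√(1 - x) : ℂ) ^ 2 = 1 - x := by
        rw [← Complex.ofReal_pow, Real.sq_sqrt (by linarith)]; simp
      linear_combination h4 - h3
    have h3 : 1 / 2 ≤ ‖(√(1 - x) : ℂ) + m‖ := by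
      refine le_trans ?_ (Complex.re_le_norm _)
      rw [Complex.add_re, Complex.ofReal_re]
      linarith [Real.sqrt_nonneg (1 - x)]
    rw [← h2, norm_mul]
    nlinarith [norm_nonneg ((√(1 - x) : ℂ) - m)]
  · rw [Real.sqrt_eq_zero_of_nonpos (by linarith), Complex.ofReal_zero, zero_sub, norm_neg]
    refine (norm_cpow_half_le_of_norm_le hw).trans ?_
    have h1 := norm_sub_norm_le (x : ℂ) w
    rw [Complex.norm_real, Real.norm_of_nonneg (by linarith), norm_sub_rev] at h1
    linarith

theorem norm_sqrt_one_sub_sub_le_three {w : ℂ} (hw : ‖w‖ ≤ 1 / 2) {x : ℝ} (hx : 0 ≤ x) :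
    ‖(√(1 - x) : ℂ) - (1 - w) ^ ((1 / 2 : ℝ) : ℂ)‖ ≤ 3 := by
  refine (norm_sub_le _ _).trans ?_
  have h1 := norm_cpow_half_le_of_norm_le hw
  have h2 : √(1 - x) ≤ 1 := Real.sqrt_le_one.2 (by linarith)
  rw [Complex.norm_real, Real.norm_of_nonneg (Real.sqrt_nonneg _)]
  linarith

section
variable {p σ a : ℝ}

theorem betaDens_sub_eq (ha : a = 1 - p * σ) {z : ℂ} (hz : z ≠ 0) {t : ℝ} :
    (betaDens p σ t : ℂ) - z ^ (a : ℂ) * betaDensC p σ z * ((t ^ (-a) : ℝ) : ℂ) =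
      ((t ^ (-a) : ℝ) : ℂ) *
        ((√(1 - t ^ σ) : ℂ) - (1 - z ^ (σ : ℂ)) ^ ((1 / 2 : ℝ) : ℂ)) := by
  have h1 : z ^ (a : ℂ) * z ^ ((p * σ - 1 : ℝ) : ℂ) = 1 := by
    rw [← Complex.cpow_add _ _ hz, ← Complex.ofReal_add]
    simp [ha]
  rw [betaDens, betaDensC, show p * σ - 1 = -a by linarith]
  rw [show p * σ - 1 = -a by linarith] at h1
  push_cast at h1 ⊢
  linear_combination (-(((t ^ (-a) : ℝ) : ℂ)) * (1 - z ^ (σ : ℂ)) ^ (1 / 2 : ℂ)) * h1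

theorem norm_betaDens_sub_mul_inv_le (ha : a = 1 - p * σ) (hσ0 : 0 < σ) (hσ1 : σ ≤ 1) {z : ℂ}
    (hz : z ≠ 0) (hz1 : ‖z‖ ^ σ ≤ 1 / 2) {t : ℝ} (ht : 0 < t) :
    ‖((betaDens p σ t : ℂ) - z ^ (a : ℂ) * betaDensC p σ z * ((t ^ (-a) : ℝ) : ℂ)) *
      (z - t)⁻¹‖ ≤ 9 * ‖z‖ ^ (σ - 1) * t ^ (-a) := by
  have hw : ‖z ^ (σ : ℂ)‖ ≤ 1 / 2 := by rwa [Complex.norm_cpow_real]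
  rw [betaDens_sub_eq ha hz, norm_mul, norm_mul, Complex.norm_real,
    Real.norm_of_nonneg (Real.rpow_nonneg ht.le _), norm_inv, mul_assoc, mul_comm]
  refine mul_le_mul_of_nonneg_right ?_ (Real.rpow_nonneg ht.le _)
  refine mul_inv_le_of_le_mul₀ (norm_nonneg _) (by positivity) ?_
  refine (norm_sqrt_one_sub_sub_le hw _).trans ?_
  linarith [norm_cpow_sub_rpow_le hz ht hσ0.le hσ1]

theorem norm_betaDens_sub_mul_inv_le_of_lt (ha : a = 1 - p * σ) (hσ0 : 0 < σ) {z : ℂ}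
    (hz : z ≠ 0) (hz1 : ‖z‖ ^ σ ≤ 1 / 2) {t : ℝ} (ht : 2 * ‖z‖ < t) :
    ‖((betaDens p σ t : ℂ) - z ^ (a : ℂ) * betaDensC p σ z * ((t ^ (-a) : ℝ) : ℂ)) *
      (z - t)⁻¹‖ ≤ 12 * t ^ (σ / 3 - a - 1) := by
  have hw : ‖z ^ (σ : ℂ)‖ ≤ 1 / 2 := by rwa [Complex.norm_cpow_real]
  have hρ : 0 < ‖z‖ := norm_pos_iff.2 hz
  have ht0 : 0 < t := by linarith
  have h1 : ‖(√(1 - t ^ σ) : ℂ) - (1 - z ^ (σ : ℂ)) ^ ((1 / 2 : ℝ) : ℂ)‖ ≤ 6 * t ^ (σ / 3) := by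
    rcases le_total t 1 with h | h
    · refine (norm_sqrt_one_sub_sub_le hw _).trans ?_
      have h2 : ‖z ^ (σ : ℂ) - (t ^ σ : ℝ)‖ ≤ 2 * t ^ σ := by
        refine (norm_sub_le _ _).trans ?_
        rw [Complex.norm_cpow_real, Complex.norm_real,
          Real.norm_of_nonneg (Real.rpow_nonneg ht0.le _)]
        have : ‖z‖ ^ σ ≤ t ^ σ := Real.rpow_le_rpow hρ.le (by linarith) hσ0.le
        linarith
      have h3 : t ^ σ ≤ t ^ (σ / 3) := Real.rpow_le_rpow_of_exponent_ge ht0 h (by linarith)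
      linarith
    · refine (norm_sqrt_one_sub_sub_le_three hw (Real.rpow_nonneg ht0.le _)).trans ?_
      have := Real.one_le_rpow h (show 0 ≤ σ / 3 by linarith)
      linarith
  have h2 : ‖(z - t)⁻¹‖ ≤ 2 * t⁻¹ := by
    have h3 := norm_sub_norm_le (t : ℂ) z
    rw [Complex.norm_real, Real.norm_of_nonneg ht0.le, norm_sub_rev] at h3
    rw [norm_inv, inv_le_comm₀ (by linarith) (by positivity), mul_inv, inv_inv]
    linarith
  rw [betaDens_sub_eq ha hz, norm_mul, norm_mul, Complex.norm_real,
    Real.norm_of_nonneg (Real.rpow_nonneg ht0.le _), Real.rpow_sub_one ht0.ne',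
    sub_eq_add_neg (σ / 3), Real.rpow_add ht0]
  calc t ^ (-a) * ‖(√(1 - t ^ σ) : ℂ) - (1 - z ^ (σ : ℂ)) ^ ((1 / 2 : ℝ) : ℂ)‖ * ‖(z - t)⁻¹‖
      ≤ t ^ (-a) * (6 * t ^ (σ / 3)) * (2 * t⁻¹) := by gcongr
    _ = _ := by field_simp; ring

theorem norm_integral_betaDens_sub_le (ha : a = 1 - p * σ) (ha1 : a < 1) (hσ0 : 0 < σ)
    (hσ1 : σ ≤ 1) (hσa : σ / 3 < a) {z : ℂ} (hz : z ≠ 0) (hz1 : ‖z‖ ^ σ ≤ 1 / 2) :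
    ‖∫ t in Ioi (0 : ℝ), ((betaDens p σ t : ℂ) - z ^ (a : ℂ) * betaDensC p σ z *
      ((t ^ (-a) : ℝ) : ℂ)) * (z - t)⁻¹‖ ≤
      9 * ‖z‖ ^ (σ - 1) * ((2 * ‖z‖) ^ (1 - a) / (1 - a)) +
        12 * ((2 * ‖z‖) ^ (σ / 3 - a) / (a - σ / 3)) := by
  have hρ : 0 < ‖z‖ := norm_pos_iff.2 hz
  set R := 2 * ‖z‖ with hR
  have hR0 : 0 < R := by positivity
  set g₁ : ℝ → ℝ := fun t => 9 * ‖z‖ ^ (σ - 1) * t ^ (-a)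
  set g₂ : ℝ → ℝ := fun t => 12 * t ^ (σ / 3 - a - 1)
  have hi₁ : IntegrableOn g₁ (Ioc 0 R) := Integrable.const_mul
    ((intervalIntegrable_iff_integrableOn_Ioc_of_le hR0.le).1
      (intervalIntegral.intervalIntegrable_rpow' (by linarith))) _
  have hi₂ : IntegrableOn g₂ (Ioi R) := Integrable.const_mul
    (integrableOn_Ioi_rpow_of_lt (by linarith) hR0) _
  have h1 : ∫ t in Ioc 0 R, g₁ t = 9 * ‖z‖ ^ (σ - 1) * (R ^ (1 - a) / (1 - a)) := by
    rw [integral_const_mul, ← intervalIntegral.integral_of_le hR0.le,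
      integral_rpow (Or.inl (by linarith)), Real.zero_rpow (by linarith)]
    ring_nf
  have h2 : ∫ t in Ioi R, g₂ t = 12 * (R ^ (σ / 3 - a) / (a - σ / 3)) := by
    rw [integral_const_mul, integral_Ioi_rpow_of_lt (by linarith) hR0,
      show σ / 3 - a - 1 + 1 = -(a - σ / 3) by ring, show σ / 3 - a = -(a - σ / 3) by ring,
      neg_div_neg_eq]
  have hI₁ : Integrable ((Ioc 0 R).indicator g₁) (volume.restrict (Ioi 0)) :=
    ((integrable_indicator_iff measurableSet_Ioc).2 hi₁).restrict
  have hI₂ : Integrable ((Ioi R).indicator g₂) (volume.restrict (Ioi 0)) :=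
    ((integrable_indicator_iff measurableSet_Ioi).2 hi₂).restrict
  have hs₁ : Ioi (0 : ℝ) ∩ Ioc 0 R = Ioc 0 R := inter_eq_right.2 Ioc_subset_Ioi_self
  have hs₂ : Ioi (0 : ℝ) ∩ Ioi R = Ioi R := inter_eq_right.2 (Ioi_subset_Ioi hR0.le)
  rw [← h1, ← h2, ← hs₁, ← hs₂, ← setIntegral_indicator measurableSet_Ioc,
    ← setIntegral_indicator measurableSet_Ioi, ← integral_add hI₁ hI₂]
  refine norm_integral_le_of_norm_le (hI₁.add hI₂)
    ((ae_restrict_iff' measurableSet_Ioi).2 (ae_of_all _ fun t ht => ?_))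
  rcases le_or_gt t R with h | h
  · rw [indicator_of_mem (show t ∈ Ioc 0 R from ⟨ht, h⟩),
      indicator_of_notMem (by simpa using h), add_zero]
    exact norm_betaDens_sub_mul_inv_le ha hσ0 hσ1 hz hz1 ht
  · rw [indicator_of_notMem (show t ∉ Ioc 0 R from fun h' => absurd h'.2 (not_le.2 h)),
      indicator_of_mem (mem_Ioi.2 h), zero_add]
    exact norm_betaDens_sub_mul_inv_le_of_lt ha hσ0 hz hz1 h

theorem tendsto_cpow_mul_betaCauchy_of_pos (ha : a = 1 - p * σ) (ha1 : a < 1)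
    (hσ0 : 0 < σ) (hσ1 : σ ≤ 1) (hσa : σ / 3 < a) :
    Tendsto (fun z => z ^ (a : ℂ) * betaCauchy p σ a z) (𝓝[≠] 0)
      (𝓝 (-(powCauchyConst a * Complex.exp (Real.pi * a * Complex.I)))) := by
  have hcont : ∀ s : ℝ, 0 < s → Tendsto (fun z : ℂ => z ^ (s : ℂ)) (𝓝 0) (𝓝 0) := fun s hs => by
    have := (Complex.continuousAt_cpow_const_of_re_pos (z := 0) (w := (s : ℂ)) (Or.inl le_rfl)
      (by simpa using hs)).tendsto
    rwa [Complex.zero_cpow (by exact_mod_cast hs.ne')] at this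
  have hnorm : ∀ s : ℝ, 0 < s → Tendsto (fun z : ℂ => ‖z‖ ^ s) (𝓝 0) (𝓝 0) := fun s hs => by
    have := (continuous_norm.tendsto (0 : ℂ)).rpow_const (p := s) (Or.inr hs.le)
    simpa [Real.zero_rpow hs.ne'] using this
  have h1 : Tendsto (fun z : ℂ => z ^ (a : ℂ) * ∫ t in Ioi (0 : ℝ), ((betaDens p σ t : ℂ) -
      z ^ (a : ℂ) * betaDensC p σ z * ((t ^ (-a) : ℝ) : ℂ)) * (z - t)⁻¹) (𝓝[≠] 0) (𝓝 0) := by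
    have h2 : Tendsto (fun z : ℂ => 9 * (2 ^ (1 - a) / (1 - a)) * ‖z‖ ^ σ +
        12 * (2 ^ (σ / 3 - a) / (a - σ / 3)) * ‖z‖ ^ (σ / 3)) (𝓝[≠] 0) (𝓝 0) := by
      have := ((hnorm σ hσ0).const_mul (9 * (2 ^ (1 - a) / (1 - a)))).add
        ((hnorm (σ / 3) (by linarith)).const_mul (12 * (2 ^ (σ / 3 - a) / (a - σ / 3))))
      rw [mul_zero, mul_zero, add_zero] at this
      exact this.mono_left nhdsWithin_le_nhds
    rw [tendsto_zero_iff_norm_tendsto_zero]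
    refine squeeze_zero' (Eventually.of_forall fun _ => norm_nonneg _) ?_ h2
    filter_upwards [self_mem_nhdsWithin, nhdsWithin_le_nhds ((hnorm σ hσ0).eventually
      (ge_mem_nhds (show (0 : ℝ) < 1 / 2 by norm_num)))] with z hz hz1
    have hρ : 0 < ‖z‖ := norm_pos_iff.2 hz
    rw [norm_mul, Complex.norm_cpow_real]
    refine (mul_le_mul_of_nonneg_left (norm_integral_betaDens_sub_le ha ha1 hσ0 hσ1 hσa hz hz1)
      (Real.rpow_nonneg hρ.le _)).trans_eq ?_
    rw [Real.mul_rpow two_pos.le hρ.le, Real.mul_rpow two_pos.le hρ.le]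
    have e1 : ‖z‖ ^ a * ‖z‖ ^ (σ - 1) * ‖z‖ ^ (1 - a) = ‖z‖ ^ σ := by
      rw [← Real.rpow_add hρ, ← Real.rpow_add hρ]; ring_nf
    have e2 : ‖z‖ ^ a * ‖z‖ ^ (σ / 3 - a) = ‖z‖ ^ (σ / 3) := by
      rw [← Real.rpow_add hρ]; ring_nf
    rw [← e1, ← e2]
    ring
  have h2 : Tendsto (fun z : ℂ => powCauchyConst a * Complex.exp (Real.pi * a * Complex.I) *
      (1 - z ^ (σ : ℂ)) ^ ((1 / 2 : ℝ) : ℂ)) (𝓝[≠] 0)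
      (𝓝 (powCauchyConst a * Complex.exp (Real.pi * a * Complex.I))) := by
    have h3 := (hcont σ hσ0).const_sub 1
    rw [sub_zero] at h3
    have h4 := (continuousAt_cpow_const (b := ((1 / 2 : ℝ) : ℂ)) Complex.one_mem_slitPlane).tendsto
    rw [Complex.one_cpow] at h4
    have := (h4.comp h3).const_mul (powCauchyConst a * Complex.exp (Real.pi * a * Complex.I))
    rw [mul_one] at this
    exact this.mono_left nhdsWithin_le_nhds
  have h5 := h1.sub h2
  rw [zero_sub] at h5
  refine h5.congr' ?_
  filter_upwards [self_mem_nhdsWithin] with z hz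
  have h6 : z ^ (a : ℂ) * z ^ ((p * σ - 1 : ℝ) : ℂ) = 1 := by
    rw [← Complex.cpow_add _ _ hz, ← Complex.ofReal_add]
    simp [ha]
  rw [betaCauchy, halfLineCont]
  have h7 : betaDensC p σ z =
      z ^ ((p * σ - 1 : ℝ) : ℂ) * (1 - z ^ (σ : ℂ)) ^ ((1 / 2 : ℝ) : ℂ) := rfl
  linear_combination powCauchyConst a * Complex.exp (Real.pi * a * Complex.I) *
    ((1 - z ^ (σ : ℂ)) ^ ((1 / 2 : ℝ) : ℂ) * h6 + z ^ (a : ℂ) * h7)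

end

section
variable {p σ a : ℝ}

theorem re_I_mul_cpow_nonpos {z : ℂ} (hz : z.im < 0) {s : ℝ} (hs0 : s ≤ 0) (hs1 : -1 ≤ s) :
    (Complex.I * z ^ (s : ℂ)).re ≤ 0 := by
  have h1 := arg_mem_of_im_neg hz
  rw [Complex.I_mul_re, Complex.cpow_ofReal_im, neg_nonpos]
  refine mul_nonneg (Real.rpow_nonneg (norm_nonneg _) _)
    (Real.sin_nonneg_of_nonneg_of_le_pi ?_ ?_) <;> nlinarith [h1.1, h1.2]

theorem eventually_betaDensC_re_le_cocompact (hp : 0 < p) (hσ0 : 0 < σ) (hσ1 : σ ≤ 1)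
    (hpσ : (p + 1 / 2) * σ ≤ 1) {ε : ℝ} (hε : 0 < ε) :
    ∀ᶠ z in cocompact ℂ, z.im < 0 → (betaDensC p σ z).re ≤ ε := by
  have h0 : Tendsto (fun z : ℂ => z ^ ((-σ : ℝ) : ℂ)) (cocompact ℂ) (𝓝 0) := by
    rw [tendsto_zero_iff_norm_tendsto_zero]
    simp_rw [Complex.norm_cpow_real]
    exact (tendsto_rpow_neg_atTop hσ0).comp (tendsto_norm_cocompact_atTop (E := ℂ))
  have h1 : Tendsto (fun z : ℂ => ‖(1 - z ^ ((-σ : ℝ) : ℂ)) ^ ((1 / 2 : ℝ) : ℂ) - 1‖)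
      (cocompact ℂ) (𝓝 0) := by
    have h3 := h0.const_sub 1
    rw [sub_zero] at h3
    have h4 := (continuousAt_cpow_const (b := ((1 / 2 : ℝ) : ℂ)) Complex.one_mem_slitPlane).tendsto
    rw [Complex.one_cpow] at h4
    simpa using ((h4.comp h3).sub_const 1).norm
  filter_upwards [h1.eventually (gt_mem_nhds hε),
    (tendsto_norm_cocompact_atTop (E := ℂ)).eventually (eventually_ge_atTop 1)] with z hz hz1 hz0
  set s := (p + 1 / 2) * σ - 1 with hs
  have hs0 : s ≤ 0 := by linarith
  have hs1 : -1 ≤ s := by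
    have : 0 < (p + 1 / 2) * σ := by positivity
    linarith
  rw [betaDensC_of_im_neg_of_pos hz0 hσ0 hσ1]
  set q := (1 - z ^ ((-σ : ℝ) : ℂ)) ^ ((1 / 2 : ℝ) : ℂ)
  have h2 : Complex.I * z ^ (s : ℂ) * q =
      Complex.I * z ^ (s : ℂ) + Complex.I * z ^ (s : ℂ) * (q - 1) := by ring
  have h3 : ‖Complex.I * z ^ (s : ℂ) * (q - 1)‖ ≤ ‖q - 1‖ := by
    rw [norm_mul, norm_mul, Complex.norm_I, one_mul, Complex.norm_cpow_real]
    exact mul_le_of_le_one_left (norm_nonneg _) (Real.rpow_le_one_of_one_le_of_nonpos hz1 hs0)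
  rw [h2, Complex.add_re]
  linarith [re_I_mul_cpow_nonpos hz0 hs0 hs1, Complex.re_le_norm (Complex.I * z ^ (s : ℂ) * (q - 1))]

theorem betaDensC_re_le (ha : a = 1 - p * σ) (ha0 : 0 < a) (ha1 : a ≤ 1) (hσ0 : 0 < σ)
    (hσ1 : σ ≤ 1) {z : ℂ} (hz : z.im < 0) :
    (betaDensC p σ z).re ≤
      ‖z‖ ^ (-a) * (max 0 (Real.cos (a * z.arg)) * (1 + ‖z‖ ^ σ) ^ (1 / 2 : ℝ)) := by
  have h0 : z ≠ 0 := by rintro rfl; simp at hz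
  have hφ := arg_mem_of_im_neg hz
  have hw : 0 < (1 - z ^ (σ : ℂ)).im := by
    have := cpow_im_neg_of_arg h0 (σ := σ) ⟨by nlinarith [hφ.1, hφ.2], by nlinarith [hφ.2]⟩
    simpa using this
  have hm1 := Complex.cpow_half_im_pos hw
  have hm2 := cpow_half_re_nonneg (1 - z ^ (σ : ℂ))
  have hm3 := (Complex.re_le_norm _).trans (norm_one_sub_cpow_half_le z σ)
  rw [betaDensC, Complex.mul_re, Complex.cpow_ofReal_re, Complex.cpow_ofReal_im,
    show p * σ - 1 = -a by linarith, show z.arg * -a = -(a * z.arg) by ring, Real.cos_neg,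
    mul_assoc, mul_assoc, ← mul_sub]
  refine mul_le_mul_of_nonneg_left ?_ (Real.rpow_nonneg (norm_nonneg _) _)
  have hs : 0 ≤ Real.sin (-(a * z.arg)) :=
    Real.sin_nonneg_of_nonneg_of_le_pi (by nlinarith [hφ.2]) (by nlinarith [hφ.1, hφ.2])
  have h1 := mul_nonneg hs hm1.le
  have h2 : Real.cos (a * z.arg) * ((1 - z ^ (σ : ℂ)) ^ ((1 / 2 : ℝ) : ℂ)).re ≤
      max 0 (Real.cos (a * z.arg)) * (1 + ‖z‖ ^ σ) ^ (1 / 2 : ℝ) :=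
    mul_le_mul (le_max_right _ _) hm3 hm2 (le_max_left _ _)
  linarith

theorem eventually_betaDensC_re_le_of_neg (ha : a = 1 - p * σ) (ha0 : 1 / 2 ≤ a) (ha1 : a ≤ 1)
    (hσ0 : 0 < σ) (hσ1 : σ ≤ 1) {x : ℝ} (hx : x < 0) {ε : ℝ} (hε : 0 < ε) :
    ∀ᶠ z in 𝓝 (x : ℂ), z.im < 0 → (betaDensC p σ z).re ≤ ε := by
  have hx0 : (x : ℂ) ≠ 0 := by exact_mod_cast hx.ne
  have h1 := Complex.tendsto_arg_nhdsWithin_im_neg_of_re_neg_of_im_zero (z := (x : ℂ))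
    (by simpa using hx) (by simp)
  have hc : Real.cos (a * -Real.pi) ≤ 0 := by
    rw [mul_neg, Real.cos_neg]
    exact Real.cos_nonpos_of_pi_div_two_le_of_le (by nlinarith [Real.pi_pos])
      (by nlinarith [Real.pi_pos])
  have h2 : Tendsto (fun z : ℂ => max 0 (Real.cos (a * z.arg))) (𝓝[{z : ℂ | z.im < 0}] (x : ℂ))
      (𝓝 0) := by
    have := (tendsto_const_nhds (x := (0 : ℝ))).max
      ((Real.continuous_cos.tendsto _).comp (h1.const_mul a))
    rwa [max_eq_left hc] at this
  have h3 : Tendsto (fun z : ℂ => ‖z‖) (𝓝[{z : ℂ | z.im < 0}] (x : ℂ)) (𝓝 ‖(x : ℂ)‖) :=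
    (continuous_norm.tendsto _).mono_left nhdsWithin_le_nhds
  have h4 := (h3.rpow_const (p := -a) (Or.inl (norm_ne_zero_iff.2 hx0))).mul
    (h2.mul (((h3.rpow_const (p := σ) (Or.inl (norm_ne_zero_iff.2 hx0))).const_add 1).rpow_const
      (p := 1 / 2) (Or.inr (by norm_num))))
  rw [zero_mul, mul_zero] at h4
  filter_upwards [eventually_nhdsWithin_iff.1 (h4.eventually (gt_mem_nhds hε))] with z hz hz0
  exact (betaDensC_re_le ha (by linarith) ha1 hσ0 hσ1 hz0).trans (hz hz0).le

theorem betaCauchy_boundary_of_pos (hp : 0 < p) (hp1 : p ≤ 1 / 2) (hσ0 : 0 < σ) (hσ1 : σ ≤ 1)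
    (𝒰 : Ultrafilter ℂ) (hD : betaRegion σ Real.pi ∈ 𝒰) :
    (∃ z ∈ betaRegion σ Real.pi, ↑𝒰 ≤ 𝓝 z) ∨
      (∀ ε > 0, ∀ᶠ z in 𝒰, -ε < (betaCauchy p σ (1 - p * σ) z).im) ∨
      ↑𝒰 ≤ 𝓝[cSector (-Real.pi) Real.pi] (0 : ℂ) := by
  have hπ := Real.pi_pos
  have hσ1' : |σ| ≤ 1 := abs_le.2 ⟨by linarith, hσ1⟩
  obtain ⟨a, ha⟩ : ∃ a, a = 1 - p * σ := ⟨_, rfl⟩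
  have hpσ : 0 < p * σ := mul_pos hp hσ0
  have hpσ1 : p * σ ≤ 1 / 2 := by nlinarith
  have ha0 : 1 / 2 ≤ a := by linarith
  have ha1 : a < 1 := by linarith
  have ha0' : 0 < a := by linarith
  rw [← ha]
  have key : ∀ l : Filter ℂ, ↑𝒰 ≤ l →
      (∀ ε > 0, ∀ᶠ z in l, 0 ≤ z.im → z ∈ betaDomain σ → -ε < (betaCauchy p σ a z).im) →
      (∀ ε > 0, ∀ᶠ z in l, z.im < 0 → (betaDensC p σ z).re ≤ ε) →
      ∀ ε > 0, ∀ᶠ z in 𝒰, -ε < (betaCauchy p σ a z).im := by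
    intro l hl h1 h2 ε hε
    have h3 := eventually_lt_betaCauchy_im_of_re_le hp hσ0.ne' ha0' ha1 h2 hε
    filter_upwards [hl h3, hl (h1 ε hε), hD] with z hz1 hz2 hz3
    rcases lt_or_ge z.im 0 with h | h
    exacts [hz1 h, hz2 h hz3.1]
  by_cases hcc : ↑𝒰 ≤ cocompact ℂ
  · exact Or.inr (Or.inl (key _ hcc (fun ε hε => eventually_lt_betaCauchy_im_cocompact hp hσ0.ne'
      ha0' ha1 (tendsto_betaDens_atTop (by linarith)) hε) fun ε hε =>
        eventually_betaDensC_re_le_cocompact hp hσ0 hσ1 (by nlinarith) hε))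
  obtain ⟨z₀, hz₀⟩ := Ultrafilter.exists_le_nhds_of_not_le_cocompact hcc
  by_cases hz₀D : z₀ ∈ betaRegion σ Real.pi
  · exact Or.inl ⟨z₀, hz₀D, hz₀⟩
  rcases eq_or_ne z₀ 0 with rfl | hz₀0
  · refine Or.inr (Or.inr (le_inf hz₀ (le_principal_iff.2 ?_)))
    filter_upwards [hD] with z hz
    exact ⟨Complex.slitPlane_ne_zero hz.1.1, Complex.neg_pi_lt_arg z,
      lt_of_le_of_ne (Complex.arg_le_pi z) (Complex.mem_slitPlane_iff_arg.1 hz.1.1).1⟩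
  have him : z₀.im = 0 := by
    by_contra him
    exact hz₀D ⟨mem_betaDomain_of_im_ne him hσ0.ne' hσ1', Complex.neg_pi_lt_arg _⟩
  refine Or.inr (Or.inl ?_)
  obtain ⟨x, rfl⟩ : ∃ x : ℝ, (x : ℂ) = z₀ := ⟨z₀.re, Complex.ext (by simp) (by simp [him])⟩
  have hx0 : x ≠ 0 := by exact_mod_cast hz₀0
  have hxD : (x : ℂ) ∉ betaDomain σ := fun h => hz₀D ⟨h, Complex.neg_pi_lt_arg _⟩
  refine key _ hz₀ (fun ε hε => eventually_lt_betaCauchy_im_nhds hp hσ0.ne' ha0' ha1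
    (tendsto_betaDens_zero hx0 hxD) hε) fun ε hε => ?_
  rcases hx0.lt_or_gt with hx | hx
  · exact eventually_betaDensC_re_le_of_neg ha ha0 ha1.le hσ0 hσ1 hx hε
  · have hx1 : x ^ (-σ) ≤ 1 := by
      have : 1 ≤ x ^ σ := by
        by_contra! h
        exact hxD (ofReal_mem_betaDomain.2 ⟨hx, h⟩)
      rw [Real.rpow_neg hx.le]
      exact inv_le_one_of_one_le₀ this
    filter_upwards [(tendsto_cpow_mul_one_sub_cpow_im ((p + 1 / 2) * σ - 1) hx hx1).eventually
      (lt_mem_nhds (neg_lt_zero.2 hε))] with z hz hz0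
    rw [betaDensC_of_im_neg_of_pos hz0 hσ0 hσ1, mul_assoc, Complex.I_mul_re]
    linarith

theorem eventually_mem_betaRegion_of_mem_cSector (hσ0 : 0 < σ) :
    ∀ᶠ z in 𝓝 (0 : ℂ), z ∈ cSector (-Real.pi) Real.pi → z ∈ betaRegion σ Real.pi := by
  filter_upwards [Metric.ball_mem_nhds (0 : ℂ) one_pos] with z hz hzs
  refine ⟨⟨Complex.mem_slitPlane_iff_arg.2 ⟨hzs.2.2.ne, hzs.1⟩, Or.inl ?_⟩, hzs.2.1⟩
  have h1 : ‖z ^ (σ : ℂ)‖ < 1 := by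
    rw [Complex.norm_cpow_real]
    exact Real.rpow_lt_one (norm_nonneg _) (by simpa using hz) hσ0
  rw [Complex.sub_re, Complex.one_re]
  linarith [Complex.re_le_norm (z ^ (σ : ℂ))]

theorem exists_inverse_betaCauchy_of_pos (hp : 0 < p) (hp1 : p ≤ 1 / 2) (hσ0 : 0 < σ)
    (hσ1 : σ ≤ 1) :
    ∃ D : Set ℂ, {z | 0 < z.im} ⊆ D ∧ ∃ F : ℂ → ℂ, AnalyticOnNhd ℂ F {z | z.im < 0} ∧
      (∀ w, w.im < 0 → F w ∈ D ∧ betaCauchy p σ (1 - p * σ) (F w) = w) ∧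
      ∀ z ∈ D, (betaCauchy p σ (1 - p * σ) z).im < 0 →
        F (betaCauchy p σ (1 - p * σ) z) = z := by
  have hπ := Real.pi_pos
  have hσ1' : |σ| ≤ 1 := abs_le.2 ⟨by linarith, hσ1⟩
  have hbd := betaCauchy_boundary_of_pos hp hp1 hσ0 hσ1
  obtain ⟨a, ha⟩ : ∃ a, a = 1 - p * σ := ⟨_, rfl⟩
  have hpσ : 0 < p * σ := mul_pos hp hσ0
  have hpσ1 : p * σ ≤ 1 / 2 * σ := by gcongr
  have ha0 : 1 / 2 ≤ a := by linarith
  have ha1 : a < 1 := by linarith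
  have ha0' : 0 < a := by linarith
  rw [← ha] at hbd ⊢
  have hk := powCauchyConst_pos ha0' ha1
  have hsub : {z : ℂ | 0 < z.im} ⊆ betaRegion σ Real.pi := fun z hz =>
    mem_betaRegion_of_im_pos hσ0.ne' hσ1' hπ hz
  refine ⟨betaRegion σ Real.pi, hsub, ?_⟩
  have hη : a * (Real.pi - Real.pi / (2 * a)) = Real.pi * a - Real.pi / 2 := by field_simp
  have hexp : ‖Complex.exp (Real.pi * a * Complex.I)‖ = 1 := by
    have := Complex.norm_exp_ofReal_mul_I (Real.pi * a)
    rwa [Complex.ofReal_mul] at this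
  have hc : -(powCauchyConst a * Complex.exp (Real.pi * a * Complex.I)) ≠ 0 :=
    neg_ne_zero.2 (mul_ne_zero (by exact_mod_cast hk.ne') (Complex.exp_ne_zero _))
  refine exists_analytic_inverse_lowerHalfPlane (b₁ := -Real.pi) (b₂ := Real.pi)
    (η₀ := Real.pi - Real.pi / (2 * a)) (α := a)
    (c₀ := -(powCauchyConst a * Complex.exp (Real.pi * a * Complex.I))) (isOpen_betaRegion σ _)
    (isPreconnected_betaRegion hσ0.ne' hσ1' hπ le_rfl)
    ((analyticOnNhd_betaCauchy hp hσ0.ne' ha0' ha1).mono inter_subset_left) le_rfl le_rfl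
    ⟨by nlinarith, by linarith [div_pos hπ (show 0 < 2 * a by linarith)]⟩ ha0' hc
    (eventually_mem_betaRegion_of_mem_cSector hσ0)
    ((tendsto_cpow_mul_betaCauchy_of_pos ha ha1 hσ0 hσ1 (by linarith)).mono_left
      (nhdsWithin_mono _ fun z hz => hz.1)) (fun η hη' h => ?_) hbd
    ⟨Complex.I, hsub (by simp), betaCauchy_im_neg_of_im_pos hp hσ0.ne' ha0' ha1 (by simp)⟩
  have h1 : Complex.exp ((a * η : ℝ) * Complex.I) * Complex.I =
      Complex.exp ((Real.pi * a : ℝ) * Complex.I) := by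
    rw [norm_neg, norm_mul, hexp, Complex.norm_real, Real.norm_of_nonneg hk.le, mul_one,
      neg_div, mul_div_cancel_left₀ _ (by exact_mod_cast hk.ne')] at h
    push_cast at h ⊢
    linear_combination -h
  have h2 := congrArg Complex.im h1
  have h3 := congrArg Complex.re h1
  simp only [Complex.mul_im, Complex.mul_re, Complex.exp_ofReal_mul_I_re,
    Complex.exp_ofReal_mul_I_im, Complex.I_re, Complex.I_im] at h2 h3
  have h5 : Real.cos (a * η + Real.pi / 2 - Real.pi * a) = 1 := by
    rw [Real.cos_sub, Real.cos_add_pi_div_two, Real.sin_add_pi_div_two]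
    simp only [mul_one, mul_zero] at h2 h3
    rw [show -Real.sin (a * η) = Real.cos (Real.pi * a) by linarith,
      show Real.cos (a * η) = Real.sin (Real.pi * a) by linarith]
    linarith [Real.sin_sq_add_cos_sq (Real.pi * a)]
  have h6 : a * -Real.pi ≤ a * η := mul_le_mul_of_nonneg_left hη'.1 ha0'.le
  have h7 : a * η ≤ a * Real.pi := mul_le_mul_of_nonneg_left hη'.2 ha0'.le
  have h8 := (Real.cos_eq_one_iff_of_lt_of_lt (by nlinarith) (by nlinarith)).1 h5
  exact mul_left_cancel₀ ha0'.ne' (by linarith)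
end

theorem betaFun_pos {p q : ℝ} (hp : 0 < p) (hq : 0 < q) : 0 < betaFun p q :=
  div_pos (mul_pos (Real.Gamma_pos_of_pos hp) (Real.Gamma_pos_of_pos hq))
    (Real.Gamma_pos_of_pos (add_pos hp hq))

section
variable {p : ℝ}

theorem betaMeasure_three_halves (p : ℝ) : betaMeasure p (3 / 2) =
    (volume.restrict (Ioi 0)).withDensity
      (fun x => ENNReal.ofReal (betaDens p 1 x / betaFun p (3 / 2))) := by
  rw [← withDensity_indicator measurableSet_Ioi, betaMeasure]
  congr 1
  ext x
  by_cases hx : x ∈ Ioi (0 : ℝ)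
  · rw [indicator_of_mem hx]
    rcases lt_or_ge x 1 with h | h
    · rw [indicator_of_mem (show x ∈ Ioo 0 1 from ⟨hx, h⟩), betaDens, Real.rpow_one, mul_one,
        Real.sqrt_eq_rpow]
      norm_num
    · rw [indicator_of_notMem (fun h' => absurd h'.2 (not_lt.2 h)), betaDens, Real.rpow_one,
        Real.sqrt_eq_zero_of_nonpos (by linarith), mul_zero, zero_div]
  · rw [indicator_of_notMem hx, indicator_of_notMem (fun h' => hx h'.1), ENNReal.ofReal_zero]

theorem betaDens_div_nonneg (hp : 0 < p) :
    ∀ᵐ x ∂volume.restrict (Ioi (0 : ℝ)), 0 ≤ betaDens p 1 x / betaFun p (3 / 2) :=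
  (ae_restrict_iff' measurableSet_Ioi).2 (ae_of_all _ fun _ hx =>
    div_nonneg (betaDens_nonneg hx) (betaFun_pos hp (by norm_num)).le)

theorem isFiniteMeasure_betaMeasure (hp : 0 < p) : IsFiniteMeasure (betaMeasure p (3 / 2)) := by
  rw [betaMeasure_three_halves]
  exact isFiniteMeasure_withDensity_ofReal ((integrableOn_betaDens_one hp).div_const _).2

theorem betaMeasure_real_univ_pos (hp : 0 < p) : 0 < (betaMeasure p (3 / 2)).real univ := by
  have hB := betaFun_pos hp (show (0 : ℝ) < 3 / 2 by norm_num)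
  have h := integral_betaDens_pos hp one_ne_zero
  rw [betaMeasure_three_halves, measureReal_def, withDensity_apply _ MeasurableSet.univ,
    Measure.restrict_univ, ← ofReal_integral_eq_lintegral_ofReal
      ((integrableOn_betaDens_one hp).div_const _) (betaDens_div_nonneg hp),
    integral_div, ENNReal.toReal_ofReal (by positivity)]
  positivity

theorem cauchyTransform_map_betaMeasure (hp : 0 < p) {r : ℝ} (hr : r ≠ 0) (z : ℂ) :
    cauchyTransform (Measure.map (fun x : ℝ => x ^ r) (betaMeasure p (3 / 2))) z =
      ((|r⁻¹| / betaFun p (3 / 2) : ℝ) : ℂ) * halfLineCauchy (betaDens p r⁻¹) z := by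
  have hm : Measurable fun x : ℝ => x ^ r := by fun_prop
  have hm1 : Measurable fun x : ℝ => (z - (x : ℂ))⁻¹ := by fun_prop
  have hm2 : Measurable (betaDens p 1) := by unfold betaDens; fun_prop
  rw [cauchyTransform, integral_map hm.aemeasurable hm1.aestronglyMeasurable,
    betaMeasure_three_halves, integral_withDensity_eq_integral_toReal_smul (by fun_prop)
      (ae_of_all _ fun _ => ENNReal.ofReal_lt_top)]
  rw [← integral_comp_rpow_Ioi _ (inv_ne_zero hr), halfLineCauchy, ← integral_const_mul]
  refine setIntegral_congr_fun measurableSet_Ioi fun t ht => ?_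
  have ht0 : (0 : ℝ) < t := ht
  have h1 := betaDens_eq_comp (p := p) (σ := r⁻¹) ht0
  have h2 : (t ^ r⁻¹) ^ r = t := by rw [← Real.rpow_mul ht0.le, inv_mul_cancel₀ hr, Real.rpow_one]
  have hB := betaFun_pos hp (show (0 : ℝ) < 3 / 2 by norm_num)
  rw [ENNReal.toReal_ofReal (div_nonneg (betaDens_nonneg (Real.rpow_pos_of_pos ht0 _)) hB.le), h2,
    smul_smul, ← mul_assoc, Complex.real_smul, ← Complex.ofReal_mul]
  congr 2
  rw [smul_eq_mul] at h1
  rw [div_mul_eq_mul_div, h1]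
  ring

theorem isUI_map_betaMeasure (hp : 0 < p) {r : ℝ} (hr : r ≠ 0) {g : ℂ → ℂ}
    (hg : ∀ z : ℂ, 0 < z.im → g z = halfLineCauchy (betaDens p r⁻¹) z)
    (h : ∃ D : Set ℂ, {z | 0 < z.im} ⊆ D ∧ ∃ F : ℂ → ℂ, AnalyticOnNhd ℂ F {z | z.im < 0} ∧
      (∀ w, w.im < 0 → F w ∈ D ∧ g (F w) = w) ∧ ∀ z ∈ D, (g z).im < 0 → F (g z) = z) :
    IsUI (Measure.map (fun x : ℝ => x ^ r) (betaMeasure p (3 / 2))) := by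
  obtain ⟨D, hD, F, hFa, hF1, hF2⟩ := h
  set c : ℝ := |r⁻¹| / betaFun p (3 / 2) with hc
  have hc0 : 0 < c := div_pos (abs_pos.2 (inv_ne_zero hr)) (betaFun_pos hp (by norm_num))
  have hc0' : (c : ℂ) ≠ 0 := by exact_mod_cast hc0.ne'
  have hG : ∀ z : ℂ, 0 < z.im →
      cauchyTransform (Measure.map (fun x : ℝ => x ^ r) (betaMeasure p (3 / 2))) z = c * g z :=
    fun z hz => by rw [cauchyTransform_map_betaMeasure hp hr, hg z hz]
  have him : ∀ w : ℂ, w.im < 0 → (((c⁻¹ : ℝ) : ℂ) * w).im < 0 := fun w hw => by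
    rw [Complex.im_ofReal_mul]
    exact mul_neg_of_pos_of_neg (inv_pos.2 hc0) hw
  have hcc : ∀ w : ℂ, (c : ℂ) * (((c⁻¹ : ℝ) : ℂ) * w) = w := fun w => by
    push_cast; field_simp
  have hcc' : ∀ w : ℂ, ((c⁻¹ : ℝ) : ℂ) * ((c : ℂ) * w) = w := fun w => by
    push_cast; field_simp
  have hFc : AnalyticOnNhd ℂ (fun w => F (((c⁻¹ : ℝ) : ℂ) * w)) {w | w.im < 0} := fun w hw =>
    (hFa _ (him w hw)).fun_comp (f := fun w => ((c⁻¹ : ℝ) : ℂ) * w) (by fun_prop)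
  refine ⟨fun w => F (((c⁻¹ : ℝ) : ℂ) * w), hFc, fun w hw w' hw' hww => ?_, ?_⟩
  · have h1 := (hF1 _ (him w hw)).2
    have h2 := (hF1 _ (him w' hw')).2
    beta_reduce at hww
    rw [hww, h2] at h1
    rw [← hcc w, ← h1, hcc]
  · have := isFiniteMeasure_betaMeasure hp
    have hm : Measurable fun x : ℝ => x ^ r := by fun_prop
    have := Measure.isFiniteMeasure_map (betaMeasure p (3 / 2)) fun x : ℝ => x ^ r
    refine exists_triangular_of_leftInverse ?_ (tendsto_mul_cauchyTransform _) hFc.continuousOn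
      (fun z hz hz1 => ?_) fun w hw hw1 => ?_
    · rw [map_measureReal_apply hm MeasurableSet.univ]
      exact betaMeasure_real_univ_pos hp
    · rw [hG z hz] at hz1 ⊢
      rw [hcc']
      rw [Complex.im_ofReal_mul] at hz1
      exact hF2 z (hD hz) (neg_of_mul_neg_right hz1 hc0.le)
    · rw [hG _ hw1, (hF1 _ (him w hw)).2, hcc]
end

theorem isUI_map_betaMeasure_of_le_neg_one {p r : ℝ} (hp : 0 < p) (hr : r ≤ -1) :
    IsUI (Measure.map (fun x : ℝ => x ^ r) (betaMeasure p (3 / 2))) := by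
  have hr0 : r < 0 := by linarith
  have hσ0 : r⁻¹ < 0 := inv_lt_zero.2 hr0
  have hσ1 : -1 ≤ r⁻¹ := by
    rw [← neg_le_neg_iff, neg_neg, ← inv_neg]
    exact inv_le_one_of_one_le₀ (by linarith)
  exact isUI_map_betaMeasure hp hr0.ne
    (fun z hz => betaCauchy_of_im_pos hp hσ0.ne (by norm_num) (by norm_num) hz)
    (exists_inverse_betaCauchy_of_neg hp hσ0 hσ1)

theorem isUI_map_betaMeasure_of_one_le {p r : ℝ} (hp : 0 < p) (hp1 : p ≤ 1 / 2) (hr : 1 ≤ r) :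
    IsUI (Measure.map (fun x : ℝ => x ^ r) (betaMeasure p (3 / 2))) := by
  have hr0 : 0 < r := by linarith
  have hσ0 : 0 < r⁻¹ := inv_pos.2 hr0
  have hσ1 : r⁻¹ ≤ 1 := inv_le_one_of_one_le₀ hr
  exact isUI_map_betaMeasure hp hr0.ne'
    (fun z hz => betaCauchy_of_im_pos hp hσ0.ne' (by nlinarith) (by nlinarith) hz)
    (exists_inverse_betaCauchy_of_pos hp hp1 hσ0 hσ1)

/-- If `B_p ~ β_{p,3/2}`, then (i) for `0 < p ≤ 1/2`, `B_p^r ∈ UI` for every `|r| ≥ 1`;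
(ii) for `p > 1/2`, `B_p^r ∈ UI` for every `r ≤ -1`. -/
theorem beta_power_UI (p : ℝ) (hp : 0 < p) :
    (p ≤ 1 / 2 → ∀ r : ℝ, 1 ≤ |r| →
      IsUI (Measure.map (fun x : ℝ => x ^ r) (betaMeasure p (3 / 2)))) ∧
    (1 / 2 < p → ∀ r : ℝ, r ≤ -1 →
      IsUI (Measure.map (fun x : ℝ => x ^ r) (betaMeasure p (3 / 2)))) := by
  refine ⟨fun hp1 r hr => ?_, fun _ r hr => isUI_map_betaMeasure_of_le_neg_one hp hr⟩
  rcases le_abs.1 hr with h | h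
  · exact isUI_map_betaMeasure_of_one_le hp hp1 h
  · exact isUI_map_betaMeasure_of_le_neg_one hp (by linarith)
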